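/- For a primitive AVRC: if the marginal channel W_{Y_1|X,S} is non-symmetrizable and C_1 > 0, then the deterministic code capacity coincides with the random code capacity, C(AVRC) = C*(AVRC), and consequently R_DF* ≤ C(AVRC) ≤ R_CS*. -/

import Mathlib

open scoped BigOperators ENNReal

noncomputable section

/-- `p` is a probability mass function on a finite type. -/
def IsPMF {α : Type} [Fintype α] (p : α → ℝ) : Prop :=
  (∀ a, 0 ≤ p a) ∧ ∑ a, p a = 1

/-- `W` is a channel: each `W x s` is a pmf on the output alphabet. -/
def IsChannel {𝒳 𝒮 𝒵 : Type} [Fintype 𝒵] (W : 𝒳 → 𝒮 → 𝒵 → ℝ) : Prop :=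
  ∀ x s, IsPMF (W x s)

/-- Shannon entropy (base 2). By the convention `log₂ 0 = 0` in Mathlib, terms with
`p a = 0` contribute `0`. -/
def ent {α : Type} [Fintype α] (p : α → ℝ) : ℝ :=
  -∑ a, p a * Real.logb 2 (p a)

/-- Mutual information of a joint pmf on a product of finite types. -/
def mutInfo {α β : Type} [Fintype α] [Fintype β] (p : α × β → ℝ) : ℝ :=
  ent (fun a => ∑ b, p (a, b)) + ent (fun b => ∑ a, p (a, b)) - ent p

/-- Conditional mutual information `I(X;Y|U)` of a joint pmf on `U × X × Y`,
via `I(X;Y|U) = H(U,X) + H(U,Y) − H(U,X,Y) − H(U)`. -/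
def condMutInfo {υ α β : Type} [Fintype υ] [Fintype α] [Fintype β]
    (p : υ × α × β → ℝ) : ℝ :=
  ent (fun ua : υ × α => ∑ b, p (ua.1, ua.2, b))
    + ent (fun ub : υ × β => ∑ a, p (ub.1, a, ub.2))
    - ent p
    - ent (fun u : υ => ∑ a, ∑ b, p (u, a, b))

section InfoQuantities

variable {𝒳 𝒮 𝒴 𝒴₁ : Type} [Fintype 𝒳] [Fintype 𝒮] [Fintype 𝒴] [Fintype 𝒴₁]

/-- `I_q(X;Y)` under input pmf `p(x)`, state pmf `q(s)` and channel `W`. -/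
def IqXY (W : 𝒳 → 𝒮 → 𝒴 × 𝒴₁ → ℝ) (p : 𝒳 → ℝ) (q : 𝒮 → ℝ) : ℝ :=
  mutInfo (fun xy : 𝒳 × 𝒴 => p xy.1 * ∑ s, q s * ∑ y1, W xy.1 s (xy.2, y1))

/-- `I_q(X;Y,Y₁)`. -/
def IqXYY1 (W : 𝒳 → 𝒮 → 𝒴 × 𝒴₁ → ℝ) (p : 𝒳 → ℝ) (q : 𝒮 → ℝ) : ℝ :=
  mutInfo (fun xz : 𝒳 × (𝒴 × 𝒴₁) => p xz.1 * ∑ s, q s * W xz.1 s xz.2)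

/-- `I_q(U;Y)` under input pmf `p(u,x)` (auxiliary alphabet `Fin k`). -/
def IqUY {k : ℕ} (W : 𝒳 → 𝒮 → 𝒴 × 𝒴₁ → ℝ) (p : Fin k × 𝒳 → ℝ) (q : 𝒮 → ℝ) : ℝ :=
  mutInfo (fun uy : Fin k × 𝒴 => ∑ x, ∑ s, ∑ y1, p (uy.1, x) * q s * W x s (uy.2, y1))

/-- `I_q(U;Y₁)` under input pmf `p(u,x)`. -/
def IqUY1 {k : ℕ} (W : 𝒳 → 𝒮 → 𝒴 × 𝒴₁ → ℝ) (p : Fin k × 𝒳 → ℝ) (q : 𝒮 → ℝ) : ℝ :=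
  mutInfo (fun uy : Fin k × 𝒴₁ => ∑ x, ∑ s, ∑ y, p (uy.1, x) * q s * W x s (y, uy.2))

/-- `I_q(X;Y|U)` under input pmf `p(u,x)`. -/
def IqXYgivenU {k : ℕ} (W : 𝒳 → 𝒮 → 𝒴 × 𝒴₁ → ℝ) (p : Fin k × 𝒳 → ℝ) (q : 𝒮 → ℝ) : ℝ :=
  condMutInfo (fun uxy : Fin k × 𝒳 × 𝒴 =>
    p (uxy.1, uxy.2.1) * ∑ s, q s * ∑ y1, W uxy.2.1 s (uxy.2.2, y1))

/-- The partial decode-forward lower bound `R_DF(Q)`: the supremum over all finite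
auxiliary alphabets (represented by `Fin k`) and input pmfs `p(u,x)` of
`min{ inf_q I_q(U;Y) + inf_q I_q(X;Y|U) + C₁, inf_q I_q(U;Y₁) + inf_q I_q(X;Y|U) }`. -/
def RDF (W : 𝒳 → 𝒮 → 𝒴 × 𝒴₁ → ℝ) (C1 : ℝ) (Q : Set (𝒮 → ℝ)) : ℝ :=
  sSup {r | ∃ (k : ℕ) (p : Fin k × 𝒳 → ℝ), IsPMF p ∧
    r = min
      (sInf {v | ∃ q ∈ Q, v = IqUY W p q} + sInf {v | ∃ q ∈ Q, v = IqXYgivenU W p q} + C1)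
      (sInf {v | ∃ q ∈ Q, v = IqUY1 W p q} + sInf {v | ∃ q ∈ Q, v = IqXYgivenU W p q})}

/-- The cutset upper bound
`R_CS(Q) = inf_{q∈Q} max_{p(x)} min{ I_q(X;Y) + C₁, I_q(X;Y,Y₁) }`. -/
def RCS (W : 𝒳 → 𝒮 → 𝒴 × 𝒴₁ → ℝ) (C1 : ℝ) (Q : Set (𝒮 → ℝ)) : ℝ :=
  sInf {r | ∃ q ∈ Q, r = sSup {v | ∃ p : 𝒳 → ℝ, IsPMF p ∧
    v = min (IqXY W p q + C1) (IqXYY1 W p q)}}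

end InfoQuantities

/-- A deterministic code for the primitive relay channel: a message encoder, a relay
function mapping the relay's received block to one of `L` indices sent over the
noiseless link, and a decoder using the channel output together with that index. -/
structure PCode (𝒳 𝒴 𝒴₁ : Type) (n M L : ℕ) where
  f : Fin M → Fin n → 𝒳
  f1 : (Fin n → 𝒴₁) → Fin L
  g : (Fin n → 𝒴) × Fin L → Fin M

/-- The noiseless link of rate `C₁` supports `L` indices when `L ≤ 2^{nC₁}`. -/
def LinkOK (n L : ℕ) (C1 : ℝ) : Prop := 1 ≤ L ∧ (L : ℝ) ≤ (2 : ℝ) ^ ((n : ℝ) * C1)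

section Codes

variable {𝒳 𝒮 𝒴 𝒴₁ : Type} [Fintype 𝒳] [Fintype 𝒮] [Fintype 𝒴] [Fintype 𝒴₁]
variable {n M L : ℕ}

/-- Conditional probability of error of the code given the state sequence `s`. -/
def PCode.errGiven (C : PCode 𝒳 𝒴 𝒴₁ n M L) (W : 𝒳 → 𝒮 → 𝒴 × 𝒴₁ → ℝ)
    (s : Fin n → 𝒮) : ℝ :=
  (M : ℝ)⁻¹ * ∑ m : Fin M, ∑ y : Fin n → 𝒴, ∑ y1 : Fin n → 𝒴₁,
    if C.g (y, C.f1 y1) = m then 0 else ∏ i, W (C.f m i) (s i) (y i, y1 i)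

/-- Average error probability under an i.i.d. state distribution `q`. -/
def PCode.errIID (C : PCode 𝒳 𝒴 𝒴₁ n M L) (W : 𝒳 → 𝒮 → 𝒴 × 𝒴₁ → ℝ)
    (q : 𝒮 → ℝ) : ℝ :=
  ∑ s : Fin n → 𝒮, (∏ i, q (s i)) * C.errGiven W s

/-- Average error probability under an arbitrary joint state distribution `qn`. -/
def PCode.errJoint (C : PCode 𝒳 𝒴 𝒴₁ n M L) (W : 𝒳 → 𝒮 → 𝒴 × 𝒴₁ → ℝ)
    (qn : (Fin n → 𝒮) → ℝ) : ℝ :=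
  ∑ s : Fin n → 𝒮, qn s * C.errGiven W s

end Codes

section Capacities

variable {𝒳 𝒮 𝒴 𝒴₁ : Type} [Fintype 𝒳] [Fintype 𝒮] [Fintype 𝒴] [Fintype 𝒴₁]

/-- `R` is achievable by deterministic codes over the compound primitive relay
channel with state set `Q`. -/
def CompAchievable (W : 𝒳 → 𝒮 → 𝒴 × 𝒴₁ → ℝ) (C1 : ℝ) (Q : Set (𝒮 → ℝ)) (R : ℝ) : Prop :=
  ∀ ε > (0 : ℝ), ∃ N : ℕ, ∀ n ≥ N, ∃ (M L : ℕ) (C : PCode 𝒳 𝒴 𝒴₁ n M L),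
    (2 : ℝ) ^ ((n : ℝ) * R) ≤ (M : ℝ) ∧ LinkOK n L C1 ∧
    ∀ q ∈ Q, C.errIID W q ≤ ε

/-- The deterministic code capacity of the compound primitive relay channel. -/
def CompCapacity (W : 𝒳 → 𝒮 → 𝒴 × 𝒴₁ → ℝ) (C1 : ℝ) (Q : Set (𝒮 → ℝ)) : ℝ :=
  sSup {R | CompAchievable W C1 Q R}

/-- `R` is achievable by random codes over the compound primitive relay channel. -/
def CompRandAchievable (W : 𝒳 → 𝒮 → 𝒴 × 𝒴₁ → ℝ) (C1 : ℝ) (Q : Set (𝒮 → ℝ)) (R : ℝ) :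
    Prop :=
  ∀ ε > (0 : ℝ), ∃ N : ℕ, ∀ n ≥ N, ∃ (M L : ℕ),
    (2 : ℝ) ^ ((n : ℝ) * R) ≤ (M : ℝ) ∧ LinkOK n L C1 ∧
    ∃ (J : Type) (π : PMF J) (Cs : J → PCode 𝒳 𝒴 𝒴₁ n M L),
      ∀ q ∈ Q, (∑' j, π j * ENNReal.ofReal ((Cs j).errIID W q)) ≤ ENNReal.ofReal ε

/-- The random code capacity of the compound primitive relay channel. -/
def CompRandCapacity (W : 𝒳 → 𝒮 → 𝒴 × 𝒴₁ → ℝ) (C1 : ℝ) (Q : Set (𝒮 → ℝ)) : ℝ :=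
  sSup {R | CompRandAchievable W C1 Q R}

/-- `R` is achievable by deterministic codes over the primitive AVRC: the average
error is small under every joint state distribution. -/
def AVRCAchievable (W : 𝒳 → 𝒮 → 𝒴 × 𝒴₁ → ℝ) (C1 R : ℝ) : Prop :=
  ∀ ε > (0 : ℝ), ∃ N : ℕ, ∀ n ≥ N, ∃ (M L : ℕ) (C : PCode 𝒳 𝒴 𝒴₁ n M L),
    (2 : ℝ) ^ ((n : ℝ) * R) ≤ (M : ℝ) ∧ LinkOK n L C1 ∧
    ∀ qn : (Fin n → 𝒮) → ℝ, IsPMF qn → C.errJoint W qn ≤ ε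

/-- The deterministic code capacity of the primitive AVRC. -/
def AVRCCapacity (W : 𝒳 → 𝒮 → 𝒴 × 𝒴₁ → ℝ) (C1 : ℝ) : ℝ :=
  sSup {R | AVRCAchievable W C1 R}

/-- `R` is achievable by random codes over the primitive AVRC. -/
def AVRCRandAchievable (W : 𝒳 → 𝒮 → 𝒴 × 𝒴₁ → ℝ) (C1 R : ℝ) : Prop :=
  ∀ ε > (0 : ℝ), ∃ N : ℕ, ∀ n ≥ N, ∃ (M L : ℕ),
    (2 : ℝ) ^ ((n : ℝ) * R) ≤ (M : ℝ) ∧ LinkOK n L C1 ∧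
    ∃ (J : Type) (π : PMF J) (Cs : J → PCode 𝒳 𝒴 𝒴₁ n M L),
      ∀ qn : (Fin n → 𝒮) → ℝ, IsPMF qn →
        (∑' j, π j * ENNReal.ofReal ((Cs j).errJoint W qn)) ≤ ENNReal.ofReal ε

/-- The random code capacity of the primitive AVRC. -/
def AVRCRandCapacity (W : 𝒳 → 𝒮 → 𝒴 × 𝒴₁ → ℝ) (C1 : ℝ) : ℝ :=
  sSup {R | AVRCRandAchievable W C1 R}

end Capacities

/-- The channel is reversely strongly degraded:
`W(y,y₁|x,s) = W_{Y|X,S}(y|x,s)·W_{Y₁|Y}(y₁|y)`. -/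
def RevStronglyDegraded {𝒳 𝒮 𝒴 𝒴₁ : Type} [Fintype 𝒴] [Fintype 𝒴₁]
    (W : 𝒳 → 𝒮 → 𝒴 × 𝒴₁ → ℝ) : Prop :=
  ∃ (WY : 𝒳 → 𝒮 → 𝒴 → ℝ) (V : 𝒴 → 𝒴₁ → ℝ),
    (∀ x s, IsPMF (WY x s)) ∧ (∀ y, IsPMF (V y)) ∧
    ∀ x s y y1, W x s (y, y1) = WY x s y * V y y1

/-- A state-dependent DMC `V(z|x,s)` is symmetrizable. -/
def Symmetrizable {𝒳 𝒮 𝒵 : Type} [Fintype 𝒮] (V : 𝒳 → 𝒮 → 𝒵 → ℝ) : Prop :=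
  ∃ J : 𝒳 → 𝒮 → ℝ, (∀ x, IsPMF (J x)) ∧
    ∀ x x' z, (∑ s, V x s z * J x' s) = ∑ s, V x' s z * J x s

section ProductSums

variable {ι α β : Type} [Fintype ι] [Fintype α] [Fintype β]

theorem sum_pi_prod_eq [DecidableEq ι] (g : ι → α → ℝ) :
    ∑ f : ι → α, ∏ i, g i (f i) = ∏ i, ∑ a, g i a := by
  rw [Finset.prod_univ_sum, Fintype.piFinset_univ]

theorem sum_pi_prod_eq_one [DecidableEq ι] {w : ι → α → ℝ} (hw : ∀ i, ∑ a, w i a = 1) :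
    ∑ f : ι → α, ∏ i, w i (f i) = 1 := by
  rw [sum_pi_prod_eq]; simp [hw]

theorem sum_pi_prod_mul_apply [DecidableEq ι] {w : ι → α → ℝ} (hw : ∀ i, ∑ a, w i a = 1)
    (i₀ : ι) (F : α → ℝ) :
    ∑ f : ι → α, (∏ i, w i (f i)) * F (f i₀) = ∑ a, w i₀ a * F a := by
  have h : ∀ f : ι → α, (∏ i, w i (f i)) * F (f i₀)
      = ∏ i, w i (f i) * (if i = i₀ then F (f i) else 1) := by
    intro f
    rw [Finset.prod_mul_distrib]
    congr 1
    rw [Finset.prod_eq_single i₀] <;> simp +contextual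
  simp_rw [h]
  rw [sum_pi_prod_eq (fun i a => w i a * (if i = i₀ then F a else 1)),
    Finset.prod_eq_single i₀]
  · simp
  · intro i _ hi
    simp [hi, hw]
  · simp

theorem sum_pi_prod_mul_apply₂ [DecidableEq ι] {w : ι → α → ℝ} (hw : ∀ i, ∑ a, w i a = 1)
    {i₀ i₁ : ι} (hne : i₀ ≠ i₁) (F : α → α → ℝ) :
    ∑ f : ι → α, (∏ i, w i (f i)) * F (f i₀) (f i₁) = ∑ a, ∑ b, w i₀ a * w i₁ b * F a b := by
  classical
  have hF : ∀ f : ι → α, (∏ i, w i (f i)) * F (f i₀) (f i₁)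
      = ∑ b, (∏ i, w i (f i) * (if i = i₁ then (if f i = b then 1 else 0) else 1))
          * F (f i₀) b := by
    intro f
    simp_rw [Finset.prod_mul_distrib, Finset.prod_ite_eq' Finset.univ i₁, mul_assoc]
    simp [Finset.sum_ite_eq]
  simp_rw [hF]
  rw [Finset.sum_comm]
  conv_rhs => rw [Finset.sum_comm]
  refine Finset.sum_congr rfl fun b _ => ?_
  have h : ∀ f : ι → α,
      (∏ i, w i (f i) * (if i = i₁ then (if f i = b then 1 else 0) else 1)) * F (f i₀) b
      = ∏ i, w i (f i) * (if i = i₁ then (if f i = b then (1 : ℝ) else 0) else 1)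
          * (if i = i₀ then F (f i) b else 1) := by
    intro f
    rw [Finset.prod_mul_distrib (g := fun i => if i = i₀ then F (f i) b else 1)]
    congr 1
    rw [Finset.prod_eq_single i₀] <;> simp +contextual
  simp_rw [h]
  rw [sum_pi_prod_eq (fun i a => w i a * (if i = i₁ then (if a = b then (1 : ℝ) else 0) else 1)
          * (if i = i₀ then F a b else 1)),
    ← Finset.mul_prod_erase Finset.univ _ (Finset.mem_univ i₀),
    ← Finset.mul_prod_erase (Finset.univ.erase i₀) _
      (Finset.mem_erase.2 ⟨hne.symm, Finset.mem_univ i₁⟩),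
    Finset.prod_eq_one]
  · simp only [if_neg hne, if_neg hne.symm]
    simp only [if_true, mul_one, mul_ite, mul_zero, Finset.sum_ite_eq', Finset.mem_univ]
    rw [Finset.sum_mul]
    refine Finset.sum_congr rfl fun a _ => ?_
    ring
  · intro i hi
    simp only [Finset.mem_erase, Finset.mem_univ, and_true] at hi
    simp [hi.1, hi.2, hw]

theorem sum_pi_prod_prod_eq [DecidableEq ι] (g : ι → α → β → ℝ) :
    ∑ f : ι → α, ∑ f' : ι → β, ∏ i, g i (f i) (f' i) = ∏ i, ∑ a, ∑ b, g i a b := by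
  rw [← sum_pi_prod_eq (fun i a => ∑ b, g i a b)]
  exact Finset.sum_congr rfl fun f _ => sum_pi_prod_eq (fun i b => g i (f i) b)

theorem isPMF_pi [DecidableEq ι] {w : ι → α → ℝ} (hw : ∀ i, IsPMF (w i)) :
    IsPMF (fun f : ι → α => ∏ i, w i (f i)) :=
  ⟨fun _ => Finset.prod_nonneg fun i _ => (hw i).1 _, sum_pi_prod_eq_one fun i => (hw i).2⟩

theorem IsPMF.sum_mul_le {p : α → ℝ} (hp : IsPMF p) {F : α → ℝ} {c : ℝ} (h : ∀ a, F a ≤ c) :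
    ∑ a, p a * F a ≤ c := by
  calc ∑ a, p a * F a ≤ ∑ a, p a * c :=
        Finset.sum_le_sum fun a _ => mul_le_mul_of_nonneg_left (h a) (hp.1 a)
    _ = c := by rw [← Finset.sum_mul, hp.2, one_mul]

theorem IsPMF.exists_le {p : α → ℝ} (hp : IsPMF p) {F : α → ℝ} {c : ℝ}
    (h : ∑ a, p a * F a ≤ c) : ∃ a, F a ≤ c := by
  by_contra! hc
  have h1 : ∑ a, p a * (F a - c) ≤ 0 := by
    simp_rw [mul_sub, Finset.sum_sub_distrib, ← Finset.sum_mul, hp.2]; linarith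
  have h2 := (Finset.sum_eq_zero_iff_of_nonneg (fun a _ =>
    mul_nonneg (hp.1 a) (sub_nonneg.2 (hc a).le))).1
    (le_antisymm h1 (Finset.sum_nonneg fun a _ =>
      mul_nonneg (hp.1 a) (sub_nonneg.2 (hc a).le)))
  have h3 : ∀ a, p a = 0 := fun a => by
    have := h2 a (Finset.mem_univ a)
    rcases mul_eq_zero.1 this with h | h
    · exact h
    · linarith [hc a]
  have := hp.2
  simp [h3] at this

theorem IsPMF.nonempty {p : α → ℝ} (hp : IsPMF p) : Nonempty α := by
  by_contra h
  rw [not_nonempty_iff] at h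
  have := hp.2
  simp at this

theorem isPMF_single [DecidableEq α] (a : α) : IsPMF (fun b => if b = a then (1 : ℝ) else 0) :=
  ⟨fun b => by dsimp only; split_ifs <;> norm_num, by simp⟩

/-- A quadratic bound for the moment generating function of a bounded variable. -/
theorem IsPMF.sum_mul_exp_le {p : α → ℝ} (hp : IsPMF p) {φ : α → ℝ} {B l : ℝ}
    (hB : ∀ a, |φ a| ≤ B) (hl : 0 ≤ l) (hlB : l * B ≤ 1) :
    ∑ a, p a * Real.exp (-(l * φ a)) ≤ 1 - l * ∑ a, p a * φ a + l ^ 2 * B ^ 2 := by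
  have h : ∀ a, Real.exp (-(l * φ a)) ≤ 1 - l * φ a + l ^ 2 * B ^ 2 := by
    intro a
    have h1 : |(-(l * φ a))| ≤ 1 := by
      rw [abs_neg, abs_mul, abs_of_nonneg hl]
      exact (mul_le_mul_of_nonneg_left (hB a) hl).trans hlB
    have h2 := (abs_le.1 (Real.abs_exp_sub_one_sub_id_le h1)).2
    have h3 : (φ a) ^ 2 ≤ B ^ 2 := sq_le_sq' (abs_le.1 (hB a)).1 (abs_le.1 (hB a)).2
    nlinarith [sq_nonneg l]
  calc ∑ a, p a * Real.exp (-(l * φ a))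
      ≤ ∑ a, p a * (1 - l * φ a + l ^ 2 * B ^ 2) :=
        Finset.sum_le_sum fun a _ => mul_le_mul_of_nonneg_left (h a) (hp.1 a)
    _ = ∑ a, (p a * (1 + l ^ 2 * B ^ 2) - l * (p a * φ a)) :=
        Finset.sum_congr rfl fun a _ => by ring
    _ = _ := by
        rw [Finset.sum_sub_distrib, ← Finset.sum_mul, hp.2, Finset.mul_sum]; ring

end ProductSums

theorem exists_abs_bound {α : Type} [Finite α] (φ : α → ℝ) : ∃ B, 0 < B ∧ ∀ a, |φ a| ≤ B := by
  obtain ⟨B, hB⟩ := (Set.finite_range fun a => |φ a|).bddAbove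
  exact ⟨max B 1, lt_max_of_lt_right one_pos, fun a => le_max_of_le_left (hB ⟨a, rfl⟩)⟩

/-- The slope at which the quadratic moment bound with mean `η` and range `B` drops below one. -/
theorem exists_slope {B η : ℝ} (hB : 0 < B) (hη : 0 < η) :
    ∃ l, 0 < l ∧ l * B ≤ 1 ∧ 1 - l * η + l ^ 2 * B ^ 2 < 1 := by
  refine ⟨min (1 / B) (η / (2 * B ^ 2)), by positivity, ?_, ?_⟩
  · calc _ ≤ 1 / B * B := mul_le_mul_of_nonneg_right (min_le_left _ _) hB.le
      _ = 1 := by field_simp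
  · set l := min (1 / B) (η / (2 * B ^ 2)) with hl
    have h0 : 0 < l := by positivity
    have h1 : l * B ^ 2 ≤ η / 2 := by
      calc _ ≤ η / (2 * B ^ 2) * B ^ 2 := by gcongr; exact min_le_right _ _
        _ = η / 2 := by field_simp
    nlinarith

/-- Chernoff exponent, uniform over a finite family of distributions with positive mean. -/
theorem exists_chernoff {σ α : Type} [Finite σ] [Fintype α] {P : σ → α → ℝ}
    (hP : ∀ s, IsPMF (P s)) {φ : α → ℝ} (hφ : ∀ s, 0 < ∑ a, P s a * φ a) :
    ∃ l ρ : ℝ, 0 < l ∧ 0 ≤ ρ ∧ ρ < 1 ∧ ∀ s, ∑ a, P s a * Real.exp (-(l * φ a)) ≤ ρ := by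
  obtain ⟨B, hB, hφB⟩ := exists_abs_bound φ
  obtain ⟨η, hη, hmean⟩ : ∃ η, 0 < η ∧ ∀ s, η ≤ ∑ a, P s a * φ a := by
    rcases isEmpty_or_nonempty σ with h | h
    · exact ⟨1, one_pos, fun s => (h.false s).elim⟩
    · obtain ⟨s₀, hs₀⟩ := Finite.exists_min fun s => ∑ a, P s a * φ a
      exact ⟨_, hφ s₀, hs₀⟩
  obtain ⟨l, hl, hlB, hlt⟩ := exists_slope hB hη
  have key : ∀ s, ∑ a, P s a * Real.exp (-(l * φ a)) ≤ 1 - l * η + l ^ 2 * B ^ 2 := fun s =>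
    ((hP s).sum_mul_exp_le hφB hl.le hlB).trans (by nlinarith [hmean s])
  refine ⟨l, max 0 (1 - l * η + l ^ 2 * B ^ 2), hl, le_max_left _ _, max_lt one_pos hlt,
    fun s => (key s).trans (le_max_right _ _)⟩

section NonSymmetrizable

variable {𝒳 𝒮 𝒵 : Type} [Fintype 𝒳] [Fintype 𝒮] [Fintype 𝒵]

/-- The obstruction to `J` symmetrizing `V`. -/
def symmDefect (V : 𝒳 → 𝒮 → 𝒵 → ℝ) : (𝒳 → 𝒮 → ℝ) →ₗ[ℝ] (𝒳 × 𝒳 × 𝒵 → ℝ) where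
  toFun J k := ∑ s, (V k.1 s k.2.2 * J k.2.1 s - V k.2.1 s k.2.2 * J k.1 s)
  map_add' J J' := by
    ext k
    simp only [Pi.add_apply, ← Finset.sum_add_distrib]
    exact Finset.sum_congr rfl fun s _ => by ring
  map_smul' c J := by
    ext k
    simp only [Pi.smul_apply, smul_eq_mul, Finset.mul_sum, RingHom.id_apply]
    exact Finset.sum_congr rfl fun s _ => by ring

theorem exists_separating_test [Nonempty 𝒮] {V : 𝒳 → 𝒮 → 𝒵 → ℝ} (hns : ¬ Symmetrizable V) :
    ∃ (h : 𝒳 → 𝒳 → 𝒵 → ℝ) (m : 𝒳 → ℝ), (∀ x x' z, h x x' z = -h x' x z) ∧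
      (∀ x' s, m x' ≤ ∑ x, ∑ z, V x s z * h x x' z) ∧ 0 < ∑ x, m x := by
  classical
  set K : Set (𝒳 → 𝒮 → ℝ) := Set.univ.pi fun _ => stdSimplex ℝ 𝒮 with hK
  have hKc : IsCompact K := isCompact_univ_pi fun _ => isCompact_stdSimplex ℝ 𝒮
  have hKv : Convex ℝ K := convex_pi fun _ _ => convex_stdSimplex ℝ 𝒮
  have himc : IsCompact (symmDefect V '' K) :=
    hKc.image (LinearMap.continuous_of_finiteDimensional _)
  have h0 : (0 : 𝒳 × 𝒳 × 𝒵 → ℝ) ∉ symmDefect V '' K := by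
    rintro ⟨J, hJ, hJ0⟩
    refine hns ⟨J, fun x => ⟨(hJ x trivial).1, (hJ x trivial).2⟩, fun x x' z => ?_⟩
    have := congrFun hJ0 (x, x', z)
    simp only [symmDefect, LinearMap.coe_mk, AddHom.coe_mk, Pi.zero_apply,
      Finset.sum_sub_distrib] at this
    linarith
  obtain ⟨f, u, hf0, hfu⟩ := geometric_hahn_banach_point_closed
    (hKv.linear_image (symmDefect V)) himc.isClosed h0
  rw [map_zero] at hf0
  set e : 𝒳 × 𝒳 × 𝒵 → ℝ := fun k => f (Pi.single k 1) with he
  have hfe : ∀ d : 𝒳 × 𝒳 × 𝒵 → ℝ, f d = ∑ k, d k * e k := by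
    intro d
    conv_lhs => rw [pi_eq_sum_univ' d]
    simp only [map_sum, map_smul, smul_eq_mul]
    rfl
  set h : 𝒳 → 𝒳 → 𝒵 → ℝ := fun x x' z => e (x, x', z) - e (x', x, z) with hh
  choose smin hsmin using fun x' : 𝒳 =>
    Finite.exists_min fun s : 𝒮 => ∑ x, ∑ z, V x s z * h x x' z
  refine ⟨h, fun x' => ∑ x, ∑ z, V x (smin x') z * h x x' z, fun x x' z => by simp [hh],
    hsmin, ?_⟩
  have hJ : (fun (x : 𝒳) (s : 𝒮) => if s = smin x then (1 : ℝ) else 0) ∈ K :=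
    fun x _ => ⟨(isPMF_single (smin x)).1, (isPMF_single (smin x)).2⟩
  have hpos := hf0.trans (hfu _ ⟨_, hJ, rfl⟩)
  rw [hfe] at hpos
  refine hpos.trans_eq ?_
  simp only [symmDefect, LinearMap.coe_mk, AddHom.coe_mk, Fintype.sum_prod_type,
    Finset.sum_sub_distrib, mul_ite, mul_one, mul_zero, Finset.sum_ite_eq', Finset.mem_univ,
    if_true, sub_mul, hh, mul_sub]
  congr 1
  exact Finset.sum_comm

/-- An exponential version of the separating test, averaged over a uniform true symbol. -/
theorem exists_exp_test [Nonempty 𝒮] [Nonempty 𝒳] {V : 𝒳 → 𝒮 → 𝒵 → ℝ}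
    (hV : IsChannel V) (hns : ¬ Symmetrizable V) :
    ∃ (h : 𝒳 → 𝒳 → 𝒵 → ℝ) (r : 𝒳 → ℝ) (ρ : ℝ), (∀ x x' z, h x x' z = -h x' x z) ∧
      (∀ x' s, ∑ x, ∑ z, V x s z * Real.exp (-h x x' z) ≤ (Fintype.card 𝒳 : ℝ) * r x') ∧
      (∀ x, 0 ≤ r x) ∧ ∑ x, r x = (Fintype.card 𝒳 : ℝ) * ρ ∧ ρ < 1 := by
  obtain ⟨h, m, hanti, hm, hmpos⟩ := exists_separating_test hns
  obtain ⟨B, hB, hhB⟩ := exists_abs_bound fun k : 𝒳 × 𝒳 × 𝒵 => h k.1 k.2.1 k.2.2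
  set c : ℝ := ((Fintype.card 𝒳 : ℕ) : ℝ) with hc
  have hcpos : 0 < c := by simp [hc, Fintype.card_pos]
  obtain ⟨l, hl, hlB, hlt⟩ := exists_slope hB
    (show 0 < (∑ x, m x) / c ^ 2 by positivity)
  have key : ∀ x' s, ∑ x, ∑ z, V x s z * Real.exp (-(l * h x x' z))
      ≤ c * (1 - l * (m x' / c) + l ^ 2 * B ^ 2) := by
    intro x' s
    have hP : IsPMF fun k : 𝒳 × 𝒵 => V k.1 s k.2 / c := by
      refine ⟨fun k => div_nonneg ((hV _ _).1 _) hcpos.le, ?_⟩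
      rw [Fintype.sum_prod_type]
      simp only [← Finset.sum_div, (hV _ s).2]
      rw [Finset.sum_const, Finset.card_univ, nsmul_eq_mul, ← hc]
      field_simp
    have h1 := hP.sum_mul_exp_le (φ := fun k => h k.1 x' k.2)
      (fun k => hhB (k.1, x', k.2)) hl.le hlB
    have e1 : ∑ k : 𝒳 × 𝒵, V k.1 s k.2 / c * Real.exp (-(l * h k.1 x' k.2))
        = (∑ x, ∑ z, V x s z * Real.exp (-(l * h x x' z))) / c := by
      rw [Fintype.sum_prod_type]
      simp_rw [Finset.sum_div]
      exact Finset.sum_congr rfl fun x _ => Finset.sum_congr rfl fun z _ => by ring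
    have e2 : ∑ k : 𝒳 × 𝒵, V k.1 s k.2 / c * h k.1 x' k.2
        = (∑ x, ∑ z, V x s z * h x x' z) / c := by
      rw [Fintype.sum_prod_type]
      simp_rw [Finset.sum_div]
      exact Finset.sum_congr rfl fun x _ => Finset.sum_congr rfl fun z _ => by ring
    rw [e1, e2, div_le_iff₀ hcpos] at h1
    refine h1.trans ?_
    rw [mul_comm]
    gcongr
    exact hm x' s
  refine ⟨fun x x' z => l * h x x' z, fun x' => 1 - l * (m x' / c) + l ^ 2 * B ^ 2,
    1 - l * ((∑ x, m x) / c ^ 2) + l ^ 2 * B ^ 2, fun x x' z => by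
      simp only [hanti x x' z, mul_neg], key,
    fun x' => ?_, ?_, hlt⟩
  · have s : 𝒮 := Classical.arbitrary 𝒮
    refine nonneg_of_mul_nonneg_right (le_trans ?_ (key x' s)) hcpos
    exact Finset.sum_nonneg fun x _ => Finset.sum_nonneg fun z _ =>
      mul_nonneg ((hV _ _).1 _) (Real.exp_pos _).le
  · simp only [Finset.sum_add_distrib, Finset.sum_sub_distrib, Finset.sum_const,
      Finset.card_univ, nsmul_eq_mul, ← hc, ← Finset.mul_sum, ← Finset.sum_div]
    field_simp

end NonSymmetrizable

section Codebook

theorem exp_min_one_le {t : ℝ} (ht : 0 ≤ t) : Real.exp (min 1 t) ≤ 1 + 2 * t := by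
  have h0 : 0 ≤ min 1 t := le_min zero_le_one ht
  have h1 : |min 1 t| ≤ 1 := by rw [abs_of_nonneg h0]; exact min_le_left _ _
  have h2 := (abs_le.1 (Real.abs_exp_sub_one_sub_id_le h1)).2
  nlinarith [min_le_left 1 t, min_le_right 1 t]

variable {α σ : Type} [Fintype α] [Fintype σ]

theorem sum_exp_previous_le {a : α → α → ℝ} (ha : ∀ x x', 0 ≤ a x x') {κ : ℝ} (hκ0 : 0 ≤ κ)
    (hκ : ∀ x', ∑ x, a x x' ≤ κ * Fintype.card α) (k₀ : ℕ) {k : ℕ} (hk : k ≤ k₀) :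
    ∑ c : Fin k → α, Real.exp (∑ i, min 1 (∑ j, if j < i then a (c i) (c j) else 0))
      ≤ (Fintype.card α * (1 + 2 * (k₀ * κ))) ^ k := by
  induction k with
  | zero => simp
  | succ k ih =>
    have ih := ih (by omega)
    rw [← (Fin.snocEquiv fun _ : Fin (k + 1) => α).sum_comp, Fintype.sum_prod_type,
      Finset.sum_comm]
    have hstep : ∀ (c : Fin k → α),
        ∑ x : α, Real.exp (min 1 (∑ j, a x (c j)))
          ≤ Fintype.card α * (1 + 2 * (k₀ * κ)) := by
      intro c
      calc ∑ x : α, Real.exp (min 1 (∑ j, a x (c j)))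
          ≤ ∑ x : α, (1 + 2 * ∑ j, a x (c j)) := Finset.sum_le_sum fun x _ =>
            exp_min_one_le (Finset.sum_nonneg fun j _ => ha _ _)
        _ = Fintype.card α + 2 * ∑ j, ∑ x, a x (c j) := by
            rw [Finset.sum_add_distrib, ← Finset.mul_sum, Finset.sum_comm]; simp
        _ ≤ Fintype.card α + 2 * ∑ j : Fin k, κ * Fintype.card α := by
            gcongr with j
            exact hκ _
        _ = Fintype.card α * (1 + 2 * (k * κ)) := by simp; ring
        _ ≤ _ := by
            have : (k : ℝ) ≤ k₀ := by exact_mod_cast (by omega : k ≤ k₀)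
            gcongr
    calc _ = ∑ c : Fin k → α, Real.exp (∑ i, min 1 (∑ j, if j < i then a (c i) (c j) else 0))
              * ∑ x : α, Real.exp (min 1 (∑ j, a x (c j))) := by
          refine Finset.sum_congr rfl fun c _ => ?_
          rw [Finset.mul_sum]
          refine Finset.sum_congr rfl fun x _ => ?_
          rw [← Real.exp_add]
          congr 1
          simp [Fin.sum_univ_castSucc, Fin.snocEquiv, Fin.castSucc_lt_last,
            (Fin.castSucc_lt_last _).not_gt]
      _ ≤ ∑ c : Fin k → α, Real.exp (∑ i, min 1 (∑ j, if j < i then a (c i) (c j) else 0))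
              * (Fintype.card α * (1 + 2 * (k₀ * κ))) :=
          Finset.sum_le_sum fun c _ => mul_le_mul_of_nonneg_left (hstep c) (Real.exp_pos _).le
      _ ≤ _ := by
          rw [← Finset.sum_mul, pow_succ]
          gcongr

theorem sum_exp_next_le {a : α → α → ℝ} (ha : ∀ x x', 0 ≤ a x x') {κ : ℝ} (hκ0 : 0 ≤ κ)
    (hκ : ∀ x', ∑ x, a x x' ≤ κ * Fintype.card α) (k : ℕ) :
    ∑ c : Fin k → α, Real.exp (∑ i, min 1 (∑ j, if i < j then a (c i) (c j) else 0))
      ≤ (Fintype.card α * (1 + 2 * (k * κ))) ^ k := by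
  refine le_trans (le_of_eq ?_) (sum_exp_previous_le ha hκ0 hκ k le_rfl)
  rw [← (Equiv.arrowCongr (Fin.revPerm (n := k)) (Equiv.refl α)).sum_comp]
  refine Finset.sum_congr rfl fun c _ => ?_
  congr 1
  rw [← Equiv.sum_comp (Fin.revPerm (n := k))]
  refine Finset.sum_congr rfl fun i _ => ?_
  congr 1
  rw [← Equiv.sum_comp (Fin.revPerm (n := k))]
  refine Finset.sum_congr rfl fun j _ => ?_
  simp [Equiv.arrowCongr]

theorem min_one_add_le {x y : ℝ} (hx : 0 ≤ x) (hy : 0 ≤ y) :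
    min 1 (x + y) ≤ min 1 x + min 1 y := by
  rcases min_cases 1 x with h | h <;> rcases min_cases 1 y with h' | h' <;>
    rcases min_cases 1 (x + y) with h'' | h'' <;> linarith

/-- A codebook of `k` words such that, for every parameter `s`, only few words have a
noticeable total confusion probability with the others. -/
theorem exists_codebook [Nonempty α] [Nonempty σ] {a : σ → α → α → ℝ}
    (ha : ∀ s x x', 0 ≤ a s x x') {κ : ℝ} (hκ0 : 0 ≤ κ)
    (hκ : ∀ s x', ∑ x, a s x x' ≤ κ * Fintype.card α) (k : ℕ) :
    ∃ c : Fin k → α, ∀ s, ∑ i, min 1 (∑ j, if j = i then 0 else a s (c i) (c j))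
      ≤ 2 * (Real.log 2 + Real.log (Fintype.card σ) + 2 * k ^ 2 * κ) := by
  set zl : σ → (Fin k → α) → ℝ := fun s c =>
    ∑ i, min 1 (∑ j, if j < i then a s (c i) (c j) else 0) with hzl
  set zg : σ → (Fin k → α) → ℝ := fun s c =>
    ∑ i, min 1 (∑ j, if i < j then a s (c i) (c j) else 0) with hzg
  set T : ℝ := 2 * Fintype.card σ * (1 + 2 * (k * κ)) ^ k with hT
  have htot : ∑ c : Fin k → α, ∑ s, (Real.exp (zl s c) + Real.exp (zg s c))
      ≤ ∑ c : Fin k → α, T := by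
    rw [Finset.sum_comm]
    simp_rw [Finset.sum_add_distrib]
    rw [← Finset.sum_add_distrib]
    calc _ ≤ ∑ s : σ, ((Fintype.card α * (1 + 2 * (k * κ))) ^ k
              + (Fintype.card α * (1 + 2 * (k * κ))) ^ k) :=
          Finset.sum_le_sum fun s _ => add_le_add
            (sum_exp_previous_le (ha s) hκ0 (hκ s) k le_rfl) (sum_exp_next_le (ha s) hκ0 (hκ s) k)
      _ = _ := by simp [hT, mul_pow]; ring
  obtain ⟨c, -, hc⟩ := Finset.exists_le_of_sum_le Finset.univ_nonempty htot
  refine ⟨c, fun s => ?_⟩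
  have hσ : (0 : ℝ) < Fintype.card σ := by simp [Fintype.card_pos]
  have hTlog : Real.log T ≤ Real.log 2 + Real.log (Fintype.card σ) + 2 * k ^ 2 * κ := by
    rw [hT, Real.log_mul (by positivity) (by positivity), Real.log_mul (by norm_num) hσ.ne',
      Real.log_pow]
    have := Real.log_le_sub_one_of_pos (show 0 < 1 + 2 * (k * κ) by positivity)
    have hk : (0 : ℝ) ≤ k := k.cast_nonneg
    nlinarith
  have hs := (Finset.single_le_sum (f := fun s => Real.exp (zl s c) + Real.exp (zg s c))
    (fun s _ => by positivity) (Finset.mem_univ s)).trans hc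
  have h1 : zl s c ≤ Real.log T :=
    (Real.le_log_iff_exp_le (by positivity)).2 (by linarith [Real.exp_pos (zg s c)])
  have h2 : zg s c ≤ Real.log T :=
    (Real.le_log_iff_exp_le (by positivity)).2 (by linarith [Real.exp_pos (zl s c)])
  have h3 : ∑ i, min 1 (∑ j, if j = i then 0 else a s (c i) (c j)) ≤ zl s c + zg s c := by
    rw [hzl, hzg, ← Finset.sum_add_distrib]
    refine Finset.sum_le_sum fun i _ => ?_
    refine le_trans (le_of_eq ?_) (min_one_add_le ?_ ?_)
    · rw [← Finset.sum_add_distrib]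
      congr 1
      refine Finset.sum_congr rfl fun j _ => ?_
      rcases lt_trichotomy j i with h | h | h
      · simp [h, h.ne, h.not_gt]
      · simp [h]
      · simp [h, h.ne', h.not_gt]
    · exact Finset.sum_nonneg fun j _ => by split_ifs <;> simp [ha]
    · exact Finset.sum_nonneg fun j _ => by split_ifs <;> simp [ha]
  linarith

end Codebook

section ArbitrarilyVaryingCode

variable {𝒳 𝒮 𝒵 : Type} [Fintype 𝒵]

theorem sum_coe_le_sum {α : Type} [Fintype α] (A : Finset α) {F : α → ℝ}
    (hF : ∀ a, 0 ≤ F a) : ∑ a : A, F a.1 ≤ ∑ a, F a := by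
  rw [Finset.sum_coe_sort]
  exact Finset.sum_le_sum_of_subset_of_nonneg (Finset.subset_univ _) fun a _ _ => hF a

theorem exists_tournament_decoder {𝒪 : Type} {k : ℕ} (hk : 1 ≤ k) {T : 𝒪 → Fin k → Fin k → ℝ}
    (hT : ∀ z i j, T z i j = -T z j i) :
    ∃ g : 𝒪 → Fin k, ∀ z i, g z ≠ i → ∃ j, j ≠ i ∧ T z i j ≤ 0 := by
  classical
  refine ⟨fun z => if h : ∃ i, ∀ j, j ≠ i → 0 < T z i j then h.choose else ⟨0, hk⟩,
    fun z i hne => ?_⟩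
  by_contra! hcon
  have hex : ∃ i, ∀ j, j ≠ i → 0 < T z i j := ⟨i, hcon⟩
  simp only [dif_pos hex] at hne
  have h1 := hex.choose_spec i hne.symm
  have h2 := hcon _ hne
  rw [hT] at h1
  linarith

theorem exists_many_light_words [Fintype 𝒳] [Nonempty 𝒳] {r : 𝒳 → ℝ} {ρ₀ : ℝ} (hr0 : ∀ x, 0 ≤ r x)
    (hrsum : ∑ x, r x = (Fintype.card 𝒳 : ℝ) * ρ₀) (hρ₀ : ρ₀ < 1) :
    ∃ ρ : ℝ, 0 ≤ ρ ∧ ρ < 1 ∧ ∃ N₁ : ℕ, ∀ N ≥ N₁, ∃ A : Finset (Fin N → 𝒳),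
      (∀ x ∈ A, ∏ t, r (x t) ≤ ρ ^ N) ∧ (Fintype.card 𝒳 : ℝ) ^ N ≤ 2 * A.card := by
  classical
  have hX : (0 : ℝ) < Fintype.card 𝒳 := by simp [Fintype.card_pos]
  have hρ₀0 : 0 ≤ ρ₀ := by
    refine nonneg_of_mul_nonneg_right ?_ hX
    rw [← hrsum]; exact Finset.sum_nonneg fun x _ => hr0 x
  set ρ := (1 + ρ₀) / 2 with hρ
  have hρpos : 0 < ρ := by positivity
  obtain ⟨N₁, hN₁⟩ := exists_pow_lt_of_lt_one (show (0 : ℝ) < 1 / 2 by norm_num)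
    (show ρ₀ / ρ < 1 by rw [div_lt_one hρpos]; linarith)
  refine ⟨ρ, hρpos.le, by linarith, N₁, fun N hN =>
    ⟨Finset.univ.filter fun x => ∏ t, r (x t) ≤ ρ ^ N, fun x hx => (Finset.mem_filter.1 hx).2, ?_⟩⟩
  have hpow : (ρ₀ / ρ) ^ N ≤ 1 / 2 :=
    (pow_le_pow_of_le_one (by positivity) (by rw [div_le_one hρpos]; linarith) hN).trans hN₁.le
  have h1 : ∑ x : Fin N → 𝒳, ∏ t, r (x t) = (Fintype.card 𝒳 * ρ₀) ^ N := by
    rw [sum_pi_prod_eq (fun _ => r)]; simp [hrsum]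
  have h2 : ∑ x : Fin N → 𝒳, (ρ ^ N - ρ ^ N * (if ∏ t, r (x t) ≤ ρ ^ N then 1 else 0))
      ≤ ∑ x : Fin N → 𝒳, ∏ t, r (x t) := by
    refine Finset.sum_le_sum fun x _ => ?_
    split_ifs with hx
    · simpa using Finset.prod_nonneg fun t _ => hr0 (x t)
    · simpa using (not_le.1 hx).le
  rw [Finset.sum_sub_distrib, ← Finset.mul_sum, Finset.sum_boole] at h2
  simp only [Finset.sum_const, Finset.card_univ, Fintype.card_fun, Fintype.card_fin,
    nsmul_eq_mul, Nat.cast_pow] at h2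
  have h5 : (Fintype.card 𝒳 * ρ₀) ^ N = Fintype.card 𝒳 ^ N * (ρ₀ / ρ) ^ N * ρ ^ N := by
    rw [← mul_pow, ← mul_pow]; congr 1; field_simp
  rw [h1, h5, mul_comm (ρ ^ N), ← sub_mul] at h2
  have h6 := le_of_mul_le_mul_right h2 (by positivity)
  have h7 : (0 : ℝ) < (Fintype.card 𝒳 : ℝ) ^ N := by positivity
  nlinarith

/-- Decoding by pairwise antisymmetric tests: the error probability of message `i` is at most
the sum of the exponential moments of its tests against the other messages. -/
theorem exists_decoder_of_exp_test {V : 𝒳 → 𝒮 → 𝒵 → ℝ} (hV : IsChannel V)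
    {h : 𝒳 → 𝒳 → 𝒵 → ℝ} (hanti : ∀ x x' z, h x x' z = -h x' x z) {k N : ℕ} (hk : 1 ≤ k)
    (c : Fin k → Fin N → 𝒳) :
    ∃ g : (Fin N → 𝒵) → Fin k, ∀ (s : Fin N → 𝒮) (i : Fin k),
      ∑ z, (if g z = i then 0 else ∏ t, V (c i t) (s t) (z t))
        ≤ min 1 (∑ j, if j = i then 0 else
            ∏ t, ∑ z, V (c i t) (s t) z * Real.exp (-h (c i t) (c j t) z)) := by
  classical
  obtain ⟨g, hg⟩ := exists_tournament_decoder hk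
    (T := fun (z : Fin N → 𝒵) i j => ∑ t, h (c i t) (c j t) (z t))
    (fun z i j => by
      rw [← Finset.sum_neg_distrib]; exact Finset.sum_congr rfl fun t _ => hanti _ _ _)
  refine ⟨g, fun s i => le_min ?_ ?_⟩
  · refine le_trans (Finset.sum_le_sum (g := fun z => ∏ t, V (c i t) (s t) (z t))
      fun z _ => ?_) ?_
    · split_ifs
      · exact Finset.prod_nonneg fun t _ => (hV _ _).1 _
      · exact le_rfl
    · exact (sum_pi_prod_eq_one (w := fun t => V (c i t) (s t))
        fun t => (hV _ _).2).le
  · have hterm : ∀ j, (if j = i then 0 else 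
            ∏ t, ∑ z, V (c i t) (s t) z * Real.exp (-h (c i t) (c j t) z))
        = ∑ z : Fin N → 𝒵, if j = i then 0 else (∏ t, V (c i t) (s t) (z t))
            * Real.exp (-∑ t, h (c i t) (c j t) (z t)) := by
      intro j
      split_ifs
      · simp
      · rw [← sum_pi_prod_eq
          (fun t z => V (c i t) (s t) z * Real.exp (-h (c i t) (c j t) z))]
        refine Finset.sum_congr rfl fun z _ => ?_
        rw [Finset.prod_mul_distrib, ← Real.exp_sum, Finset.sum_neg_distrib]
    simp_rw [hterm]
    rw [Finset.sum_comm]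
    refine Finset.sum_le_sum fun z _ => ?_
    have hp : 0 ≤ ∏ t, V (c i t) (s t) (z t) := Finset.prod_nonneg fun t _ => (hV _ _).1 _
    have hnn : ∀ j, 0 ≤ (if j = i then 0 else (∏ t, V (c i t) (s t) (z t))
            * Real.exp (-∑ t, h (c i t) (c j t) (z t))) := fun j => by
      split_ifs
      · exact le_rfl
      · exact mul_nonneg hp (Real.exp_pos _).le
    split_ifs with hgz
    · exact Finset.sum_nonneg fun j _ => hnn j
    · obtain ⟨j, hji, hj⟩ := hg z i hgz
      refine le_trans ?_ (Finset.single_le_sum (fun j _ => hnn j) (Finset.mem_univ j))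
      rw [if_neg hji]
      exact le_mul_of_one_le_right hp (Real.one_le_exp (by linarith))

/-- Over a non-symmetrizable channel, `k` messages can be sent with a small average error
at blocklengths that are linear in `log k`, uniformly over the state sequences. -/
theorem exists_avc_code [Fintype 𝒳] [Fintype 𝒮] [Nonempty 𝒮] [Nonempty 𝒳] {V : 𝒳 → 𝒮 → 𝒵 → ℝ}
    (hV : IsChannel V) (hns : ¬ Symmetrizable V) :
    ∃ ρ : ℝ, 0 ≤ ρ ∧ ρ < 1 ∧ ∃ N₁ : ℕ, ∀ N ≥ N₁, ∀ k ≥ 1,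
      ∃ (f : Fin k → Fin N → 𝒳) (g : (Fin N → 𝒵) → Fin k), ∀ s : Fin N → 𝒮,
        ∑ i, ∑ z, (if g z = i then 0 else ∏ t, V (f i t) (s t) (z t))
          ≤ 2 * (Real.log 2 + N * Real.log (Fintype.card 𝒮) + 2 * k ^ 2 * (2 * ρ ^ N)) := by
  classical
  obtain ⟨h, r, ρ₀, hanti, hr, hr0, hrsum, hρ₀⟩ := exists_exp_test hV hns
  obtain ⟨ρ, hρ0, hρ1, N₁, hN₁⟩ := exists_many_light_words hr0 hrsum hρ₀
  refine ⟨ρ, hρ0, hρ1, N₁, fun N hN k hk => ?_⟩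
  obtain ⟨A, hA, hAcard⟩ := hN₁ N hN
  have hX : (0 : ℝ) < Fintype.card 𝒳 := by simp [Fintype.card_pos]
  have hAne : Nonempty A := by
    rw [nonempty_subtype]
    by_contra hcon
    rw [Finset.eq_empty_of_forall_notMem (not_exists.1 hcon)] at hAcard
    have : (0 : ℝ) < (Fintype.card 𝒳 : ℝ) ^ N := by positivity
    simp at hAcard
    linarith
  have hnn : ∀ x x' s, 0 ≤ ∑ z, V x s z * Real.exp (-h x x' z) := fun x x' s =>
    Finset.sum_nonneg fun z _ => mul_nonneg ((hV _ _).1 _) (Real.exp_pos _).le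
  have haκ : ∀ (s : Fin N → 𝒮) (x' : A),
      ∑ x : A, ∏ t, ∑ z, V (x.1 t) (s t) z * Real.exp (-h (x.1 t) (x'.1 t) z)
        ≤ 2 * ρ ^ N * Fintype.card A := by
    intro s x'
    calc _ ≤ ∑ x : Fin N → 𝒳, ∏ t, ∑ z, V (x t) (s t) z * Real.exp (-h (x t) (x'.1 t) z) :=
          sum_coe_le_sum A
            (F := fun x => ∏ t, ∑ z, V (x t) (s t) z * Real.exp (-h (x t) (x'.1 t) z))
            fun x => Finset.prod_nonneg fun t _ => hnn _ _ _
      _ = ∏ t, ∑ x, ∑ z, V x (s t) z * Real.exp (-h x (x'.1 t) z) :=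
          sum_pi_prod_eq (fun t x => ∑ z, V x (s t) z * Real.exp (-h x (x'.1 t) z))
      _ ≤ ∏ t, (Fintype.card 𝒳 * r (x'.1 t)) := Finset.prod_le_prod
          (fun t _ => Finset.sum_nonneg fun x _ => hnn _ _ _) fun t _ => hr _ _
      _ = Fintype.card 𝒳 ^ N * ∏ t, r (x'.1 t) := by
          rw [Finset.prod_mul_distrib, Finset.prod_const, Finset.card_univ, Fintype.card_fin]
      _ ≤ (2 * A.card) * ρ ^ N :=
          mul_le_mul hAcard (hA _ x'.2) (Finset.prod_nonneg fun t _ => hr0 _)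
            (mul_nonneg zero_le_two (Nat.cast_nonneg _))
      _ = _ := by rw [Fintype.card_coe]; ring
  obtain ⟨c, hc⟩ := exists_codebook (σ := Fin N → 𝒮) (α := A)
    (a := fun s x x' => ∏ t, ∑ z, V (x.1 t) (s t) z * Real.exp (-h (x.1 t) (x'.1 t) z))
    (fun s x x' => Finset.prod_nonneg fun t _ => hnn _ _ _) (by positivity) haκ k
  obtain ⟨g, hg⟩ := exists_decoder_of_exp_test hV hanti hk fun i => (c i).1
  refine ⟨fun i => (c i).1, g, fun s => ?_⟩
  have hs := hc s
  rw [Fintype.card_fun, Fintype.card_fin, Nat.cast_pow, Real.log_pow] at hs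
  exact (Finset.sum_le_sum fun i _ => hg s i).trans hs

end ArbitrarilyVaryingCode

section CodeErrors

variable {𝒳 𝒮 𝒴 𝒴₁ : Type} [Fintype 𝒴] [Fintype 𝒴₁] {n M L : ℕ}

theorem sum_prod_channel_eq_one {W : 𝒳 → 𝒮 → 𝒴 × 𝒴₁ → ℝ} (hW : IsChannel W)
    (x : Fin n → 𝒳) (s : Fin n → 𝒮) :
    ∑ y : Fin n → 𝒴, ∑ y1 : Fin n → 𝒴₁, ∏ i, W (x i) (s i) (y i, y1 i) = 1 := by
  rw [sum_pi_prod_prod_eq (fun i y y1 => W (x i) (s i) (y, y1))]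
  simp_rw [← Fintype.sum_prod_type, (hW _ _).2]
  simp

theorem PCode.errGiven_nonneg {W : 𝒳 → 𝒮 → 𝒴 × 𝒴₁ → ℝ} (hW : IsChannel W)
    (C : PCode 𝒳 𝒴 𝒴₁ n M L) (s : Fin n → 𝒮) : 0 ≤ C.errGiven W s := by
  unfold PCode.errGiven
  refine mul_nonneg (by positivity) (Finset.sum_nonneg fun m _ => Finset.sum_nonneg fun y _ =>
    Finset.sum_nonneg fun y1 _ => ?_)
  split_ifs
  · exact le_rfl
  · exact Finset.prod_nonneg fun i _ => (hW _ _).1 _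

theorem PCode.errGiven_le_one {W : 𝒳 → 𝒮 → 𝒴 × 𝒴₁ → ℝ} (hW : IsChannel W)
    (C : PCode 𝒳 𝒴 𝒴₁ n M L) (s : Fin n → 𝒮) : C.errGiven W s ≤ 1 := by
  unfold PCode.errGiven
  have h : ∀ m : Fin M, ∑ y : Fin n → 𝒴, ∑ y1 : Fin n → 𝒴₁,
      (if C.g (y, C.f1 y1) = m then 0 else ∏ i, W (C.f m i) (s i) (y i, y1 i)) ≤ 1 := by
    intro m
    rw [← sum_prod_channel_eq_one hW (C.f m) s]
    refine Finset.sum_le_sum fun y _ => Finset.sum_le_sum fun y1 _ => ?_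
    split_ifs
    · exact Finset.prod_nonneg fun i _ => (hW _ _).1 _
    · exact le_rfl
  calc _ ≤ (M : ℝ)⁻¹ * ∑ m : Fin M, (1 : ℝ) := by gcongr with m; exact h m
    _ ≤ 1 := by
      simp only [Finset.sum_const, Finset.card_univ, Fintype.card_fin, nsmul_eq_mul, mul_one]
      exact inv_mul_le_one

end CodeErrors

section Elimination

variable {σ γ : Type} [Fintype σ]

/-- Multiplicative weights: if against every distribution on `σ` some `c` has mean error at
most `ε`, then a uniform mixture of `k` choices has small error at every point of `σ`. -/
theorem exists_uniform_mixture [Nonempty σ] {e : γ → σ → ℝ} (he0 : ∀ c s, 0 ≤ e c s)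
    (he1 : ∀ c s, e c s ≤ 1) {ε : ℝ} (hε : 0 ≤ ε)
    (h : ∀ q : σ → ℝ, IsPMF q → ∃ c, ∑ s, q s * e c s ≤ ε) (k : ℕ) :
    ∃ cs : Fin k → γ, ∀ s, ∑ i, e (cs i) s ≤ Real.log (Fintype.card σ) + 2 * ε * k := by
  have hσ : (0 : ℝ) < Fintype.card σ := by simp [Fintype.card_pos]
  have key : ∀ k : ℕ, ∃ cs : Fin k → γ,
      ∑ s, Real.exp (∑ i, e (cs i) s) ≤ Fintype.card σ * (1 + 2 * ε) ^ k := by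
    intro k
    induction k with
    | zero => exact ⟨Fin.elim0, by simp⟩
    | succ k ih =>
      obtain ⟨cs, hcs⟩ := ih
      set w : σ → ℝ := fun s => Real.exp (∑ i, e (cs i) s) with hw
      have hwpos : 0 < ∑ s, w s := Finset.sum_pos (fun s _ => Real.exp_pos _)
        Finset.univ_nonempty
      obtain ⟨c, hc⟩ := h (fun s => w s / ∑ s, w s)
        ⟨fun s => div_nonneg (Real.exp_pos _).le hwpos.le, by
          rw [← Finset.sum_div, div_self hwpos.ne']⟩
      have hc' : ∑ s, w s * e c s ≤ ε * ∑ s, w s := by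
        rw [← div_le_iff₀ hwpos, Finset.sum_div]
        refine le_trans (le_of_eq (Finset.sum_congr rfl fun s _ => ?_)) hc
        ring
      refine ⟨Fin.snoc cs c, ?_⟩
      calc ∑ s, Real.exp (∑ i, e (Fin.snoc (α := fun _ => γ) cs c i) s)
          = ∑ s, w s * Real.exp (min 1 (e c s)) := by
            refine Finset.sum_congr rfl fun s _ => ?_
            rw [hw, ← Real.exp_add, min_eq_right (he1 c s)]
            simp [Fin.sum_univ_castSucc]
        _ ≤ ∑ s, w s * (1 + 2 * e c s) := Finset.sum_le_sum fun s _ =>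
            mul_le_mul_of_nonneg_left (exp_min_one_le (he0 c s)) (Real.exp_pos _).le
        _ = ∑ s, w s + 2 * ∑ s, w s * e c s := by
            rw [Finset.mul_sum, ← Finset.sum_add_distrib]
            exact Finset.sum_congr rfl fun s _ => by ring
        _ ≤ (∑ s, w s) * (1 + 2 * ε) := by linarith
        _ ≤ Fintype.card σ * (1 + 2 * ε) ^ k * (1 + 2 * ε) := by gcongr
        _ = _ := by ring
  obtain ⟨cs, hcs⟩ := key k
  refine ⟨cs, fun s => ?_⟩
  have h1 : Real.exp (∑ i, e (cs i) s) ≤ Fintype.card σ * (1 + 2 * ε) ^ k :=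
    (Finset.single_le_sum (f := fun s => Real.exp (∑ i, e (cs i) s))
      (fun s _ => (Real.exp_pos _).le) (Finset.mem_univ s)).trans hcs
  rw [← Real.le_log_iff_exp_le (by positivity), Real.log_mul hσ.ne' (by positivity),
    Real.log_pow] at h1
  have h2 := Real.log_le_sub_one_of_pos (show 0 < 1 + 2 * ε by positivity)
  have h3 : (k : ℝ) * Real.log (1 + 2 * ε) ≤ k * (1 + 2 * ε - 1) := by gcongr
  linarith

end Elimination

section Concatenation

variable {𝒳 𝒮 𝒴 𝒴₁ : Type} {n N k M L : ℕ}

/-- Send an index `i` to the relay with the inner code `(f, g)`, have the relay forward it,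
and use the `i`-th outer code on the rest of the block. -/
def PCode.concat (f : Fin k → Fin N → 𝒳) (g : (Fin N → 𝒴₁) → Fin k)
    (Cs : Fin k → PCode 𝒳 𝒴 𝒴₁ n M L) : PCode 𝒳 𝒴 𝒴₁ (N + n) (k * M) (k * L) where
  f m := Fin.append (f (finProdFinEquiv.symm m).1)
    ((Cs (finProdFinEquiv.symm m).1).f (finProdFinEquiv.symm m).2)
  f1 y1 := finProdFinEquiv (g fun i => y1 (Fin.castAdd n i),
    (Cs (g fun i => y1 (Fin.castAdd n i))).f1 fun i => y1 (Fin.natAdd N i))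
  g yl := finProdFinEquiv ((finProdFinEquiv.symm yl.2).1,
    (Cs (finProdFinEquiv.symm yl.2).1).g
      (fun i => yl.1 (Fin.natAdd N i), (finProdFinEquiv.symm yl.2).2))

theorem sum_append {α : Type} [Fintype α] (F : (Fin (N + n) → α) → ℝ) :
    ∑ f, F f = ∑ f : Fin N → α, ∑ f' : Fin n → α, F (Fin.append f f') := by
  rw [← (Fin.appendEquiv N n).sum_comp, Fintype.sum_prod_type]
  rfl

variable [Fintype 𝒴] [Fintype 𝒴₁]

theorem PCode.errGiven_concat_le {W : 𝒳 → 𝒮 → 𝒴 × 𝒴₁ → ℝ} (hW : IsChannel W)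
    (hM : 1 ≤ M) (f : Fin k → Fin N → 𝒳) (g : (Fin N → 𝒴₁) → Fin k)
    (Cs : Fin k → PCode 𝒳 𝒴 𝒴₁ n M L) (s : Fin (N + n) → 𝒮) :
    k * (PCode.concat f g Cs).errGiven W s
      ≤ (∑ i, ∑ z : Fin N → 𝒴₁, if g z = i then 0 else
          ∏ t, ∑ y, W (f i t) (s (Fin.castAdd n t)) (y, z t))
        + ∑ i, (Cs i).errGiven W fun t => s (Fin.natAdd N t) := by
  set s₀ : Fin N → 𝒮 := fun t => s (Fin.castAdd n t) with hs₀
  set s₁ : Fin n → 𝒮 := fun t => s (Fin.natAdd N t) with hs₁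
  have hterm : ∀ (i : Fin k) (m : Fin M),
      ∑ y : Fin (N + n) → 𝒴, ∑ y1 : Fin (N + n) → 𝒴₁,
        (if (PCode.concat f g Cs).g (y, (PCode.concat f g Cs).f1 y1) = finProdFinEquiv (i, m)
          then 0 else ∏ t, W ((PCode.concat f g Cs).f (finProdFinEquiv (i, m)) t) (s t)
            (y t, y1 t))
      ≤ (∑ z : Fin N → 𝒴₁, if g z = i then 0 else ∏ t, ∑ y, W (f i t) (s₀ t) (y, z t))
        + ∑ y : Fin n → 𝒴, ∑ y1 : Fin n → 𝒴₁, if (Cs i).g (y, (Cs i).f1 y1) = m then 0 else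
            ∏ t, W ((Cs i).f m t) (s₁ t) (y t, y1 t) := by
    intro i m
    set p₀ : (Fin N → 𝒴) → (Fin N → 𝒴₁) → ℝ := fun y y1 =>
      ∏ t, W (f i t) (s₀ t) (y t, y1 t) with hp₀
    set p₁ : (Fin n → 𝒴) → (Fin n → 𝒴₁) → ℝ := fun y y1 =>
      ∏ t, W ((Cs i).f m t) (s₁ t) (y t, y1 t) with hp₁
    have hp₀0 : ∀ y y1, 0 ≤ p₀ y y1 := fun y y1 => Finset.prod_nonneg fun t _ => (hW _ _).1 _
    have hp₁0 : ∀ y y1, 0 ≤ p₁ y y1 := fun y y1 => Finset.prod_nonneg fun t _ => (hW _ _).1 _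
    have hmarg : ∀ z, ∑ y, p₀ y z = ∏ t, ∑ y, W (f i t) (s₀ t) (y, z t) := fun z =>
      sum_pi_prod_eq (fun t y => W (f i t) (s₀ t) (y, z t))
    rw [sum_append]
    simp_rw [sum_append (α := 𝒴₁)]
    calc _ ≤ ∑ y : Fin N → 𝒴, ∑ y' : Fin n → 𝒴, ∑ z : Fin N → 𝒴₁, ∑ z' : Fin n → 𝒴₁,
            ((if g z = i then 0 else p₀ y z) * p₁ y' z'
              + p₀ y z * (if (Cs i).g (y', (Cs i).f1 z') = m then 0 else p₁ y' z')) := by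
          refine Finset.sum_le_sum fun y _ => Finset.sum_le_sum fun y' _ =>
            Finset.sum_le_sum fun z _ => Finset.sum_le_sum fun z' _ => ?_
          simp only [PCode.concat, Equiv.symm_apply_apply, Fin.append_left, Fin.append_right,
            Fin.prod_univ_add, Equiv.apply_eq_iff_eq, Prod.mk.injEq]
          by_cases hz : g z = i
          · rw [hz]
            simp only [true_and, if_true, zero_mul, zero_add]
            split_ifs <;> simp [hp₀, hp₁, hs₀, hs₁]
          · simp only [hz, false_and, if_false]
            refine le_add_of_nonneg_right (mul_nonneg (hp₀0 _ _) ?_)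
            split_ifs
            exacts [le_rfl, hp₁0 _ _]
      _ = ∑ z : Fin N → 𝒴₁, ∑ y : Fin N → 𝒴, (if g z = i then 0 else p₀ y z)
              * (∑ y' : Fin n → 𝒴, ∑ z' : Fin n → 𝒴₁, p₁ y' z')
            + (∑ y : Fin N → 𝒴, ∑ z : Fin N → 𝒴₁, p₀ y z) *
              ∑ y' : Fin n → 𝒴, ∑ z' : Fin n → 𝒴₁,
                (if (Cs i).g (y', (Cs i).f1 z') = m then 0 else p₁ y' z') := by
          simp_rw [Finset.sum_add_distrib]
          congr 1
          · rw [Finset.sum_comm (s := (Finset.univ : Finset (Fin N → 𝒴₁)))]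
            refine Finset.sum_congr rfl fun y _ => ?_
            rw [Finset.sum_comm]
            refine Finset.sum_congr rfl fun z _ => ?_
            simp_rw [Finset.mul_sum]
          · rw [Finset.sum_mul]
            refine Finset.sum_congr rfl fun y _ => ?_
            rw [Finset.sum_comm, Finset.sum_mul]
            refine Finset.sum_congr rfl fun z _ => ?_
            simp_rw [Finset.mul_sum]
      _ = _ := by
          rw [sum_prod_channel_eq_one hW, sum_prod_channel_eq_one hW, one_mul]
          simp_rw [mul_one]
          congr 1
          refine Finset.sum_congr rfl fun z _ => ?_
          split_ifs
          · simp
          · exact hmarg z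
  unfold PCode.errGiven
  rw [← finProdFinEquiv.sum_comp, Fintype.sum_prod_type, Nat.cast_mul, mul_inv]
  rcases Nat.eq_zero_or_pos k with hk | hk
  · subst hk; simp
  have hk' : (0 : ℝ) < k := by exact_mod_cast hk
  have hM' : (0 : ℝ) < M := by exact_mod_cast hM
  rw [← mul_assoc, ← mul_assoc, mul_inv_cancel₀ hk'.ne', one_mul, ← Finset.sum_add_distrib,
    Finset.mul_sum]
  refine Finset.sum_le_sum fun i _ => ?_
  rw [inv_mul_le_iff₀ hM', mul_add, ← mul_assoc, mul_inv_cancel₀ hM'.ne', one_mul]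
  refine (Finset.sum_le_sum fun m _ => hterm i m).trans (le_of_eq ?_)
  rw [Finset.sum_add_distrib]
  rw [Finset.sum_const, Finset.card_univ, Fintype.card_fin, nsmul_eq_mul]

end Concatenation

section Achievability

variable {𝒳 𝒮 𝒴 𝒴₁ : Type} [Fintype 𝒮] [Fintype 𝒴] [Fintype 𝒴₁]

/-- `R` is achievable when the code may be chosen after the state distribution. -/
def WeakAchievable (W : 𝒳 → 𝒮 → 𝒴 × 𝒴₁ → ℝ) (C1 R : ℝ) : Prop :=
  ∀ ε > (0 : ℝ), ∃ N : ℕ, ∀ n ≥ N, ∃ M L : ℕ,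
    (2 : ℝ) ^ ((n : ℝ) * R) ≤ (M : ℝ) ∧ LinkOK n L C1 ∧
    ∀ qn : (Fin n → 𝒮) → ℝ, IsPMF qn → ∃ C : PCode 𝒳 𝒴 𝒴₁ n M L, C.errJoint W qn ≤ ε

variable {W : 𝒳 → 𝒮 → 𝒴 × 𝒴₁ → ℝ} {C1 R R' : ℝ}

theorem AVRCAchievable.rand (h : AVRCAchievable W C1 R) : AVRCRandAchievable W C1 R := by
  intro ε hε
  obtain ⟨N, hN⟩ := h ε hε
  refine ⟨N, fun n hn => ?_⟩
  obtain ⟨M, L, C, hM, hL, hC⟩ := hN n hn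
  refine ⟨M, L, hM, hL, Unit, PMF.pure (), fun _ => C, fun qn hqn => ?_⟩
  rw [tsum_fintype]
  simpa using ENNReal.ofReal_le_ofReal (hC qn hqn)

theorem AVRCRandAchievable.weak (h : AVRCRandAchievable W C1 R) : WeakAchievable W C1 R := by
  intro ε hε
  obtain ⟨N, hN⟩ := h (ε / 2) (by positivity)
  refine ⟨N, fun n hn => ?_⟩
  obtain ⟨M, L, hM, hL, J, π, Cs, hC⟩ := hN n hn
  refine ⟨M, L, hM, hL, fun qn hqn => ?_⟩
  by_contra! hc
  have h1 : ENNReal.ofReal ε ≤ ∑' j, π j * ENNReal.ofReal ((Cs j).errJoint W qn) := by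
    calc ENNReal.ofReal ε = ∑' j, π j * ENNReal.ofReal ε := by
          rw [ENNReal.tsum_mul_right, π.tsum_coe, one_mul]
      _ ≤ _ := by
          refine ENNReal.tsum_le_tsum fun j => ?_
          gcongr
          exact (hc (Cs j)).le
  have h2 := (ENNReal.ofReal_le_ofReal_iff (by positivity)).1 (h1.trans (hC qn hqn))
  linarith

theorem AVRCAchievable.of_nonpos [Nonempty 𝒳] (hC1 : 0 ≤ C1) (hR : R ≤ 0) :
    AVRCAchievable W C1 R := by
  intro ε hε
  refine ⟨0, fun n _ => ⟨1, 1, ⟨fun _ _ => Classical.arbitrary 𝒳, fun _ => 0, fun _ => 0⟩,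
    ?_, ⟨le_rfl, ?_⟩, fun qn _ => ?_⟩⟩
  · rw [Nat.cast_one]
    exact Real.rpow_le_one_of_one_le_of_nonpos one_le_two
      (mul_nonpos_of_nonneg_of_nonpos (Nat.cast_nonneg n) hR)
  · rw [Nat.cast_one]
    exact Real.one_le_rpow one_le_two (by positivity)
  · simp [PCode.errJoint, PCode.errGiven, Subsingleton.elim _ (0 : Fin 1), hε.le]

theorem exists_overhead_bound (c : ℝ) {C1 ρ : ℝ} (hC1 : 0 < C1) (hρ0 : 0 ≤ ρ) (hρ1 : ρ < 1) :
    ∃ N₂ : ℕ, ∀ N ≥ N₂, c * N ≤ (2 : ℝ) ^ ((N : ℝ) * C1) ∧ 4 * (c * N) ^ 2 * ρ ^ N ≤ 1 := by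
  have hb : (2 : ℝ) ^ (-C1) < 1 := Real.rpow_lt_one_of_one_lt_of_neg one_lt_two (by linarith)
  have h1 := (tendsto_pow_const_mul_const_pow_of_lt_one 1 (by positivity) hb).const_mul c
  have h2 := (tendsto_pow_const_mul_const_pow_of_lt_one 2 hρ0 hρ1).const_mul (4 * c ^ 2)
  rw [mul_zero] at h1 h2
  have := (h1.eventually_le_const one_pos).and (h2.eventually_le_const one_pos)
  obtain ⟨N₂, hN₂⟩ := Filter.eventually_atTop.1 this
  refine ⟨N₂, fun N hN => ⟨?_, ?_⟩⟩
  · have h := (hN₂ N hN).1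
    have h3 : ((2 : ℝ) ^ (-C1)) ^ N = ((2 : ℝ) ^ ((N : ℝ) * C1))⁻¹ := by
      rw [← Real.rpow_natCast, ← Real.rpow_mul zero_le_two, ← Real.rpow_neg zero_le_two]
      ring_nf
    rw [h3, pow_one, ← mul_assoc, ← div_eq_mul_inv, div_le_one (by positivity)] at h
    exact h
  · have h := (hN₂ N hN).2
    nlinarith

theorem WeakAchievable.det [Fintype 𝒳] [Nonempty 𝒳] [Nonempty 𝒮] (hW : IsChannel W) (hC1 : 0 < C1)
    (hns : ¬ Symmetrizable (fun x s y1 => ∑ y, W x s (y, y1)))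
    (h : WeakAchievable W C1 R) (hR : R' < R) : AVRCAchievable W C1 R' := by
  rcases le_or_gt R' 0 with hR' | hR'
  · exact .of_nonpos hC1.le hR'
  have hV : IsChannel (fun x s y1 => ∑ y, W x s (y, y1)) := fun x s =>
    ⟨fun y1 => Finset.sum_nonneg fun y _ => (hW x s).1 _, by
      rw [Finset.sum_comm, ← Fintype.sum_prod_type]; exact (hW x s).2⟩
  obtain ⟨ρ, hρ0, hρ1, N₁, hcode⟩ := exists_avc_code hV hns
  intro ε hε
  have hRpos : 0 < R := hR'.trans hR
  obtain ⟨Nw, hw⟩ := h (ε / 4) (by positivity)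
  set θ := R' / R with hθ
  have hθ0 : 0 < θ := by positivity
  have hθ1 : θ < 1 := (div_lt_one hRpos).2 hR
  set S := Real.log (Fintype.card 𝒮) with hS
  have hS0 : 0 ≤ S := Real.log_natCast_nonneg _
  obtain ⟨D, hD⟩ := exists_nat_ge (2 / (1 - θ))
  have hD2 : 2 ≤ (1 - θ) * D := by
    rw [div_le_iff₀ (by linarith)] at hD; linarith
  have hDpos : (0 : ℝ) < D := by
    have : 0 < 2 / (1 - θ) := div_pos two_pos (by linarith)
    linarith
  set c := (8 / ε + 6 * S / ε + 1) * D with hc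
  obtain ⟨N₂, hN₂⟩ := exists_overhead_bound c hC1 hρ0 hρ1
  obtain ⟨Na, hNa⟩ := exists_nat_ge (Nw / θ)
  refine ⟨max (max D 1) (max Na (D * max N₁ N₂)), fun n hn => ?_⟩
  have hnD : (D : ℝ) ≤ n := by exact_mod_cast (by omega : D ≤ n)
  have hn1 : (1 : ℝ) ≤ n := by exact_mod_cast (by omega : 1 ≤ n)
  have hnNa : (Na : ℝ) ≤ n := by exact_mod_cast (by omega : Na ≤ n)
  have hnD2 : D * max N₁ N₂ ≤ n := by omega
  obtain ⟨n₁, hn₁⟩ : ∃ n₁, n₁ = ⌈n * θ⌉₊ := ⟨_, rfl⟩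
  have hn₁a : n * θ ≤ n₁ := hn₁ ▸ Nat.le_ceil _
  have hn₁b : (n₁ : ℝ) ≤ n * θ + 1 := hn₁ ▸ (Nat.ceil_lt_add_one (by positivity)).le
  have hn₁n : n₁ ≤ n := by
    rw [hn₁]; exact Nat.ceil_le.2 (by nlinarith)
  obtain ⟨N, rfl⟩ : ∃ N, n = N + n₁ := ⟨n - n₁, by omega⟩
  clear hn₁ hn hn₁n
  push_cast at *
  have hND : (N : ℝ) + n₁ ≤ D * N := by
    have h1 : 0 ≤ (1 - θ) * (N + n₁) - 2 * ((n₁ : ℝ) - (N + n₁) * θ) := by nlinarith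
    have h2 : (N : ℝ) ≥ (N + n₁) * (1 - θ) / 2 := by nlinarith
    have h3 : (D : ℝ) * ((N + n₁) * (1 - θ) / 2) ≤ D * N :=
      mul_le_mul_of_nonneg_left h2 hDpos.le
    nlinarith
  have hNN : max N₁ N₂ ≤ N := by
    have h1 : D * max N₁ N₂ ≤ D * N := hnD2.trans (by exact_mod_cast hND)
    exact Nat.le_of_mul_le_mul_left h1 (by exact_mod_cast hDpos)
  obtain ⟨hov1, hov2⟩ := hN₂ N ((le_max_right _ _).trans hNN)
  have hNw : Nw ≤ n₁ := by
    have : (Nw : ℝ) ≤ n₁ := by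
      rw [div_le_iff₀ hθ0] at hNa
      nlinarith
    exact_mod_cast this
  obtain ⟨M, L, hM, hL, hcodes⟩ := hw n₁ hNw
  set k := ⌈(4 + 3 * (N + n₁) * S) / (ε / 2)⌉₊ with hk
  have hkpos : 1 ≤ k := Nat.ceil_pos.2 (by positivity)
  have hkR : (0 : ℝ) < k := by exact_mod_cast hkpos
  have hka : 4 + 3 * (N + n₁) * S ≤ k * (ε / 2) :=
    (div_le_iff₀ (by positivity)).1 (Nat.le_ceil _)
  have hkc : (k : ℝ) ≤ c * N := by
    have h1 : (k : ℝ) ≤ (4 + 3 * (N + n₁) * S) / (ε / 2) + 1 :=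
      (Nat.ceil_lt_add_one (by positivity)).le
    have h2 : (4 + 3 * (N + n₁) * S) / (ε / 2) + 1
        = 8 / ε + 6 * S / ε * (N + n₁) + 1 := by field_simp; ring
    have h3 : 8 / ε ≤ 8 / ε * (N + n₁) := le_mul_of_one_le_right (by positivity) hn1
    have h4 : (8 / ε + 6 * S / ε + 1) * (N + n₁) ≤ (8 / ε + 6 * S / ε + 1) * (D * N) :=
      mul_le_mul_of_nonneg_left hND (by positivity)
    rw [hc]
    nlinarith
  obtain ⟨f, g, hfg⟩ := hcode N ((le_max_left _ _).trans hNN) k hkpos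
  obtain ⟨Cs, hCs⟩ := exists_uniform_mixture (σ := Fin n₁ → 𝒮)
    (e := fun C : PCode 𝒳 𝒴 𝒴₁ n₁ M L => C.errGiven W) (PCode.errGiven_nonneg hW)
    (PCode.errGiven_le_one hW) (by positivity : 0 ≤ ε / 4) hcodes k
  have hMpos : 1 ≤ M := by
    have : (0 : ℝ) < M := lt_of_lt_of_le (by positivity) hM
    exact_mod_cast this
  refine ⟨k * M, k * L, PCode.concat f g Cs, ?_, ⟨Nat.mul_pos hkpos hL.1, ?_⟩, fun qn hqn => ?_⟩
  · calc (2 : ℝ) ^ (((N : ℝ) + n₁) * R') ≤ (2 : ℝ) ^ ((n₁ : ℝ) * R) := by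
          refine Real.rpow_le_rpow_of_exponent_le one_le_two ?_
          have : R' = θ * R := by rw [hθ]; field_simp
          rw [this, ← mul_assoc]
          exact mul_le_mul_of_nonneg_right hn₁a hRpos.le
      _ ≤ M := hM
      _ ≤ (k * M : ℕ) := by exact_mod_cast Nat.le_mul_of_pos_left M hkpos
  · push_cast
    rw [add_mul, Real.rpow_add two_pos]
    exact mul_le_mul (hkc.trans hov1) hL.2 (by positivity) (by positivity)
  · refine hqn.sum_mul_le fun s => ?_
    have h1 := PCode.errGiven_concat_le hW hMpos f g Cs s
    have h2 := hfg fun t => s (Fin.castAdd n₁ t)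
    have h3 := hCs fun t => s (Fin.natAdd N t)
    have h4 : Real.log (Fintype.card (Fin n₁ → 𝒮)) = n₁ * S := by
      simp [hS]
    have h5 : 2 * (k : ℝ) ^ 2 * (2 * ρ ^ N) ≤ 1 := by
      calc 2 * (k : ℝ) ^ 2 * (2 * ρ ^ N) = 4 * (k : ℝ) ^ 2 * ρ ^ N := by ring
        _ ≤ 4 * (c * N) ^ 2 * ρ ^ N := by gcongr
        _ ≤ 1 := hov2
    have h6 : Real.log 2 ≤ 1 := by linarith [Real.log_two_lt_d9]
    rw [h4] at h3
    have h7 : (k : ℝ) * (PCode.concat f g Cs).errGiven W s ≤ k * ε := by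
      have : 0 ≤ (n₁ : ℝ) * S := by positivity
      have : 0 ≤ (N : ℝ) * S := by positivity
      linarith
    exact le_of_mul_le_mul_left h7 hkR

end Achievability

section Entropy

variable {α β : Type} [Fintype α] [Fintype β]

theorem ent_le_card {p : α → ℝ} (hp : ∀ a, 0 ≤ p a) : ent p ≤ Fintype.card α / Real.log 2 := by
  have h2 : 0 < Real.log 2 := Real.log_pos one_lt_two
  rw [ent, ← Finset.sum_neg_distrib, div_eq_mul_inv, ← nsmul_eq_mul]
  refine Finset.sum_le_card_nsmul _ _ _ fun a _ => ?_
  rcases (hp a).eq_or_lt with h | h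
  · rw [← h]; simp; positivity
  · have h1 := Real.one_sub_inv_le_log_of_pos h
    rw [Real.logb, ← mul_div_assoc, ← neg_div, div_le_iff₀ h2, inv_mul_cancel₀ h2.ne']
    have h3 := mul_le_mul_of_nonneg_left h1 h.le
    rw [mul_sub, mul_inv_cancel₀ h.ne'] at h3
    linarith

theorem ent_nonneg {p : α → ℝ} (hp : ∀ a, 0 ≤ p a) (hp1 : ∀ a, p a ≤ 1) : 0 ≤ ent p := by
  rw [ent, ← Finset.sum_neg_distrib]
  refine Finset.sum_nonneg fun a _ => ?_
  have := Real.logb_nonpos one_lt_two (hp a) (hp1 a)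
  nlinarith [hp a]

theorem IsPMF.le_one {p : α → ℝ} (hp : IsPMF p) (a : α) : p a ≤ 1 :=
  hp.2 ▸ Finset.single_le_sum (fun b _ => hp.1 b) (Finset.mem_univ a)

theorem IsPMF.ent_nonneg {p : α → ℝ} (hp : IsPMF p) : 0 ≤ ent p :=
  _root_.ent_nonneg hp.1 hp.le_one

theorem mutInfo_le {p : α × β → ℝ} (hp : IsPMF p) :
    mutInfo p ≤ Fintype.card α / Real.log 2 + Fintype.card β / Real.log 2 := by
  have h1 := ent_le_card (p := fun a => ∑ b, p (a, b)) fun a =>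
    Finset.sum_nonneg fun b _ => hp.1 _
  have h2 := ent_le_card (p := fun b => ∑ a, p (a, b)) fun a =>
    Finset.sum_nonneg fun b _ => hp.1 _
  have h3 := hp.ent_nonneg
  rw [mutInfo]
  linarith

/-- Mutual information as an average log-likelihood ratio. -/
theorem mutInfo_eq_sum {p : α → ℝ} (hp : ∀ a, 0 ≤ p a) {V : α → β → ℝ} (hV : ∀ a, IsPMF (V a)) :
    mutInfo (fun ab : α × β => p ab.1 * V ab.1 ab.2)
      = ∑ a, ∑ b, p a * V a b * Real.logb 2 (V a b / ∑ a', p a' * V a' b) := by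
  have hterm : ∀ a b, p a * V a b * Real.logb 2 (V a b / ∑ a', p a' * V a' b)
      = p a * V a b * Real.logb 2 (p a * V a b) - p a * V a b * Real.logb 2 (p a)
        - p a * V a b * Real.logb 2 (∑ a', p a' * V a' b) := by
    intro a b
    rcases (hp a).eq_or_lt with h | h
    · simp [← h]
    rcases ((hV a).1 b).eq_or_lt with h' | h'
    · simp [← h']
    have hQ : 0 < ∑ a', p a' * V a' b :=
      lt_of_lt_of_le (mul_pos h h') (Finset.single_le_sum
        (f := fun a' => p a' * V a' b) (fun a' _ => mul_nonneg (hp a') ((hV a').1 b))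
        (Finset.mem_univ a))
    rw [Real.logb_div h'.ne' hQ.ne', Real.logb_mul h.ne' h'.ne']
    ring
  simp_rw [hterm, Finset.sum_sub_distrib]
  have h1 : ∀ a, ∑ b, p a * V a b = p a := fun a => by rw [← Finset.mul_sum, (hV a).2, mul_one]
  simp only [mutInfo, ent, h1, Fintype.sum_prod_type]
  have h2 : ∑ a, ∑ b, p a * V a b * Real.logb 2 (p a) = ∑ a, p a * Real.logb 2 (p a) := by
    refine Finset.sum_congr rfl fun a _ => ?_
    rw [← Finset.sum_mul, h1]
  have h3 : ∑ a, ∑ b, p a * V a b * Real.logb 2 (∑ a', p a' * V a' b)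
      = ∑ b, (∑ a, p a * V a b) * Real.logb 2 (∑ a', p a' * V a' b) := by
    rw [Finset.sum_comm]
    refine Finset.sum_congr rfl fun b _ => ?_
    rw [← Finset.sum_mul]
  rw [h2, h3]
  ring

end Entropy

section Converse

variable {𝒳 𝒮 𝒴 𝒴₁ B : Type} [Fintype 𝒳] [Fintype B]

open Classical in
/-- The average empirical input distribution of a codebook. -/
def codebookDist {n M : ℕ} (x : Fin M → Fin n → 𝒳) (a : 𝒳) : ℝ :=
  (M : ℝ)⁻¹ * (n : ℝ)⁻¹ * ∑ m, ∑ i, if x m i = a then 1 else 0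

theorem sum_codebookDist_mul {n M : ℕ} (x : Fin M → Fin n → 𝒳) (F : 𝒳 → ℝ) :
    ∑ a, codebookDist x a * F a = (M : ℝ)⁻¹ * (n : ℝ)⁻¹ * ∑ m, ∑ i, F (x m i) := by
  simp_rw [codebookDist, mul_assoc, ← Finset.mul_sum, Finset.sum_mul]
  rw [Finset.sum_comm]
  congr 2
  refine Finset.sum_congr rfl fun m _ => ?_
  rw [Finset.sum_comm]
  refine Finset.sum_congr rfl fun i _ => ?_
  rw [Finset.sum_eq_single (x m i) (fun b _ hb => by rw [if_neg hb.symm, zero_mul])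
    (fun h => (h (Finset.mem_univ _)).elim), if_pos rfl, one_mul]

theorem isPMF_codebookDist {n M : ℕ} (hn : 1 ≤ n) (hM : 1 ≤ M) (x : Fin M → Fin n → 𝒳) :
    IsPMF (codebookDist x) := by
  have hMR : (0 : ℝ) < M := by exact_mod_cast hM
  have hnR : (0 : ℝ) < n := by exact_mod_cast hn
  refine ⟨fun a => mul_nonneg (by positivity) (Finset.sum_nonneg fun m _ =>
    Finset.sum_nonneg fun i _ => by split_ifs <;> norm_num), ?_⟩
  have := sum_codebookDist_mul x fun _ => 1
  simp only [mul_one] at this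
  rw [this]
  simp
  field_simp

/-- Fano-type bound for a code over the memoryless channel `V` whose decoder has an additional
`L`-valued side information. -/
theorem codebookDist_fano {V : 𝒳 → B → ℝ} (hV : ∀ x, IsPMF (V x)) {n M L : ℕ} (hn : 1 ≤ n)
    (hM : 1 ≤ M) (hL : 1 ≤ L) (x : Fin M → Fin n → 𝒳) (A : Fin M → (Fin n → B) → Fin L → ℝ)
    (hA0 : ∀ m b l, 0 ≤ A m b l) (hA : ∀ m b, ∑ l, A m b l = ∏ i, V (x m i) (b i))
    (g : (Fin n → B) → Fin L → Fin M) :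
    (M : ℝ)⁻¹ * (∑ m, ∑ b, ∑ l, if g b l = m then A m b l else 0) * Real.logb 2 M
      ≤ n * mutInfo (fun xb : 𝒳 × B => codebookDist x xb.1 * V xb.1 xb.2)
        + Real.logb 2 L + 1 := by
  classical
  have hMR : (0 : ℝ) < M := by exact_mod_cast hM
  have hnR : (0 : ℝ) < n := by exact_mod_cast hn
  have hLR : (0 : ℝ) < L := by exact_mod_cast hL
  have hpmf := isPMF_codebookDist hn hM x
  have havg := sum_codebookDist_mul x
  set p := codebookDist x with hp
  set Q : B → ℝ := fun b => ∑ a, p a * V a b with hQ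
  have hQ0 : ∀ b, 0 ≤ Q b := fun b => Finset.sum_nonneg fun a _ =>
    mul_nonneg (hpmf.1 a) ((hV a).1 b)
  have hQ1 : ∑ b, Q b = 1 := by
    rw [hQ, Finset.sum_comm]
    simp_rw [← Finset.mul_sum, (hV _).2, mul_one, hpmf.2]
  have hQpos : ∀ m i b, 0 < V (x m i) b → 0 < Q b := by
    intro m i b h
    have h1 : Q b = (M : ℝ)⁻¹ * (n : ℝ)⁻¹ * ∑ m, ∑ i, V (x m i) b := havg fun a => V a b
    rw [h1]
    refine mul_pos (by positivity) (Finset.sum_pos' (fun m _ => Finset.sum_nonneg fun i _ =>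
      (hV _).1 b) ⟨m, Finset.mem_univ m, Finset.sum_pos' (fun i _ => (hV _).1 b)
      ⟨i, Finset.mem_univ i, h⟩⟩)
  have hVA : ∀ m b l, A m b l ≤ ∏ i, V (x m i) (b i) := fun m b l => by
    rw [← hA m b]; exact Finset.single_le_sum (fun l _ => hA0 m b l) (Finset.mem_univ l)
  have hsumV : ∀ m, ∑ b : Fin n → B, ∏ i, V (x m i) (b i) = 1 := fun m =>
    sum_pi_prod_eq_one fun i => (hV _).2
  set l2 := Real.log 2 with hl2
  have hl2pos : 0 < l2 := Real.log_pos one_lt_two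
  -- reference weights: half on the decoded message, half spread uniformly
  set ref : Fin M → (Fin n → B) → Fin L → ℝ := fun m b l =>
    (∏ i, Q (b i)) * (L : ℝ)⁻¹ * (2⁻¹ * if g b l = m then 1 else (M : ℝ)⁻¹) with href
  have href_sum : ∑ m, ∑ b, ∑ l, ref m b l ≤ 1 := by
    have h1 : ∀ b l, ∑ m, (2⁻¹ * if g b l = m then 1 else (M : ℝ)⁻¹) ≤ 1 := by
      intro b l
      calc ∑ m, (2⁻¹ * if g b l = m then 1 else (M : ℝ)⁻¹)
          ≤ ∑ m, ((2⁻¹ * if g b l = m then 1 else 0) + 2⁻¹ * (M : ℝ)⁻¹) := by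
            refine Finset.sum_le_sum fun m _ => ?_
            split_ifs
            · have : 0 < (M : ℝ)⁻¹ := by positivity
              linarith
            · simp
        _ = 1 := by
            rw [Finset.sum_add_distrib, ← Finset.mul_sum]
            simp
            field_simp
            norm_num
    calc ∑ m, ∑ b, ∑ l, ref m b l = ∑ b, ∑ l, (∏ i, Q (b i)) * (L : ℝ)⁻¹ *
          ∑ m, (2⁻¹ * if g b l = m then 1 else (M : ℝ)⁻¹) := by
          rw [Finset.sum_comm]
          refine Finset.sum_congr rfl fun b _ => ?_
          rw [Finset.sum_comm]
          simp_rw [href, Finset.mul_sum]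
      _ ≤ ∑ b : Fin n → B, ∑ l : Fin L, (∏ i, Q (b i)) * (L : ℝ)⁻¹ :=
          Finset.sum_le_sum fun b _ => Finset.sum_le_sum fun l _ =>
            mul_le_of_le_one_right (mul_nonneg (Finset.prod_nonneg fun i _ => hQ0 _)
              (by positivity)) (h1 b l)
      _ = 1 := by
          simp only [Finset.sum_const, Finset.card_univ, Fintype.card_fin, nsmul_eq_mul]
          simp_rw [mul_comm (∏ i, Q _), ← mul_assoc, mul_inv_cancel₀ hLR.ne', one_mul]
          exact sum_pi_prod_eq_one fun i => hQ1
  have hpoint : ∀ m b l, (M : ℝ)⁻¹ * A m b l * ((if g b l = m then Real.log M else 0)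
        - Real.log L - l2 - ∑ i, Real.log (V (x m i) (b i) / Q (b i)))
      ≤ ref m b l - (M : ℝ)⁻¹ * A m b l := by
    intro m b l
    rcases (hA0 m b l).eq_or_lt with h | h
    · rw [← h, mul_zero, zero_mul, sub_zero]
      refine mul_nonneg (mul_nonneg (Finset.prod_nonneg fun i _ => hQ0 _) (by positivity)) ?_
      split_ifs <;> positivity
    have hVpos : ∀ i, 0 < V (x m i) (b i) := by
      have h1 : 0 < ∏ i, V (x m i) (b i) := h.trans_le (hVA m b l)
      intro i
      refine lt_of_le_of_ne ((hV _).1 _) fun h0 => h1.ne' ?_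
      exact Finset.prod_eq_zero (Finset.mem_univ i) h0.symm
    have hQp : ∀ i, 0 < Q (b i) := fun i => hQpos m i _ (hVpos i)
    have hprodQ : 0 < ∏ i, Q (b i) := Finset.prod_pos fun i _ => hQp i
    set a := (M : ℝ)⁻¹ * A m b l with ha
    have hapos : 0 < a := by positivity
    have hrpos : 0 < ref m b l := by
      refine mul_pos (by positivity) ?_
      split_ifs <;> positivity
    have hlog : Real.log (ref m b l / a) ≤ ref m b l / a - 1 :=
      Real.log_le_sub_one_of_pos (by positivity)
    have h2 : a * Real.log (ref m b l / a) ≤ ref m b l - a := by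
      calc a * Real.log (ref m b l / a) ≤ a * (ref m b l / a - 1) :=
            mul_le_mul_of_nonneg_left hlog hapos.le
        _ = _ := by field_simp
    refine le_trans (mul_le_mul_of_nonneg_left ?_ hapos.le) h2
    rw [Real.log_div hrpos.ne' hapos.ne', ha, Real.log_mul (by positivity) h.ne', Real.log_inv]
    have h3 : Real.log (A m b l) ≤ ∑ i, Real.log (V (x m i) (b i)) := by
      rw [← Real.log_prod fun i _ => (hVpos i).ne']
      exact Real.log_le_log h (hVA m b l)
    have h4 : Real.log (ref m b l) = ∑ i, Real.log (Q (b i)) - Real.log L - l2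
        - (if g b l = m then 0 else Real.log M) := by
      rw [href, ← Real.log_prod fun i _ => (hQp i).ne']
      dsimp only
      split_ifs
      · rw [Real.log_mul (by positivity) (by positivity), Real.log_mul (by positivity)
          (by positivity), mul_one, Real.log_inv, Real.log_inv]
        ring
      · rw [Real.log_mul (by positivity) (by positivity), Real.log_mul (by positivity)
          (by positivity), Real.log_mul (by positivity) (by positivity),
          Real.log_inv, Real.log_inv, Real.log_inv]
        ring
    have h5 : ∑ i, Real.log (V (x m i) (b i) / Q (b i))
        = ∑ i, Real.log (V (x m i) (b i)) - ∑ i, Real.log (Q (b i)) := by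
      rw [← Finset.sum_sub_distrib]
      exact Finset.sum_congr rfl fun i _ => Real.log_div (hVpos i).ne' (hQp i).ne'
    rw [h4, h5]
    split_ifs <;> linarith
  have hA1 : ∑ m, ∑ b, ∑ l, (M : ℝ)⁻¹ * A m b l = 1 := by
    simp_rw [← Finset.mul_sum, hA, hsumV]
    simp
    field_simp
  have hI : ∑ m, ∑ b, ∑ l, (M : ℝ)⁻¹ * A m b l * ∑ i, Real.log (V (x m i) (b i) / Q (b i))
      = n * (mutInfo (fun xb : 𝒳 × B => p xb.1 * V xb.1 xb.2) * l2) := by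
    rw [mutInfo_eq_sum hpmf.1 hV, Finset.sum_mul]
    have h1 : ∀ a, (∑ b, p a * V a b * Real.logb 2 (V a b / ∑ a', p a' * V a' b)) * l2
        = p a * ∑ b, V a b * Real.log (V a b / Q b) := by
      intro a
      rw [Finset.sum_mul, Finset.mul_sum]
      refine Finset.sum_congr rfl fun b _ => ?_
      rw [Real.logb, ← hl2]
      field_simp
      rfl
    simp_rw [h1]
    rw [havg fun a => ∑ b, V a b * Real.log (V a b / Q b)]
    have h2 : ∀ m, ∑ b, ∑ l, (M : ℝ)⁻¹ * A m b l * ∑ i, Real.log (V (x m i) (b i) / Q (b i))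
        = (M : ℝ)⁻¹ * ∑ i, ∑ b, V (x m i) b * Real.log (V (x m i) b / Q b) := by
      intro m
      simp_rw [← Finset.sum_mul, ← Finset.mul_sum, hA, mul_assoc, ← Finset.mul_sum]
      congr 1
      simp_rw [Finset.mul_sum]
      rw [Finset.sum_comm]
      refine Finset.sum_congr rfl fun i _ => ?_
      exact sum_pi_prod_mul_apply (w := fun i b => V (x m i) b) (fun i => (hV _).2) i
        fun b => Real.log (V (x m i) b / Q b)
    simp_rw [h2, ← Finset.mul_sum]
    field_simp
  have hfinal : ∑ m, ∑ b, ∑ l, (M : ℝ)⁻¹ * A m b l * ((if g b l = m then Real.log M else 0)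
        - Real.log L - l2 - ∑ i, Real.log (V (x m i) (b i) / Q (b i))) ≤ 0 := by
    calc _ ≤ ∑ m, ∑ b, ∑ l, (ref m b l - (M : ℝ)⁻¹ * A m b l) :=
          Finset.sum_le_sum fun m _ => Finset.sum_le_sum fun b _ => Finset.sum_le_sum fun l _ =>
            hpoint m b l
      _ ≤ 0 := by
          simp_rw [Finset.sum_sub_distrib]
          rw [hA1]; linarith
  have hc : ∀ c : ℝ, ∑ m, ∑ b, ∑ l, (M : ℝ)⁻¹ * A m b l * c = c := fun c => by
    simp_rw [← Finset.sum_mul]; rw [hA1, one_mul]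
  simp_rw [mul_sub, Finset.sum_sub_distrib] at hfinal
  rw [hI, hc, hc] at hfinal
  have hPc : ∑ m, ∑ b, ∑ l, (M : ℝ)⁻¹ * A m b l * (if g b l = m then Real.log M else 0)
      = (M : ℝ)⁻¹ * (∑ m, ∑ b, ∑ l, if g b l = m then A m b l else 0) * Real.log M := by
    simp_rw [Finset.mul_sum, Finset.sum_mul]
    refine Finset.sum_congr rfl fun m _ => Finset.sum_congr rfl fun b _ =>
      Finset.sum_congr rfl fun l _ => ?_
    split_ifs <;> simp
  rw [hPc] at hfinal
  rw [Real.logb, Real.logb, ← hl2, ← mul_div_assoc, div_le_iff₀ hl2pos, add_mul, add_mul,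
    div_mul_cancel₀ _ hl2pos.ne']
  linarith

end Converse

section Cutset

variable {𝒳 𝒮 𝒴 𝒴₁ : Type} [Fintype 𝒮] [Fintype 𝒴] [Fintype 𝒴₁]

theorem isPMF_avgChannel {W : 𝒳 → 𝒮 → 𝒴 × 𝒴₁ → ℝ} (hW : IsChannel W) {q : 𝒮 → ℝ}
    (hq : IsPMF q) (x : 𝒳) : IsPMF fun z => ∑ s, q s * W x s z := by
  refine ⟨fun z => Finset.sum_nonneg fun s _ => mul_nonneg (hq.1 s) ((hW x s).1 z), ?_⟩
  rw [Finset.sum_comm]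
  simp_rw [← Finset.mul_sum, (hW _ _).2, mul_one, hq.2]

theorem isPMF_marginal {p : 𝒴 × 𝒴₁ → ℝ} (hp : IsPMF p) : IsPMF fun y => ∑ y1, p (y, y1) :=
  ⟨fun _ => Finset.sum_nonneg fun _ _ => hp.1 _, by rw [← Fintype.sum_prod_type]; exact hp.2⟩

theorem isPMF_marginal' {p : 𝒴 × 𝒴₁ → ℝ} (hp : IsPMF p) : IsPMF fun y1 => ∑ y, p (y, y1) :=
  ⟨fun _ => Finset.sum_nonneg fun _ _ => hp.1 _, by
    rw [Finset.sum_comm, ← Fintype.sum_prod_type]; exact hp.2⟩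

theorem isPMF_joint [Fintype 𝒳] {p : 𝒳 → ℝ} (hp : IsPMF p) {V : 𝒳 → 𝒴 → ℝ}
    (hV : ∀ x, IsPMF (V x)) : IsPMF fun xy : 𝒳 × 𝒴 => p xy.1 * V xy.1 xy.2 := by
  refine ⟨fun xy => mul_nonneg (hp.1 _) ((hV _).1 _), ?_⟩
  rw [Fintype.sum_prod_type]
  simp_rw [← Finset.mul_sum, (hV _).2, mul_one, hp.2]

theorem PCode.success_eq {n M L : ℕ} {W : 𝒳 → 𝒮 → 𝒴 × 𝒴₁ → ℝ} (hW : IsChannel W) {q : 𝒮 → ℝ}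
    (hq : IsPMF q) (hM : 1 ≤ M) (C : PCode 𝒳 𝒴 𝒴₁ n M L) :
    (M : ℝ)⁻¹ * ∑ m, ∑ y : Fin n → 𝒴, ∑ y1 : Fin n → 𝒴₁, (if C.g (y, C.f1 y1) = m then
      ∏ i, ∑ s, q s * W (C.f m i) s (y i, y1 i) else 0)
      = 1 - C.errJoint W fun s => ∏ i, q (s i) := by
  have hMR : (0 : ℝ) < M := by exact_mod_cast hM
  have h1 : C.errJoint W (fun s => ∏ i, q (s i)) = (M : ℝ)⁻¹ * ∑ m, ∑ y : Fin n → 𝒴,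
      ∑ y1 : Fin n → 𝒴₁, (if C.g (y, C.f1 y1) = m then 0 else
        ∏ i, ∑ s, q s * W (C.f m i) s (y i, y1 i)) := by
    unfold PCode.errJoint PCode.errGiven
    simp_rw [mul_left_comm _ (M : ℝ)⁻¹, ← Finset.mul_sum]
    congr 1
    simp_rw [Finset.mul_sum]
    rw [Finset.sum_comm]
    refine Finset.sum_congr rfl fun m _ => ?_
    rw [Finset.sum_comm]
    refine Finset.sum_congr rfl fun y _ => ?_
    rw [Finset.sum_comm]
    refine Finset.sum_congr rfl fun y1 _ => ?_
    split_ifs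
    · simp
    · simp_rw [← Finset.prod_mul_distrib]
      exact sum_pi_prod_eq fun i s => q s * W (C.f m i) s (y i, y1 i)
  rw [h1, eq_sub_iff_add_eq, ← mul_add]
  simp_rw [← Finset.sum_add_distrib]
  have h2 : ∀ m : Fin M, ∑ y : Fin n → 𝒴, ∑ y1 : Fin n → 𝒴₁,
      ((if C.g (y, C.f1 y1) = m then ∏ i, ∑ s, q s * W (C.f m i) s (y i, y1 i) else 0)
      + (if C.g (y, C.f1 y1) = m then 0 else ∏ i, ∑ s, q s * W (C.f m i) s (y i, y1 i))) = 1 := by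
    intro m
    rw [← sum_prod_channel_eq_one (W := fun x (_ : Unit) z => ∑ s, q s * W x s z)
      (fun x _ => isPMF_avgChannel hW hq x) (C.f m) (fun _ => ())]
    refine Finset.sum_congr rfl fun y _ => Finset.sum_congr rfl fun y1 _ => ?_
    split_ifs <;> simp
  simp_rw [h2]
  simp
  field_simp

variable [Fintype 𝒳]

theorem PCode.cutset_bound {n M L : ℕ} {W : 𝒳 → 𝒮 → 𝒴 × 𝒴₁ → ℝ} (hW : IsChannel W) {q : 𝒮 → ℝ}
    (hq : IsPMF q) (hn : 1 ≤ n) (hM : 1 ≤ M) (hL : 1 ≤ L) (C : PCode 𝒳 𝒴 𝒴₁ n M L) :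
    (1 - C.errJoint W fun s => ∏ i, q (s i)) * Real.logb 2 M
      ≤ n * min (IqXY W (codebookDist C.f) q + Real.logb 2 L / n) (IqXYY1 W (codebookDist C.f) q)
        + 1 := by
  have hnR : (0 : ℝ) < n := by exact_mod_cast hn
  have hV := isPMF_avgChannel hW hq
  have hsucc := C.success_eq hW hq hM
  rw [mul_min_of_nonneg _ _ hnR.le, mul_add, mul_div_cancel₀ _ hnR.ne', ← min_add_add_right]
  refine le_min ?_ ?_
  · have h := codebookDist_fano (fun x => isPMF_marginal (hV x)) hn hM hL C.f
      (fun m y l => ∑ y1 : Fin n → 𝒴₁, if C.f1 y1 = l then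
        ∏ i, ∑ s, q s * W (C.f m i) s (y i, y1 i) else 0)
      (fun m y l => Finset.sum_nonneg fun y1 _ => by
        split_ifs
        exacts [Finset.prod_nonneg fun i _ => (hV _).1 _, le_rfl])
      (fun m y => by
        rw [Finset.sum_comm]
        simp only [Finset.sum_ite_eq, Finset.mem_univ, if_true]
        exact sum_pi_prod_eq fun i y1 => ∑ s, q s * W (C.f m i) s (y i, y1))
      (fun y l => C.g (y, l))
    have h1 : ∀ m : Fin M, ∀ y : Fin n → 𝒴, (∑ l, if C.g (y, l) = m then
        ∑ y1 : Fin n → 𝒴₁, (if C.f1 y1 = l then ∏ i, ∑ s, q s * W (C.f m i) s (y i, y1 i) else 0)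
        else 0) = ∑ y1 : Fin n → 𝒴₁, (if C.g (y, C.f1 y1) = m then
          ∏ i, ∑ s, q s * W (C.f m i) s (y i, y1 i) else 0) := by
      intro m y
      calc _ = ∑ l, ∑ y1 : Fin n → 𝒴₁, (if C.f1 y1 = l then if C.g (y, l) = m then
            ∏ i, ∑ s, q s * W (C.f m i) s (y i, y1 i) else 0 else 0) := by
            refine Finset.sum_congr rfl fun l _ => ?_
            by_cases hl : C.g (y, l) = m <;> simp [hl]
        _ = _ := by
            rw [Finset.sum_comm]
            simp only [Finset.sum_ite_eq, Finset.mem_univ, if_true]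
    simp_rw [h1] at h
    rw [hsucc] at h
    refine h.trans (le_of_eq ?_)
    unfold IqXY
    simp_rw [Finset.sum_comm (s := (Finset.univ : Finset 𝒴₁)), ← Finset.mul_sum]
  · have h := codebookDist_fano hV hn hM le_rfl C.f
      (fun m b (_ : Fin 1) => ∏ i, ∑ s, q s * W (C.f m i) s (b i))
      (fun m y l => Finset.prod_nonneg fun i _ => (hV _).1 _)
      (fun m y => by simp)
      (fun b _ => C.g (fun i => (b i).1, C.f1 fun i => (b i).2))
    have h1 : ∀ F : (Fin n → 𝒴) → (Fin n → 𝒴₁) → ℝ,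
        ∑ b : Fin n → 𝒴 × 𝒴₁, F (fun i => (b i).1) (fun i => (b i).2) = ∑ y, ∑ y1, F y y1 := by
      intro F
      rw [← (Equiv.arrowProdEquivProdArrow (Fin n) (fun _ => 𝒴) (fun _ => 𝒴₁)).symm.sum_comp,
        Fintype.sum_prod_type]
      rfl
    simp only [Finset.univ_unique, Finset.sum_const, Finset.card_singleton, one_smul,
      Nat.cast_one, Real.logb_one, add_zero] at h
    have h2 := fun m : Fin M => h1 fun y y1 => if C.g (y, C.f1 y1) = m then
      ∏ i, ∑ s, q s * W (C.f m i) s (y i, y1 i) else 0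
    simp only [Prod.mk.eta] at h2
    simp_rw [h2] at h
    rw [hsucc] at h
    exact h

theorem bddAbove_cutset {W : 𝒳 → 𝒮 → 𝒴 × 𝒴₁ → ℝ} (hW : IsChannel W) {q : 𝒮 → ℝ}
    (hq : IsPMF q) (C1 : ℝ) :
    BddAbove {v | ∃ p : 𝒳 → ℝ, IsPMF p ∧ v = min (IqXY W p q + C1) (IqXYY1 W p q)} := by
  refine ⟨Fintype.card 𝒳 / Real.log 2 + Fintype.card (𝒴 × 𝒴₁) / Real.log 2, ?_⟩
  rintro v ⟨p, hp, rfl⟩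
  exact (min_le_right _ _).trans (mutInfo_le (isPMF_joint hp (isPMF_avgChannel hW hq)))

theorem AVRCAchievable.le_RCS [Nonempty 𝒮] {W : 𝒳 → 𝒮 → 𝒴 × 𝒴₁ → ℝ} (hW : IsChannel W)
    {C1 R : ℝ} (h : AVRCAchievable W C1 R) : R ≤ RCS W C1 {q : 𝒮 → ℝ | IsPMF q} := by
  classical
  refine le_csInf ⟨_, _, isPMF_single (Classical.arbitrary 𝒮), rfl⟩ ?_
  rintro _ ⟨q, hq, rfl⟩
  set S := sSup {v | ∃ p : 𝒳 → ℝ, IsPMF p ∧ v = min (IqXY W p q + C1) (IqXYY1 W p q)} with hS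
  have key : ∀ ε : ℝ, 0 < ε → ε ≤ 1 → (1 - ε) * R ≤ S + ε := by
    intro ε hε hε1
    obtain ⟨N, hN⟩ := h ε hε
    obtain ⟨K, hK⟩ := exists_nat_ge (1 / ε)
    obtain ⟨n, hn⟩ : ∃ n, n = max N (max K 1) := ⟨_, rfl⟩
    obtain ⟨M, L, C, hM, hL, hC⟩ := hN n (by omega)
    have hn1 : 1 ≤ n := by omega
    have hnR : (0 : ℝ) < n := by exact_mod_cast hn1
    have hnε : 1 ≤ n * ε := by
      rw [div_le_iff₀ hε] at hK
      have : (K : ℝ) ≤ n := by exact_mod_cast (by omega : K ≤ n)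
      nlinarith
    have hMR : (0 : ℝ) < M := lt_of_lt_of_le (by positivity) hM
    have hM1 : 1 ≤ M := by exact_mod_cast hMR
    have hLR : (0 : ℝ) < L := by exact_mod_cast hL.1
    have hlogM : n * R ≤ Real.logb 2 M := (Real.le_logb_iff_rpow_le one_lt_two hMR).2 hM
    have hlogL : Real.logb 2 L / n ≤ C1 := by
      rw [div_le_iff₀ hnR, mul_comm]
      exact (Real.logb_le_iff_le_rpow one_lt_two hLR).2 hL.2
    have hlogM0 : 0 ≤ Real.logb 2 M := Real.logb_nonneg one_lt_two (by exact_mod_cast hM1)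
    have hb := C.cutset_bound hW hq hn1 hM1 hL.1
    have herr := hC _ (isPMF_pi fun _ => hq)
    have hmin : min (IqXY W (codebookDist C.f) q + Real.logb 2 L / n)
        (IqXYY1 W (codebookDist C.f) q) ≤ S :=
      (min_le_min_right _ (by linarith)).trans
        (le_csSup (bddAbove_cutset hW hq C1) ⟨_, isPMF_codebookDist hn1 hM1 C.f, rfl⟩)
    have h1 : (1 - ε) * (n * R) ≤ n * S + 1 := by
      calc (1 - ε) * (n * R) ≤ (1 - ε) * Real.logb 2 M :=
            mul_le_mul_of_nonneg_left hlogM (by linarith)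
        _ ≤ _ := mul_le_mul_of_nonneg_right (by linarith) hlogM0
        _ ≤ _ := hb
        _ ≤ _ := by gcongr
    have h2 : n * ((1 - ε) * R) ≤ n * (S + ε) := by linarith
    exact le_of_mul_le_mul_left h2 hnR
  refine le_of_forall_pos_le_add fun δ hδ => ?_
  set ε := min 1 (δ / (|R| + 1)) with hε
  have hε0 : 0 < ε := by positivity
  have h1 := key ε hε0 (min_le_left _ _)
  have h2 : ε * (|R| + 1) ≤ δ := by
    rw [← le_div_iff₀ (by positivity)]; exact min_le_right _ _
  nlinarith [le_abs_self R]

end Cutset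

section Scores

variable {σ υ α β : Type} [Fintype σ] [Fintype υ] [Fintype α] [Fintype β]

/-- A finite minimax principle: if every mixture of coordinates exceeds `γ` somewhere on a convex
set, then all coordinates exceed `γ` simultaneously somewhere on it. -/
theorem Convex.exists_forall_lt_of_mixtures [Nonempty σ] {A : Set (σ → ℝ)} (hA : Convex ℝ A) {γ : ℝ}
    (h : ∀ q : σ → ℝ, IsPMF q → ∃ v ∈ A, γ < ∑ s, q s * v s) : ∃ v ∈ A, ∀ s, γ < v s := by
  classical
  by_contra! hc
  have hdisj : Disjoint (Set.pi Set.univ fun _ : σ => Set.Ioi γ) A :=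
    Set.disjoint_left.2 fun v hv hvA => by
      obtain ⟨s, hs⟩ := hc v hvA
      exact absurd (hv s trivial) (not_lt.2 hs)
  obtain ⟨f, c, hf1, hf2⟩ := geometric_hahn_banach_open
    (convex_pi fun _ _ => convex_Ioi γ) (isOpen_set_pi Set.finite_univ fun _ _ => isOpen_Ioi)
    hA hdisj
  have hrep : ∀ v, f v = ∑ s, f (Pi.single s 1) * v s := by
    intro v
    conv_lhs => rw [← Finset.univ_sum_single v, map_sum]
    refine Finset.sum_congr rfl fun s _ => ?_
    have : Pi.single s (v s) = v s • (Pi.single s 1 : σ → ℝ) := by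
      rw [← Pi.single_smul, smul_eq_mul, mul_one]
    rw [this, map_smul, smul_eq_mul, mul_comm]
  have hneg : ∀ s, f (Pi.single s 1) ≤ 0 := by
    intro s
    by_contra! hs
    set t := max 0 ((c - f fun _ => γ + 1) / f (Pi.single s 1)) with ht
    have ht0 : 0 ≤ t := le_max_left _ _
    have h1 := hf1 ((fun _ => γ + 1) + t • (Pi.single s 1 : σ → ℝ)) fun s' _ => by
      have : 0 ≤ (Pi.single s 1 : σ → ℝ) s' := by
        rw [Pi.single_apply]; split_ifs <;> norm_num
      have : 0 ≤ t * (Pi.single s 1 : σ → ℝ) s' := mul_nonneg ht0 this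
      simp only [Pi.add_apply, Pi.smul_apply, smul_eq_mul, Set.mem_Ioi]
      linarith
    rw [map_add, map_smul, smul_eq_mul] at h1
    have h2 : (c - f fun _ => γ + 1) ≤ t * f (Pi.single s 1) :=
      (div_le_iff₀ hs).1 (le_max_right _ _)
    linarith
  set w := -∑ s, f (Pi.single s 1) with hw
  have hw0 : 0 ≤ w := by
    rw [hw, ← Finset.sum_neg_distrib]
    exact Finset.sum_nonneg fun s _ => by linarith [hneg s]
  have hconst : ∀ t, f (fun _ => t) = -(w * t) := by
    intro t
    rw [hrep, ← Finset.sum_mul, hw]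
    ring
  have hwpos : 0 < w := by
    refine lt_of_le_of_ne hw0 fun hw00 => ?_
    have hzero : ∀ s, f (Pi.single s 1) = 0 := by
      have h1 : ∑ s, -f (Pi.single s 1) = 0 := by rw [Finset.sum_neg_distrib, ← hw, ← hw00]
      intro s
      have := (Finset.sum_eq_zero_iff_of_nonneg fun s _ => by linarith [hneg s]).1 h1 s
        (Finset.mem_univ s)
      linarith
    obtain ⟨v, hv, -⟩ := h _ (isPMF_single (Classical.arbitrary σ))
    have h1 := hf2 v hv
    have h2 := hf1 (fun _ => γ + 1) fun _ _ => by simp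
    rw [hrep] at h1 h2
    simp only [hzero, zero_mul, Finset.sum_const_zero] at h1 h2
    linarith
  obtain ⟨v, hv, hγ⟩ := h (fun s => -f (Pi.single s 1) / w)
    ⟨fun s => div_nonneg (by linarith [hneg s]) hw0, by
      rw [← Finset.sum_div, Finset.sum_neg_distrib, ← hw, div_self hwpos.ne']⟩
  have h1 := hf2 v hv
  have h2 : ∑ s, -f (Pi.single s 1) / w * v s = -f v / w := by
    rw [hrep, ← Finset.sum_neg_distrib, Finset.sum_div]
    exact Finset.sum_congr rfl fun s _ => by ring
  rw [h2, lt_div_iff₀ hwpos] at hγ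
  set t := (-f v / w - γ) / 2 with ht
  have htw : t * w = (-f v - γ * w) / 2 := by rw [ht]; field_simp
  have h3 := hf1 (fun _ => γ + t) fun _ _ => by
    simp only [Set.mem_Ioi, lt_add_iff_pos_right]
    exact pos_of_mul_pos_left (by rw [htw]; linarith) hw0
  rw [hconst] at h3
  linarith

/-- Conditional mutual information as an average of logarithms of the marginals. -/
theorem condMutInfo_eq_sum (T : υ → α → β → ℝ) :
    condMutInfo (fun t : υ × α × β => T t.1 t.2.1 t.2.2)
      = ∑ u, ∑ a, ∑ b, T u a b * (Real.logb 2 (T u a b) - Real.logb 2 (∑ b, T u a b)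
        - Real.logb 2 (∑ a, T u a b) + Real.logb 2 (∑ a, ∑ b, T u a b)) := by
  simp_rw [mul_add, mul_sub, Finset.sum_add_distrib, Finset.sum_sub_distrib]
  simp only [condMutInfo, ent, Fintype.sum_prod_type]
  have h1 : ∑ u, ∑ a, ∑ b, T u a b * Real.logb 2 (∑ a, T u a b)
      = ∑ u, ∑ b, (∑ a, T u a b) * Real.logb 2 (∑ a, T u a b) := by
    refine Finset.sum_congr rfl fun u _ => ?_
    rw [Finset.sum_comm]
    exact Finset.sum_congr rfl fun b _ => by rw [← Finset.sum_mul]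
  rw [h1]
  simp_rw [← Finset.sum_mul]
  ring

theorem exists_score_single {T : υ → α → β → ℝ} (hT : ∀ u a b, 0 ≤ T u a b)
    (hT1 : ∑ u, ∑ a, ∑ b, T u a b = 1) {γ : ℝ}
    (hγ : γ < condMutInfo (fun t : υ × α × β => T t.1 t.2.1 t.2.2)) :
    ∃ φ : υ → α → β → ℝ,
      (∀ u b, ∑ a, (∑ b, T u a b) * (2 : ℝ) ^ φ u a b ≤ ∑ a, ∑ b, T u a b) ∧
      γ < ∑ u, ∑ a, ∑ b, T u a b * φ u a b := by
  classical
  set I := condMutInfo (fun t : υ × α × β => T t.1 t.2.1 t.2.2) with hI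
  obtain ⟨d, hd, hdI⟩ : ∃ d : ℝ, 0 < d ∧ γ < I - d := ⟨(I - γ) / 2, by linarith, by linarith⟩
  have h2d : 1 < (2 : ℝ) ^ d := Real.one_lt_rpow one_lt_two hd
  set p : υ → α → ℝ := fun u a => ∑ b, T u a b with hp
  set pU : υ → ℝ := fun u => ∑ a, p u a with hpU
  set Q : υ → β → ℝ := fun u b => ∑ a, T u a b with hQ
  have hp0 : ∀ u a, 0 ≤ p u a := fun u a => Finset.sum_nonneg fun b _ => hT u a b
  have hpU0 : ∀ u, 0 ≤ pU u := fun u => Finset.sum_nonneg fun a _ => hp0 u a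
  have hQ0 : ∀ u b, 0 ≤ Q u b := fun u b => Finset.sum_nonneg fun a _ => hT u a b
  set K := Real.logb 2 (2 ^ d - 1) with hK
  set L : υ → α → β → ℝ := fun u a b => Real.logb 2 (T u a b) - Real.logb 2 (p u a)
    - Real.logb 2 (Q u b) + Real.logb 2 (pU u) with hL
  refine ⟨fun u a b => (if T u a b = 0 then K else L u a b) - d, ?_, ?_⟩
  · intro u b
    have hexpL : ∀ a, T u a b ≠ 0 → p u a * (2 : ℝ) ^ L u a b = pU u / Q u b * T u a b := by
      intro a ha
      have h0 : 0 < T u a b := lt_of_le_of_ne (hT u a b) (Ne.symm ha)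
      have h1 : 0 < p u a := h0.trans_le
        (Finset.single_le_sum (fun b _ => hT u a b) (Finset.mem_univ b))
      have h2 : 0 < Q u b := h0.trans_le
        (Finset.single_le_sum (fun a _ => hT u a b) (Finset.mem_univ a))
      have h3 : 0 < pU u := h1.trans_le
        (Finset.single_le_sum (fun a _ => hp0 u a) (Finset.mem_univ a))
      simp only [hL]
      rw [Real.rpow_add two_pos, Real.rpow_sub two_pos, Real.rpow_sub two_pos,
        Real.rpow_logb two_pos one_lt_two.ne' h0, Real.rpow_logb two_pos one_lt_two.ne' h1,
        Real.rpow_logb two_pos one_lt_two.ne' h2, Real.rpow_logb two_pos one_lt_two.ne' h3]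
      field_simp
    have hK2 : (2 : ℝ) ^ K = 2 ^ d - 1 := Real.rpow_logb two_pos one_lt_two.ne' (by linarith)
    have hterm : ∀ a, p u a * (2 : ℝ) ^ ((if T u a b = 0 then K else L u a b) - d)
        ≤ (pU u / Q u b * T u a b + p u a * (2 ^ d - 1)) / 2 ^ d := by
      intro a
      rw [Real.rpow_sub two_pos, ← mul_div_assoc]
      refine div_le_div_of_nonneg_right ?_ (by positivity)
      split_ifs with h
      · rw [h, hK2]; simp
      · rw [hexpL a h]
        exact le_add_of_nonneg_right (mul_nonneg (hp0 u a) (by linarith))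
    calc _ ≤ ∑ a, (pU u / Q u b * T u a b + p u a * (2 ^ d - 1)) / 2 ^ d :=
          Finset.sum_le_sum fun a _ => hterm a
      _ = (pU u / Q u b * Q u b + pU u * (2 ^ d - 1)) / 2 ^ d := by
          rw [← Finset.sum_div, Finset.sum_add_distrib, ← Finset.mul_sum, ← Finset.sum_mul]
      _ ≤ (pU u + pU u * (2 ^ d - 1)) / 2 ^ d := by
          refine div_le_div_of_nonneg_right (add_le_add_left ?_ _) (by positivity)
          rcases (hQ0 u b).eq_or_lt with h | h
          · rw [← h]; simpa using hpU0 u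
          · rw [div_mul_cancel₀ _ h.ne']
      _ = pU u := by field_simp; ring
  · have h1 : ∑ u, ∑ a, ∑ b, T u a b * ((if T u a b = 0 then K else L u a b) - d)
        = ∑ u, ∑ a, ∑ b, (T u a b * L u a b - T u a b * d) := by
      refine Finset.sum_congr rfl fun u _ => Finset.sum_congr rfl fun a _ =>
        Finset.sum_congr rfl fun b _ => ?_
      split_ifs with h
      · simp [h]
      · ring
    rw [h1]
    simp_rw [Finset.sum_sub_distrib, ← Finset.sum_mul]
    rw [hT1, one_mul, ← condMutInfo_eq_sum T]
    exact hdI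

/-- A single score function that is simultaneously good for all states. -/
theorem exists_score [Nonempty σ] {T : σ → υ → α → β → ℝ} (hT : ∀ s u a b, 0 ≤ T s u a b)
    {p : υ → α → ℝ} (hTp : ∀ s u a, ∑ b, T s u a b = p u a) (hp : ∑ u, ∑ a, p u a = 1) {γ : ℝ}
    (hγ : ∀ q : σ → ℝ, IsPMF q →
      γ < condMutInfo (fun t : υ × α × β => ∑ s, q s * T s t.1 t.2.1 t.2.2)) :
    ∃ φ : υ → α → β → ℝ, (∀ u b, ∑ a, p u a * (2 : ℝ) ^ φ u a b ≤ ∑ a, p u a) ∧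
      ∀ s, γ < ∑ u, ∑ a, ∑ b, T s u a b * φ u a b := by
  have hp0 : ∀ u a, 0 ≤ p u a := fun u a => by
    rw [← hTp (Classical.arbitrary σ)]
    exact Finset.sum_nonneg fun b _ => hT _ _ _ _
  have hconv : Convex ℝ {v : σ → ℝ | ∃ φ : υ → α → β → ℝ,
      (∀ u b, ∑ a, p u a * (2 : ℝ) ^ φ u a b ≤ ∑ a, p u a) ∧
      ∀ s, v s = ∑ u, ∑ a, ∑ b, T s u a b * φ u a b} := by
    rintro v ⟨φ, hφ, hv⟩ v' ⟨φ', hφ', hv'⟩ c c' hc hc' hcc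
    refine ⟨fun u a b => c * φ u a b + c' * φ' u a b, fun u b => ?_, fun s => ?_⟩
    · have hx : ∀ x y : ℝ, (2 : ℝ) ^ (c * x + c' * y) ≤ c * 2 ^ x + c' * 2 ^ y := by
        intro x y
        have := convexOn_exp.2 (Set.mem_univ (Real.log 2 * x)) (Set.mem_univ (Real.log 2 * y))
          hc hc' hcc
        simp only [smul_eq_mul] at this
        rw [Real.rpow_def_of_pos two_pos, Real.rpow_def_of_pos two_pos,
          Real.rpow_def_of_pos two_pos]
        calc _ = Real.exp (c * (Real.log 2 * x) + c' * (Real.log 2 * y)) := by ring_nf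
          _ ≤ _ := this
      calc _ ≤ ∑ a, p u a * (c * 2 ^ φ u a b + c' * 2 ^ φ' u a b) :=
            Finset.sum_le_sum fun a _ => mul_le_mul_of_nonneg_left (hx _ _) (hp0 u a)
        _ = c * (∑ a, p u a * 2 ^ φ u a b) + c' * ∑ a, p u a * 2 ^ φ' u a b := by
            rw [Finset.mul_sum, Finset.mul_sum, ← Finset.sum_add_distrib]
            exact Finset.sum_congr rfl fun a _ => by ring
        _ ≤ c * (∑ a, p u a) + c' * ∑ a, p u a :=
            add_le_add (mul_le_mul_of_nonneg_left (hφ u b) hc)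
              (mul_le_mul_of_nonneg_left (hφ' u b) hc')
        _ = _ := by rw [← add_mul, hcc, one_mul]
    · simp only [Pi.add_apply, Pi.smul_apply, smul_eq_mul, hv, hv', Finset.mul_sum]
      simp_rw [← Finset.sum_add_distrib]
      refine Finset.sum_congr rfl fun u _ => Finset.sum_congr rfl fun a _ =>
        Finset.sum_congr rfl fun b _ => by ring
  obtain ⟨v, ⟨φ, hφ, hv⟩, hlt⟩ := hconv.exists_forall_lt_of_mixtures (γ := γ) fun q hq => by
    have hmarg : ∀ u a, ∑ b, ∑ s, q s * T s u a b = p u a := by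
      intro u a
      rw [Finset.sum_comm]
      simp_rw [← Finset.mul_sum, hTp, ← Finset.sum_mul, hq.2, one_mul]
    obtain ⟨φ, hφ, hlt⟩ := exists_score_single (T := fun u a b => ∑ s, q s * T s u a b)
      (fun u a b => Finset.sum_nonneg fun s _ => mul_nonneg (hq.1 s) (hT s u a b))
      (by simp_rw [hmarg]; exact hp) (hγ q hq)
    simp_rw [hmarg] at hφ
    refine ⟨_, ⟨φ, hφ, fun s => rfl⟩, hlt.trans_eq ?_⟩
    simp_rw [Finset.mul_sum, Finset.sum_mul]
    symm
    rw [Finset.sum_comm]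
    refine Finset.sum_congr rfl fun u _ => ?_
    rw [Finset.sum_comm]
    refine Finset.sum_congr rfl fun a _ => ?_
    rw [Finset.sum_comm]
    refine Finset.sum_congr rfl fun b _ => Finset.sum_congr rfl fun s _ => by ring
  exact ⟨φ, hφ, fun s => (hlt s).trans_eq (hv s)⟩

theorem mutInfo_eq_condMutInfo {p : α × β → ℝ} (hp : IsPMF p) :
    mutInfo p = condMutInfo fun t : Unit × α × β => p t.2 := by
  have h : ∑ a, ∑ b, p (a, b) = 1 := by rw [← Fintype.sum_prod_type]; exact hp.2
  simp [mutInfo, condMutInfo, ent, Fintype.sum_prod_type, h]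

theorem exists_score_mutInfo [Nonempty σ] {T : σ → α → β → ℝ} (hT : ∀ s a b, 0 ≤ T s a b)
    {p : α → ℝ} (hTp : ∀ s a, ∑ b, T s a b = p a) (hp : ∑ a, p a = 1) {γ : ℝ}
    (hγ : ∀ q : σ → ℝ, IsPMF q → γ < mutInfo fun t : α × β => ∑ s, q s * T s t.1 t.2) :
    ∃ φ : α → β → ℝ, (∀ b, ∑ a, p a * (2 : ℝ) ^ φ a b ≤ 1) ∧
      ∀ s, γ < ∑ a, ∑ b, T s a b * φ a b := by
  obtain ⟨φ, hφ, h⟩ := exists_score (υ := Unit) (T := fun s _ => T s) (p := fun _ => p)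
    (fun s _ => hT s) (fun s _ => hTp s) (by simpa using hp) (γ := γ) fun q hq => by
      have := hγ q hq
      rwa [mutInfo_eq_condMutInfo] at this
      refine ⟨fun t => Finset.sum_nonneg fun s _ => mul_nonneg (hq.1 s) (hT _ _ _), ?_⟩
      rw [Fintype.sum_prod_type]
      have h1 : ∀ a, ∑ b, ∑ s, q s * T s a b = p a := by
        intro a
        rw [Finset.sum_comm]
        simp_rw [← Finset.mul_sum, hTp, ← Finset.sum_mul, hq.2, one_mul]
      simp_rw [h1, hp]
  exact ⟨φ (), fun b => (hφ () b).trans_eq hp, fun s => by simpa using h s⟩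

end Scores

section Superposition

theorem epsilon_eq_of_unique {ι : Type} [Nonempty ι] {A : ι → Prop} {i : ι} (hi : A i)
    (h : ∀ i', i' ≠ i → ¬ A i') : Classical.epsilon A = i := by
  by_contra hne
  exact h _ hne (Classical.epsilon_spec ⟨i, hi⟩)

open Classical in
/-- The real-valued indicator of a proposition. -/
def ind (P : Prop) : ℝ := if P then 1 else 0

theorem ind_nonneg (P : Prop) : 0 ≤ ind P := by unfold ind; split_ifs <;> norm_num

theorem ind_of {P : Prop} (h : P) : ind P = 1 := if_pos h

theorem ind_le_of_imp {P : Prop} {a : ℝ} (h0 : 0 ≤ a) (h : P → 1 ≤ a) : ind P ≤ a := by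
  unfold ind; split_ifs with hP
  exacts [h hP, h0]

theorem sum_ind_nonneg {ι : Type} (S : Finset ι) (P : ι → Prop) : 0 ≤ ∑ i ∈ S, ind (P i) :=
  Finset.sum_nonneg fun _ _ => ind_nonneg _

theorem one_le_sum_ind {ι : Type} {S : Finset ι} {P : ι → Prop} {i : ι} (hi : i ∈ S) (h : P i) :
    1 ≤ ∑ i ∈ S, ind (P i) :=
  (ind_of h).symm.le.trans
    (Finset.single_le_sum (f := fun i => ind (P i)) (fun _ _ => ind_nonneg _) hi)

theorem sum_sum_sum_mul {ι Y Y₁ : Type} [Fintype Y] [Fintype Y₁] (S : Finset ι)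
    (v : Y → Y₁ → ℝ) (F : ι → Y → Y₁ → ℝ) :
    ∑ i ∈ S, ∑ y, ∑ y1, v y y1 * F i y y1 = ∑ y, ∑ y1, v y y1 * ∑ i ∈ S, F i y y1 := by
  simp_rw [Finset.mul_sum]
  rw [Finset.sum_comm]
  exact Finset.sum_congr rfl fun y _ => Finset.sum_comm

variable {U X Y Y₁ Λ B J : Type} [Fintype Λ] [Fintype B] [Fintype J]
  [Nonempty Λ] [Nonempty B] [Nonempty J]

open Classical in
/-- Decode-forward decoding with a superposition codebook `c`: the error indicator is bounded by
the sum of the indicators of the elementary error events. -/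
theorem superposition_decode (c : Λ × B → U × (J → X)) (A1 : U → Y₁ → Prop) (A2 : U → Y → Prop)
    (A3 : U → X → Y → Prop) :
    ∃ (f1 : Y₁ → Λ) (g : Y × Λ → Λ × B × J), ∀ l b j y y1,
      ind (g (y, f1 y1) ≠ (l, b, j)) ≤
        ind (¬ A1 (c (l, b)).1 y1) + ∑ i ∈ Finset.univ.erase (l, b), ind (A1 (c i).1 y1)
        + ind (¬ A2 (c (l, b)).1 y) + ∑ b' ∈ Finset.univ.erase b, ind (A2 (c (l, b')).1 y)
        + ind (¬ A3 (c (l, b)).1 ((c (l, b)).2 j) y)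
        + ∑ j' ∈ Finset.univ.erase j, ind (A3 (c (l, b)).1 ((c (l, b)).2 j') y) := by
  set bin : Y × Λ → B := fun t => Classical.epsilon fun b => A2 (c (t.2, b)).1 t.1 with hbin
  refine ⟨fun y1 => (Classical.epsilon fun i => A1 (c i).1 y1).1,
    fun t => (t.2, bin t, Classical.epsilon fun j =>
      A3 (c (t.2, bin t)).1 ((c (t.2, bin t)).2 j) t.1), fun l b j y y1 => ?_⟩
  have h1 := ind_nonneg (¬ A1 (c (l, b)).1 y1)
  have h2 := sum_ind_nonneg (Finset.univ.erase (l, b)) fun i => A1 (c i).1 y1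
  have h3 := ind_nonneg (¬ A2 (c (l, b)).1 y)
  have h4 := sum_ind_nonneg (Finset.univ.erase b) fun b' => A2 (c (l, b')).1 y
  have h5 := ind_nonneg (¬ A3 (c (l, b)).1 ((c (l, b)).2 j) y)
  have h6 := sum_ind_nonneg (Finset.univ.erase j) fun j' => A3 (c (l, b)).1 ((c (l, b)).2 j') y
  refine ind_le_of_imp (by positivity) fun hg => ?_
  by_contra! hlt
  refine hg ?_
  have e1 : A1 (c (l, b)).1 y1 := by
    by_contra h; rw [ind_of h] at hlt; linarith
  have e2 : ∀ i, i ≠ (l, b) → ¬ A1 (c i).1 y1 := fun i hi h => by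
    have := one_le_sum_ind (P := fun i => A1 (c i).1 y1)
      (Finset.mem_erase.2 ⟨hi, Finset.mem_univ i⟩) h
    linarith
  have e3 : A2 (c (l, b)).1 y := by
    by_contra h; rw [ind_of h] at hlt; linarith
  have e4 : ∀ i, i ≠ b → ¬ A2 (c (l, i)).1 y := fun i hi h => by
    have := one_le_sum_ind (P := fun b' => A2 (c (l, b')).1 y)
      (Finset.mem_erase.2 ⟨hi, Finset.mem_univ i⟩) h
    linarith
  have e5 : A3 (c (l, b)).1 ((c (l, b)).2 j) y := by
    by_contra h; rw [ind_of h] at hlt; linarith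
  have e6 : ∀ i, i ≠ j → ¬ A3 (c (l, b)).1 ((c (l, b)).2 i) y := fun i hi h => by
    have := one_le_sum_ind (P := fun j' => A3 (c (l, b)).1 ((c (l, b)).2 j') y)
      (Finset.mem_erase.2 ⟨hi, Finset.mem_univ i⟩) h
    linarith
  have hl : (Classical.epsilon fun i => A1 (c i).1 y1) = (l, b) := epsilon_eq_of_unique e1 e2
  have hb : bin (y, l) = b := epsilon_eq_of_unique e3 e4
  simp only [hl, hb]
  rw [epsilon_eq_of_unique (A := fun j => A3 (c (l, b)).1 ((c (l, b)).2 j) y) e5 e6]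

variable [Fintype U] [Fintype X] [Fintype Y] [Fintype Y₁]

open Classical in
/-- One-shot random coding bound for decode-forward with superposition coding. -/
theorem exists_superposition_code {P : U → ℝ} (hP : IsPMF P) {K : U → X → ℝ}
    (hK : ∀ u, IsPMF (K u)) {V : X → Y → Y₁ → ℝ} (hV0 : ∀ x y y1, 0 ≤ V x y y1)
    (hV1 : ∀ x, ∑ y, ∑ y1, V x y y1 = 1)
    {A1 : U → Y₁ → Prop} {A2 : U → Y → Prop} {A3 : U → X → Y → Prop} {δ1 δ2 δ3 η1 η2 η3 : ℝ}
    (hδ1 : ∀ y1, ∑ u, P u * ind (A1 u y1) ≤ δ1) (hδ2 : ∀ y, ∑ u, P u * ind (A2 u y) ≤ δ2)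
    (hδ3 : ∀ u y, ∑ x, K u x * ind (A3 u x y) ≤ δ3)
    (hη1 : ∑ u, P u * ∑ x, K u x * ∑ y, ∑ y1, V x y y1 * ind (¬ A1 u y1) ≤ η1)
    (hη2 : ∑ u, P u * ∑ x, K u x * ∑ y, ∑ y1, V x y y1 * ind (¬ A2 u y) ≤ η2)
    (hη3 : ∑ u, P u * ∑ x, K u x * ∑ y, ∑ y1, V x y y1 * ind (¬ A3 u x y) ≤ η3) :
    ∃ (f : Λ × B × J → X) (f1 : Y₁ → Λ) (g : Y × Λ → Λ × B × J),
      (Fintype.card (Λ × B × J) : ℝ)⁻¹ * ∑ m, ∑ y, ∑ y1,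
          (if g (y, f1 y1) = m then 0 else V (f m) y y1)
        ≤ η1 + η2 + η3 + (Fintype.card Λ * Fintype.card B - 1) * δ1
          + (Fintype.card B - 1) * δ2 + (Fintype.card J - 1) * δ3 := by
  choose f1 g hfg using fun c : Λ × B → U × (J → X) => superposition_decode c A1 A2 A3
  set w : U × (J → X) → ℝ := fun a => P a.1 * ∏ j, K a.1 (a.2 j) with hw
  have hw_pmf : IsPMF w := by
    refine ⟨fun a => mul_nonneg (hP.1 _) (Finset.prod_nonneg fun j _ => (hK _).1 _), ?_⟩
    rw [Fintype.sum_prod_type]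
    simp_rw [hw, ← Finset.mul_sum, sum_pi_prod_eq_one fun _ => (hK _).2, mul_one, hP.2]
  have hc_pmf : IsPMF fun c : Λ × B → U × (J → X) => ∏ i, w (c i) := isPMF_pi fun _ => hw_pmf
  have hw1 : ∀ (j : J) (F : U → X → ℝ), ∑ a, w a * F a.1 (a.2 j)
      = ∑ u, P u * ∑ x, K u x * F u x := by
    intro j F
    rw [Fintype.sum_prod_type]
    simp_rw [hw, mul_assoc, ← Finset.mul_sum]
    refine Finset.sum_congr rfl fun u _ => ?_
    rw [sum_pi_prod_mul_apply (w := fun _ => K u) (fun _ => (hK u).2) j (F u)]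
  have hw2 : ∀ {j j' : J} (_ : j ≠ j') (F : U → X → X → ℝ), ∑ a, w a * F a.1 (a.2 j) (a.2 j')
      = ∑ u, P u * ∑ x, K u x * ∑ x', K u x' * F u x x' := by
    intro j j' hj F
    rw [Fintype.sum_prod_type]
    simp_rw [hw, mul_assoc, ← Finset.mul_sum]
    refine Finset.sum_congr rfl fun u _ => ?_
    rw [sum_pi_prod_mul_apply₂ (w := fun _ => K u) (fun _ => (hK u).2) hj (F u)]
    simp_rw [Finset.mul_sum, mul_assoc]
  have hw0 : ∀ F : U → ℝ, ∑ a, w a * F a.1 = ∑ u, P u * F u := by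
    intro F
    rw [hw1 (Classical.arbitrary J) fun u _ => F u]
    simp_rw [← Finset.sum_mul, (hK _).2, one_mul]
  -- the elementary error probabilities of message `(l, b, j)` for a given codebook
  set G1 : Λ × B × J → (Λ × B → U × (J → X)) → ℝ := fun m c => ∑ y, ∑ y1,
    V ((c (m.1, m.2.1)).2 m.2.2) y y1 * ind (¬ A1 (c (m.1, m.2.1)).1 y1) with hG1
  set G2 : Λ × B × J → Λ × B → (Λ × B → U × (J → X)) → ℝ := fun m i c => ∑ y, ∑ y1,
    V ((c (m.1, m.2.1)).2 m.2.2) y y1 * ind (A1 (c i).1 y1) with hG2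
  set G3 : Λ × B × J → (Λ × B → U × (J → X)) → ℝ := fun m c => ∑ y, ∑ y1,
    V ((c (m.1, m.2.1)).2 m.2.2) y y1 * ind (¬ A2 (c (m.1, m.2.1)).1 y) with hG3
  set G4 : Λ × B × J → B → (Λ × B → U × (J → X)) → ℝ := fun m b c => ∑ y, ∑ y1,
    V ((c (m.1, m.2.1)).2 m.2.2) y y1 * ind (A2 (c (m.1, b)).1 y) with hG4
  set G5 : Λ × B × J → (Λ × B → U × (J → X)) → ℝ := fun m c => ∑ y, ∑ y1,
    V ((c (m.1, m.2.1)).2 m.2.2) y y1 *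
      ind (¬ A3 (c (m.1, m.2.1)).1 ((c (m.1, m.2.1)).2 m.2.2) y) with hG5
  set G6 : Λ × B × J → J → (Λ × B → U × (J → X)) → ℝ := fun m j c => ∑ y, ∑ y1,
    V ((c (m.1, m.2.1)).2 m.2.2) y y1 *
      ind (A3 (c (m.1, m.2.1)).1 ((c (m.1, m.2.1)).2 j) y) with hG6
  have hpoint : ∀ c (m : Λ × B × J), ∑ y, ∑ y1, (if g c (y, f1 c y1) = m then 0 else
      V ((c (m.1, m.2.1)).2 m.2.2) y y1) ≤ G1 m c + ∑ i ∈ Finset.univ.erase (m.1, m.2.1), G2 m i c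
        + G3 m c + ∑ b ∈ Finset.univ.erase m.2.1, G4 m b c + G5 m c
        + ∑ j ∈ Finset.univ.erase m.2.2, G6 m j c := by
    rintro c ⟨l, b, j⟩
    simp only [hG1, hG2, hG3, hG4, hG5, hG6]
    rw [sum_sum_sum_mul, sum_sum_sum_mul, sum_sum_sum_mul]
    simp_rw [← Finset.sum_add_distrib, ← mul_add]
    refine Finset.sum_le_sum fun y _ => Finset.sum_le_sum fun y1 _ => ?_
    refine le_trans (le_of_eq ?_) (mul_le_mul_of_nonneg_left (hfg c l b j y y1) (hV0 _ _ _))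
    unfold ind
    by_cases h : g c (y, f1 c y1) = (l, b, j) <;> simp [h]
  have hV1' : ∀ x (F : Y → Y₁ → ℝ) (d : ℝ), (∀ y y1, F y y1 ≤ d) →
      ∑ y, ∑ y1, V x y y1 * F y y1 ≤ d := by
    intro x F d h
    calc _ ≤ ∑ y, ∑ y1, V x y y1 * d := Finset.sum_le_sum fun y _ => Finset.sum_le_sum fun y1 _ =>
          mul_le_mul_of_nonneg_left (h y y1) (hV0 _ _ _)
      _ = d := by simp_rw [← Finset.sum_mul]; rw [hV1, one_mul]
  have hE1 : ∀ m, ∑ c, (∏ i, w (c i)) * G1 m c ≤ η1 := fun m => by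
    refine le_trans (le_of_eq ?_) hη1
    rw [← hw1 m.2.2 fun u x => ∑ y, ∑ y1, V x y y1 * ind (¬ A1 u y1)]
    exact sum_pi_prod_mul_apply (fun _ => hw_pmf.2) (m.1, m.2.1)
      fun a => ∑ y, ∑ y1, V (a.2 m.2.2) y y1 * ind (¬ A1 a.1 y1)
  have hE3 : ∀ m, ∑ c, (∏ i, w (c i)) * G3 m c ≤ η2 := fun m => by
    refine le_trans (le_of_eq ?_) hη2
    rw [← hw1 m.2.2 fun u x => ∑ y, ∑ y1, V x y y1 * ind (¬ A2 u y)]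
    exact sum_pi_prod_mul_apply (fun _ => hw_pmf.2) (m.1, m.2.1)
      fun a => ∑ y, ∑ y1, V (a.2 m.2.2) y y1 * ind (¬ A2 a.1 y)
  have hE5 : ∀ m, ∑ c, (∏ i, w (c i)) * G5 m c ≤ η3 := fun m => by
    refine le_trans (le_of_eq ?_) hη3
    rw [← hw1 m.2.2 fun u x => ∑ y, ∑ y1, V x y y1 * ind (¬ A3 u x y)]
    exact sum_pi_prod_mul_apply (fun _ => hw_pmf.2) (m.1, m.2.1)
      fun a => ∑ y, ∑ y1, V (a.2 m.2.2) y y1 * ind (¬ A3 a.1 (a.2 m.2.2) y)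
  have hswap : ∀ {i i' : Λ × B} (_ : i ≠ i') (j : J) (E : U → Y → Y₁ → ℝ) (d : ℝ),
      (∀ y y1, ∑ u, P u * E u y y1 ≤ d) →
      ∑ c : Λ × B → U × (J → X), (∏ i, w (c i)) *
        (∑ y, ∑ y1, V ((c i).2 j) y y1 * E (c i').1 y y1) ≤ d := by
    intro i i' hi j E d hE
    rw [sum_pi_prod_mul_apply₂ (w := fun _ => w) (fun _ => hw_pmf.2) hi
      fun a a' => ∑ y, ∑ y1, V (a.2 j) y y1 * E a'.1 y y1]
    simp_rw [mul_assoc, ← Finset.mul_sum]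
    refine hw_pmf.sum_mul_le fun a => ?_
    rw [hw0 fun u => ∑ y, ∑ y1, V (a.2 j) y y1 * E u y y1]
    calc _ = ∑ y, ∑ y1, V (a.2 j) y y1 * ∑ u, P u * E u y y1 := by
          simp_rw [Finset.mul_sum]
          rw [Finset.sum_comm]
          refine Finset.sum_congr rfl fun y _ => ?_
          rw [Finset.sum_comm]
          exact Finset.sum_congr rfl fun y1 _ => Finset.sum_congr rfl fun u _ => by ring
      _ ≤ d := hV1' _ _ d hE
  have hE2 : ∀ m, ∀ i ∈ Finset.univ.erase (m.1, m.2.1), ∑ c, (∏ i, w (c i)) * G2 m i c ≤ δ1 :=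
    fun m i hi => hswap (Finset.ne_of_mem_erase hi).symm m.2.2 (fun u _ y1 => ind (A1 u y1)) δ1
      fun _ y1 => hδ1 y1
  have hE4 : ∀ m : Λ × B × J, ∀ b ∈ Finset.univ.erase m.2.1,
      ∑ c, (∏ i, w (c i)) * G4 m b c ≤ δ2 :=
    fun m b hb => hswap (i := (m.1, m.2.1)) (i' := (m.1, b))
      (fun h => Finset.ne_of_mem_erase hb (Prod.mk.inj h).2.symm)
      m.2.2 (fun u y _ => ind (A2 u y)) δ2 fun y _ => hδ2 y
  have hE6 : ∀ m : Λ × B × J, ∀ j ∈ Finset.univ.erase m.2.2,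
      ∑ c, (∏ i, w (c i)) * G6 m j c ≤ δ3 := fun m j hj => by
    rw [sum_pi_prod_mul_apply (w := fun _ => w) (fun _ => hw_pmf.2) (m.1, m.2.1)
      fun a => ∑ y, ∑ y1, V (a.2 m.2.2) y y1 * ind (A3 a.1 (a.2 j) y),
      hw2 (Finset.ne_of_mem_erase hj).symm
        fun u x x' => ∑ y, ∑ y1, V x y y1 * ind (A3 u x' y)]
    refine hP.sum_mul_le fun u => (hK u).sum_mul_le fun x => ?_
    calc _ = ∑ y, ∑ y1, V x y y1 * ∑ x', K u x' * ind (A3 u x' y) := by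
          simp_rw [Finset.mul_sum]
          rw [Finset.sum_comm]
          refine Finset.sum_congr rfl fun y _ => ?_
          rw [Finset.sum_comm]
          exact Finset.sum_congr rfl fun y1 _ => Finset.sum_congr rfl fun u _ => by ring
      _ ≤ δ3 := hV1' _ _ δ3 fun y _ => hδ3 u y
  have hcard : ∀ {ι : Type} [Fintype ι] [DecidableEq ι] (i : ι),
      ((Finset.univ.erase i).card : ℝ) = Fintype.card ι - 1 := by
    intro ι _ _ i
    rw [Finset.card_erase_of_mem (Finset.mem_univ i), Finset.card_univ,
      Nat.cast_sub (Fintype.card_pos_iff.2 ⟨i⟩), Nat.cast_one]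
  obtain ⟨c, hc⟩ := hc_pmf.exists_le (F := fun c => (Fintype.card (Λ × B × J) : ℝ)⁻¹ * ∑ m, ∑ y,
      ∑ y1, (if g c (y, f1 c y1) = m then 0 else V ((c (m.1, m.2.1)).2 m.2.2) y y1))
    (c := η1 + η2 + η3 + (Fintype.card Λ * Fintype.card B - 1) * δ1
          + (Fintype.card B - 1) * δ2 + (Fintype.card J - 1) * δ3) (by
    simp_rw [mul_left_comm _ (Fintype.card (Λ × B × J) : ℝ)⁻¹, ← Finset.mul_sum]
    rw [inv_mul_le_iff₀ (by simp only [Nat.cast_pos, Fintype.card_pos])]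
    simp_rw [Finset.mul_sum (s := (Finset.univ : Finset (Λ × B × J)))]
    rw [Finset.sum_comm, ← nsmul_eq_mul, ← Finset.card_univ]
    refine Finset.sum_le_card_nsmul _ _ _ fun m _ => ?_
    have hS2 := Finset.sum_le_card_nsmul _ _ _ (hE2 m)
    have hS4 := Finset.sum_le_card_nsmul _ _ _ (hE4 m)
    have hS6 := Finset.sum_le_card_nsmul _ _ _ (hE6 m)
    rw [Finset.sum_comm, nsmul_eq_mul, hcard] at hS2 hS4 hS6
    simp_rw [← Finset.mul_sum] at hS2 hS4 hS6
    rw [Fintype.card_prod, Nat.cast_mul] at hS2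
    calc _ ≤ ∑ c : Λ × B → U × (J → X), (∏ i, w (c i)) * (G1 m c
          + ∑ i ∈ Finset.univ.erase (m.1, m.2.1), G2 m i c + G3 m c
          + ∑ b ∈ Finset.univ.erase m.2.1, G4 m b c + G5 m c
          + ∑ j ∈ Finset.univ.erase m.2.2, G6 m j c) :=
          Finset.sum_le_sum fun c _ => mul_le_mul_of_nonneg_left (hpoint c m) (hc_pmf.1 c)
      _ ≤ _ := by
          simp_rw [mul_add, Finset.sum_add_distrib]
          linarith [hE1 m, hE3 m, hE5 m])
  exact ⟨fun m => (c (m.1, m.2.1)).2 m.2.2, f1 c, g c, hc⟩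

end Superposition

section Blocks

variable {α β : Type} [Fintype α] [Fintype β] {n : ℕ}

theorem sum_ind_le_of_sum_rpow_le_one {w φ : Fin n → α → ℝ} (hw : ∀ i a, 0 ≤ w i a)
    (h : ∀ i, ∑ a, w i a * (2 : ℝ) ^ φ i a ≤ 1) (t : ℝ) :
    ∑ f : Fin n → α, (∏ i, w i (f i)) * ind (t ≤ ∑ i, φ i (f i)) ≤ (2 : ℝ) ^ (-t) := by
  calc _ ≤ ∑ f : Fin n → α, (2 : ℝ) ^ (-t) * ∏ i, (w i (f i) * (2 : ℝ) ^ φ i (f i)) := by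
        refine Finset.sum_le_sum fun f _ => ?_
        rw [Finset.prod_mul_distrib, mul_left_comm,
          ← Real.rpow_sum_of_pos (two_pos : (0 : ℝ) < 2), ← Real.rpow_add two_pos]
        exact mul_le_mul_of_nonneg_left (ind_le_of_imp (by positivity) fun hf =>
          Real.one_le_rpow one_le_two (by linarith)) (Finset.prod_nonneg fun i _ => hw i _)
    _ = (2 : ℝ) ^ (-t) * ∏ i, ∑ a, w i a * (2 : ℝ) ^ φ i a := by
        rw [← Finset.mul_sum, sum_pi_prod_eq fun i a => w i a * (2 : ℝ) ^ φ i a]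
    _ ≤ (2 : ℝ) ^ (-t) * 1 := by
        gcongr
        refine Finset.prod_le_one (fun i _ => Finset.sum_nonneg fun a _ => ?_) fun i _ => h i
        have := hw i a
        positivity
    _ = _ := mul_one _

theorem sum_ind_not_le_pow {P : Fin n → α → ℝ} (hP : ∀ i a, 0 ≤ P i a) {ψ : α → ℝ} {γ l ρ : ℝ}
    (hl : 0 < l) (h : ∀ i, ∑ a, P i a * Real.exp (-(l * (ψ a - γ))) ≤ ρ) :
    ∑ f : Fin n → α, (∏ i, P i (f i)) * ind (¬ n * γ ≤ ∑ i, ψ (f i)) ≤ ρ ^ n := by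
  calc _ ≤ ∑ f : Fin n → α, ∏ i, (P i (f i) * Real.exp (-(l * (ψ (f i) - γ)))) := by
        refine Finset.sum_le_sum fun f _ => ?_
        rw [Finset.prod_mul_distrib, ← Real.exp_sum]
        refine mul_le_mul_of_nonneg_left (ind_le_of_imp (by positivity) fun hf => ?_)
          (Finset.prod_nonneg fun i _ => hP i _)
        refine Real.one_le_exp ?_
        rw [Finset.sum_neg_distrib, ← Finset.mul_sum, Finset.sum_sub_distrib]
        simp only [Finset.sum_const, Finset.card_univ, Fintype.card_fin, nsmul_eq_mul]
        rw [not_le] at hf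
        nlinarith
    _ = ∏ i, ∑ a, P i a * Real.exp (-(l * (ψ a - γ))) :=
        sum_pi_prod_eq fun i a => P i a * Real.exp (-(l * (ψ a - γ)))
    _ ≤ ∏ _i : Fin n, ρ := Finset.prod_le_prod (fun i _ => Finset.sum_nonneg fun a _ =>
        mul_nonneg (hP i a) (Real.exp_pos _).le) fun i _ => h i
    _ = ρ ^ n := by simp

theorem sum_pi_prod_type (F : (Fin n → α × β) → ℝ) :
    ∑ f, F f = ∑ a : Fin n → α, ∑ b : Fin n → β, F fun i => (a i, b i) := by
  rw [← Fintype.sum_prod_type', ← (Equiv.arrowProdEquivProdArrow (Fin n) (fun _ => α)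
    fun _ => β).symm.sum_comp]
  rfl

end Blocks

section FiniteLength

theorem sum_mixture_eq {υ 𝒳 𝒮 𝒴 𝒴₁ : Type} [Fintype υ] [Fintype 𝒳] [Fintype 𝒮] [Fintype 𝒴]
    [Fintype 𝒴₁] (p : υ → ℝ) (κ : υ → 𝒳 → ℝ) (q : 𝒮 → ℝ) (w : 𝒳 → 𝒮 → 𝒴 → 𝒴₁ → ℝ)
    (F : υ → 𝒳 → 𝒴 → 𝒴₁ → ℝ) :
    ∑ u, p u * ∑ x, κ u x * ∑ y, ∑ y1, (∑ s, q s * w x s y y1) * F u x y y1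
      = ∑ s, q s * ∑ u, ∑ x, ∑ y, ∑ y1, p u * κ u x * w x s y y1 * F u x y y1 := by
  simp_rw [Finset.mul_sum, Finset.sum_mul, Finset.mul_sum]
  symm
  rw [Finset.sum_comm]
  refine Finset.sum_congr rfl fun u _ => ?_
  rw [Finset.sum_comm]
  refine Finset.sum_congr rfl fun x _ => ?_
  rw [Finset.sum_comm]
  refine Finset.sum_congr rfl fun y _ => ?_
  rw [Finset.sum_comm]
  exact Finset.sum_congr rfl fun y1 _ => Finset.sum_congr rfl fun s _ => by ring

variable {υ 𝒳 𝒮 𝒴 𝒴₁ : Type} [Fintype υ] [Fintype 𝒳] [Fintype 𝒮] [Fintype 𝒴] [Fintype 𝒴₁]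
  {W : 𝒳 → 𝒮 → 𝒴 × 𝒴₁ → ℝ} {n : ℕ}

theorem sum_blocks_ind_not_le_pow (hW : IsChannel W) {p : υ → ℝ} (hp : IsPMF p)
    {κ : υ → 𝒳 → ℝ} (hκ : ∀ u, IsPMF (κ u)) {qn : (Fin n → 𝒮) → ℝ} (hqn : IsPMF qn)
    {ψ : υ × 𝒳 × 𝒴 × 𝒴₁ → ℝ} {γ l ρ : ℝ} (hl : 0 < l)
    (h : ∀ s, ∑ a : υ × 𝒳 × 𝒴 × 𝒴₁, p a.1 * κ a.1 a.2.1 * W a.2.1 s a.2.2 *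
      Real.exp (-(l * (ψ a - γ))) ≤ ρ) :
    ∑ u : Fin n → υ, (∏ i, p (u i)) * ∑ x : Fin n → 𝒳, (∏ i, κ (u i) (x i)) *
      ∑ y : Fin n → 𝒴, ∑ y1 : Fin n → 𝒴₁, (∑ s, qn s * ∏ i, W (x i) (s i) (y i, y1 i)) *
        ind (¬ n * γ ≤ ∑ i, ψ (u i, x i, y i, y1 i)) ≤ ρ ^ n := by
  calc _ = ∑ s, qn s * ∑ f : Fin n → υ × 𝒳 × 𝒴 × 𝒴₁,
        (∏ i, p (f i).1 * κ (f i).1 (f i).2.1 * W (f i).2.1 (s i) (f i).2.2) *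
          ind (¬ n * γ ≤ ∑ i, ψ (f i)) := by
        rw [sum_mixture_eq (fun u : Fin n → υ => ∏ i, p (u i))
          (fun u (x : Fin n → 𝒳) => ∏ i, κ (u i) (x i)) qn
          (fun x s (y : Fin n → 𝒴) (y1 : Fin n → 𝒴₁) => ∏ i, W (x i) (s i) (y i, y1 i))
          fun u x y y1 => ind (¬ n * γ ≤ ∑ i, ψ (u i, x i, y i, y1 i))]
        refine Finset.sum_congr rfl fun s _ => congrArg _ ?_
        rw [sum_pi_prod_type]
        refine Finset.sum_congr rfl fun u _ => ?_
        rw [sum_pi_prod_type]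
        refine Finset.sum_congr rfl fun x _ => ?_
        rw [sum_pi_prod_type]
        refine Finset.sum_congr rfl fun y _ => Finset.sum_congr rfl fun y1 _ => ?_
        rw [Finset.prod_mul_distrib, Finset.prod_mul_distrib]
    _ ≤ ρ ^ n := by
        refine hqn.sum_mul_le fun s => ?_
        have hP : ∀ (i : Fin n) (a : υ × 𝒳 × 𝒴 × 𝒴₁),
            0 ≤ p a.1 * κ a.1 a.2.1 * W a.2.1 (s i) a.2.2 := fun i a =>
          mul_nonneg (mul_nonneg (hp.1 _) ((hκ _).1 _)) ((hW _ _).1 _)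
        exact sum_ind_not_le_pow hP hl fun i => h (s i)

/-- Finite-length random coding bound for partial decode-forward with score decoding. -/
theorem exists_code_errJoint_le (hW : IsChannel W) {p : υ → ℝ} (hp : IsPMF p)
    {κ : υ → 𝒳 → ℝ} (hκ : ∀ u, IsPMF (κ u)) {qn : (Fin n → 𝒮) → ℝ} (hqn : IsPMF qn)
    {φ1 : υ → 𝒴₁ → ℝ} (hφ1 : ∀ y1, ∑ u, p u * (2 : ℝ) ^ φ1 u y1 ≤ 1)
    {φ2 : υ → 𝒴 → ℝ} (hφ2 : ∀ y, ∑ u, p u * (2 : ℝ) ^ φ2 u y ≤ 1)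
    {φ3 : υ → 𝒳 → 𝒴 → ℝ} (hφ3 : ∀ u y, ∑ x, κ u x * (2 : ℝ) ^ φ3 u x y ≤ 1)
    {γ1 γ2 γ3 l1 l2 l3 ρ1 ρ2 ρ3 : ℝ} (hl1 : 0 < l1) (hl2 : 0 < l2) (hl3 : 0 < l3)
    (hρ1 : ∀ s, ∑ a : υ × 𝒳 × 𝒴 × 𝒴₁, p a.1 * κ a.1 a.2.1 * W a.2.1 s a.2.2 *
      Real.exp (-(l1 * (φ1 a.1 a.2.2.2 - γ1))) ≤ ρ1)
    (hρ2 : ∀ s, ∑ a : υ × 𝒳 × 𝒴 × 𝒴₁, p a.1 * κ a.1 a.2.1 * W a.2.1 s a.2.2 *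
      Real.exp (-(l2 * (φ2 a.1 a.2.2.1 - γ2))) ≤ ρ2)
    (hρ3 : ∀ s, ∑ a : υ × 𝒳 × 𝒴 × 𝒴₁, p a.1 * κ a.1 a.2.1 * W a.2.1 s a.2.2 *
      Real.exp (-(l3 * (φ3 a.1 a.2.1 a.2.2.1 - γ3))) ≤ ρ3)
    (L B J : ℕ) [NeZero L] [NeZero B] [NeZero J] :
    ∃ C : PCode 𝒳 𝒴 𝒴₁ n (L * (B * J)) L, C.errJoint W qn ≤ ρ1 ^ n + ρ2 ^ n + ρ3 ^ n
      + (L * B - 1) * (2 : ℝ) ^ (-(n * γ1)) + (B - 1) * (2 : ℝ) ^ (-(n * γ2))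
      + (J - 1) * (2 : ℝ) ^ (-(n * γ3)) := by
  obtain ⟨f, f1, g, hfg⟩ := exists_superposition_code (Λ := Fin L) (B := Fin B) (J := Fin J)
    (P := fun u : Fin n → υ => ∏ i, p (u i)) (isPMF_pi fun _ => hp)
    (K := fun u (x : Fin n → 𝒳) => ∏ i, κ (u i) (x i)) (fun u => isPMF_pi fun _ => hκ _)
    (V := fun x (y : Fin n → 𝒴) (y1 : Fin n → 𝒴₁) => ∑ s, qn s * ∏ i, W (x i) (s i) (y i, y1 i))
    (fun x y y1 => Finset.sum_nonneg fun s _ => mul_nonneg (hqn.1 s)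
      (Finset.prod_nonneg fun i _ => (hW _ _).1 _))
    (fun x => by
      have h := sum_mixture_eq (fun _ : Unit => 1) (fun _ (_ : Unit) => 1) qn
        (fun _ s (y : Fin n → 𝒴) (y1 : Fin n → 𝒴₁) => ∏ i, W (x i) (s i) (y i, y1 i))
        (fun _ _ _ _ => 1)
      simp only [Finset.univ_unique, Finset.sum_const, Finset.card_singleton, one_smul, one_mul,
        mul_one] at h
      rw [h]
      simp_rw [sum_prod_channel_eq_one hW, mul_one, hqn.2])
    (A1 := fun u y1 => n * γ1 ≤ ∑ i, φ1 (u i) (y1 i))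
    (A2 := fun u y => n * γ2 ≤ ∑ i, φ2 (u i) (y i))
    (A3 := fun u x y => n * γ3 ≤ ∑ i, φ3 (u i) (x i) (y i))
    (fun y1 => sum_ind_le_of_sum_rpow_le_one (w := fun _ => p) (φ := fun i u => φ1 u (y1 i))
      (fun _ => hp.1) (fun i => hφ1 _) _)
    (fun y => sum_ind_le_of_sum_rpow_le_one (w := fun _ => p) (φ := fun i u => φ2 u (y i))
      (fun _ => hp.1) (fun i => hφ2 _) _)
    (fun u y => sum_ind_le_of_sum_rpow_le_one (w := fun i => κ (u i))
      (φ := fun i x => φ3 (u i) x (y i)) (fun i => (hκ _).1) (fun i => hφ3 _ _) _)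
    (sum_blocks_ind_not_le_pow hW hp hκ hqn hl1 (ψ := fun a => φ1 a.1 a.2.2.2) hρ1)
    (sum_blocks_ind_not_le_pow hW hp hκ hqn hl2 (ψ := fun a => φ2 a.1 a.2.2.1) hρ2)
    (sum_blocks_ind_not_le_pow hW hp hκ hqn hl3 (ψ := fun a => φ3 a.1 a.2.1 a.2.2.1) hρ3)
  simp only [Fintype.card_fin] at hfg
  let e : Fin L × Fin B × Fin J ≃ Fin (L * (B * J)) :=
    ((Equiv.refl _).prodCongr finProdFinEquiv).trans finProdFinEquiv
  refine ⟨⟨fun m => f (e.symm m), f1, fun t => e (g t)⟩, (le_of_eq ?_).trans hfg⟩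
  simp only [PCode.errJoint, PCode.errGiven]
  simp_rw [mul_left_comm (qn _), ← Finset.mul_sum]
  congr 1
  · simp
  simp_rw [Finset.mul_sum]
  rw [Finset.sum_comm, ← e.sum_comp]
  refine Finset.sum_congr rfl fun m _ => ?_
  rw [Finset.sum_comm]
  refine Finset.sum_congr rfl fun y _ => ?_
  rw [Finset.sum_comm]
  refine Finset.sum_congr rfl fun y1 _ => ?_
  simp only [Equiv.symm_apply_apply, EmbeddingLike.apply_eq_iff_eq]
  split_ifs with h <;> simp

end FiniteLength

section ScoreAchievability

theorem sub_one_mul_rpow_neg_le {X γ τ : ℝ} {n : ℕ}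
    (hX : X ≤ (2 : ℝ) ^ ((n : ℝ) * max (γ - τ) 0)) :
    (X - 1) * (2 : ℝ) ^ (-(n * γ)) ≤ (2 : ℝ) ^ (-(n * τ)) := by
  rcases le_total (γ - τ) 0 with h | h
  · rw [max_eq_right h, mul_zero, Real.rpow_zero] at hX
    have h1 : (0 : ℝ) < 2 ^ (-(n * γ)) := by positivity
    have h2 : (0 : ℝ) < 2 ^ (-(n * τ)) := by positivity
    nlinarith
  · rw [max_eq_left h] at hX
    calc _ ≤ (2 : ℝ) ^ ((n : ℝ) * (γ - τ)) * (2 : ℝ) ^ (-(n * γ)) := by gcongr; linarith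
      _ = _ := by rw [← Real.rpow_add two_pos]; ring_nf

theorem half_le_floor {x : ℝ} (hx : 1 ≤ x) : x / 2 ≤ ⌊x⌋₊ := by
  have h1 := Nat.lt_floor_add_one x
  have h2 : (1 : ℝ) ≤ ⌊x⌋₊ := by exact_mod_cast (Nat.one_le_floor_iff x).2 hx
  linarith

variable {υ 𝒳 𝒮 𝒴 𝒴₁ : Type} [Fintype υ] [Fintype 𝒳] [Fintype 𝒮] [Fintype 𝒴] [Fintype 𝒴₁]
  {W : 𝒳 → 𝒮 → 𝒴 × 𝒴₁ → ℝ}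

theorem exists_chernoff_channel (hW : IsChannel W) {p : υ → ℝ} (hp : IsPMF p) {κ : υ → 𝒳 → ℝ}
    (hκ : ∀ u, IsPMF (κ u)) {ψ : υ × 𝒳 × 𝒴 × 𝒴₁ → ℝ} {γ : ℝ}
    (h : ∀ s, γ < ∑ a : υ × 𝒳 × 𝒴 × 𝒴₁, p a.1 * κ a.1 a.2.1 * W a.2.1 s a.2.2 * ψ a) :
    ∃ l ρ : ℝ, 0 < l ∧ 0 ≤ ρ ∧ ρ < 1 ∧ ∀ s, ∑ a : υ × 𝒳 × 𝒴 × 𝒴₁,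
      p a.1 * κ a.1 a.2.1 * W a.2.1 s a.2.2 * Real.exp (-(l * (ψ a - γ))) ≤ ρ := by
  have hP : ∀ s, IsPMF fun a : υ × 𝒳 × 𝒴 × 𝒴₁ => p a.1 * κ a.1 a.2.1 * W a.2.1 s a.2.2 := by
    refine fun s => ⟨fun a =>
      mul_nonneg (mul_nonneg (hp.1 _) ((hκ _).1 _)) ((hW _ _).1 _), ?_⟩
    rw [Fintype.sum_prod_type]
    simp_rw [Fintype.sum_prod_type (α₁ := 𝒳), ← Finset.mul_sum, (hW _ _).2, mul_one,
      ← Finset.mul_sum, (hκ _).2, mul_one, hp.2]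
  refine exists_chernoff hP fun s => ?_
  simp_rw [mul_sub, Finset.sum_sub_distrib, ← Finset.sum_mul]
  rw [(hP s).2, one_mul]
  linarith [h s]

theorem weakAchievable_of_scores (hW : IsChannel W) {p : υ → ℝ} (hp : IsPMF p)
    {κ : υ → 𝒳 → ℝ} (hκ : ∀ u, IsPMF (κ u))
    {φ1 : υ → 𝒴₁ → ℝ} (hφ1 : ∀ y1, ∑ u, p u * (2 : ℝ) ^ φ1 u y1 ≤ 1)
    {φ2 : υ → 𝒴 → ℝ} (hφ2 : ∀ y, ∑ u, p u * (2 : ℝ) ^ φ2 u y ≤ 1)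
    {φ3 : υ → 𝒳 → 𝒴 → ℝ} (hφ3 : ∀ u y, ∑ x, κ u x * (2 : ℝ) ^ φ3 u x y ≤ 1)
    {γ1 γ2 γ3 : ℝ}
    (h1 : ∀ s, γ1 < ∑ a : υ × 𝒳 × 𝒴 × 𝒴₁,
      p a.1 * κ a.1 a.2.1 * W a.2.1 s a.2.2 * φ1 a.1 a.2.2.2)
    (h2 : ∀ s, γ2 < ∑ a : υ × 𝒳 × 𝒴 × 𝒴₁,
      p a.1 * κ a.1 a.2.1 * W a.2.1 s a.2.2 * φ2 a.1 a.2.2.1)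
    (h3 : ∀ s, γ3 < ∑ a : υ × 𝒳 × 𝒴 × 𝒴₁,
      p a.1 * κ a.1 a.2.1 * W a.2.1 s a.2.2 * φ3 a.1 a.2.1 a.2.2.1)
    {C1 R ℓ b r τ : ℝ} (hℓ0 : 0 ≤ ℓ) (hb0 : 0 ≤ b) (hr0 : 0 ≤ r) (hτ : 0 < τ) (hℓ : ℓ ≤ C1)
    (hℓb : ℓ + b ≤ max (γ1 - τ) 0) (hb : b ≤ max (γ2 - τ) 0) (hr : r ≤ max (γ3 - τ) 0)
    (hR : R < ℓ + b + r) : WeakAchievable W C1 R := by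
  obtain ⟨l1, ρ1, hl1, hρ10, hρ11, hρ1⟩ := exists_chernoff_channel hW hp hκ h1
  obtain ⟨l2, ρ2, hl2, hρ20, hρ21, hρ2⟩ := exists_chernoff_channel hW hp hκ h2
  obtain ⟨l3, ρ3, hl3, hρ30, hρ31, hρ3⟩ := exists_chernoff_channel hW hp hκ h3
  have hlim : Filter.Tendsto (fun n : ℕ => ρ1 ^ n + ρ2 ^ n + ρ3 ^ n + 3 * ((2 : ℝ) ^ (-τ)) ^ n)
      Filter.atTop (nhds (0 + 0 + 0 + 3 * 0)) :=
    (((tendsto_pow_atTop_nhds_zero_of_lt_one hρ10 hρ11).add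
      (tendsto_pow_atTop_nhds_zero_of_lt_one hρ20 hρ21)).add
      (tendsto_pow_atTop_nhds_zero_of_lt_one hρ30 hρ31)).add
      ((tendsto_pow_atTop_nhds_zero_of_lt_one (by positivity)
        (Real.rpow_lt_one_of_one_lt_of_neg one_lt_two (neg_lt_zero.2 hτ))).const_mul 3)
  intro ε hε
  obtain ⟨N₁, hN₁⟩ := Filter.eventually_atTop.1 (hlim.eventually_le_const
    (u := ε) (by simpa using hε))
  obtain ⟨N₂, hN₂⟩ := exists_nat_ge (3 / (ℓ + b + r - R))
  refine ⟨max N₁ N₂, fun n hn => ?_⟩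
  have hpos : 0 < ℓ + b + r - R := by linarith
  have hn3 : 3 ≤ n * (ℓ + b + r - R) := by
    rw [← div_le_iff₀ hpos]
    exact hN₂.trans (by exact_mod_cast (le_max_right _ _).trans hn)
  have hone : ∀ {t : ℝ}, 0 ≤ t → (1 : ℝ) ≤ 2 ^ ((n : ℝ) * t) := fun ht =>
    Real.one_le_rpow one_le_two (by positivity)
  have hle : ∀ t : ℝ, (⌊(2 : ℝ) ^ ((n : ℝ) * t)⌋₊ : ℝ) ≤ 2 ^ ((n : ℝ) * t) := fun t =>
    Nat.floor_le (by positivity)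
  have hfl : ∀ {t : ℝ}, 0 ≤ t → 1 ≤ ⌊(2 : ℝ) ^ ((n : ℝ) * t)⌋₊ := fun ht =>
    (Nat.one_le_floor_iff _).2 (hone ht)
  have hmono : ∀ {t t' : ℝ}, t ≤ t' → (2 : ℝ) ^ ((n : ℝ) * t) ≤ 2 ^ ((n : ℝ) * t') := fun h =>
    Real.rpow_le_rpow_of_exponent_le one_le_two (by gcongr)
  have hL := hfl hℓ0
  have hB := hfl hb0
  have hJ := hfl hr0
  set L := ⌊(2 : ℝ) ^ ((n : ℝ) * ℓ)⌋₊
  set B := ⌊(2 : ℝ) ^ ((n : ℝ) * b)⌋₊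
  set J := ⌊(2 : ℝ) ^ ((n : ℝ) * r)⌋₊
  have : NeZero L := ⟨by omega⟩
  have : NeZero B := ⟨by omega⟩
  have : NeZero J := ⟨by omega⟩
  refine ⟨L * (B * J), L, ?_, ⟨hL, (hle ℓ).trans (hmono hℓ)⟩, fun qn hqn => ?_⟩
  · push_cast
    calc (2 : ℝ) ^ ((n : ℝ) * R) ≤ 2 ^ (n * ℓ + (n * b + n * r) + -3) :=
          Real.rpow_le_rpow_of_exponent_le one_le_two (by nlinarith)
      _ = (2 ^ (n * ℓ) / 2) * ((2 ^ (n * b) / 2) * (2 ^ (n * r) / 2)) := by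
          rw [Real.rpow_add two_pos, Real.rpow_add two_pos, Real.rpow_add two_pos,
            show (2 : ℝ) ^ (-3 : ℝ) = 1 / 8 by
              rw [Real.rpow_neg two_pos.le]; norm_num]
          ring
      _ ≤ L * (B * J) := by
          gcongr
          exacts [half_le_floor (hone hℓ0), half_le_floor (hone hb0), half_le_floor (hone hr0)]
  · obtain ⟨C, hC⟩ := exists_code_errJoint_le hW hp hκ hqn hφ1 hφ2 hφ3 hl1 hl2 hl3 hρ1 hρ2 hρ3
      L B J
    refine ⟨C, hC.trans ?_⟩
    have hLB : (L * B : ℝ) ≤ (2 : ℝ) ^ ((n : ℝ) * max (γ1 - τ) 0) := by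
      refine (mul_le_mul (hle ℓ) (hle b) (by positivity) (by positivity)).trans ?_
      rw [← Real.rpow_add two_pos, ← mul_add]
      exact hmono hℓb
    have e1 := sub_one_mul_rpow_neg_le hLB
    have e2 := sub_one_mul_rpow_neg_le ((hle b).trans (hmono hb))
    have e3 := sub_one_mul_rpow_neg_le ((hle r).trans (hmono hr))
    have hτn : (2 : ℝ) ^ (-(n * τ)) = ((2 : ℝ) ^ (-τ)) ^ n := by
      rw [← Real.rpow_natCast, ← Real.rpow_mul two_pos.le]; ring_nf
    rw [hτn] at e1 e2 e3
    have := hN₁ n ((le_max_left _ _).trans hn)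
    linarith

end ScoreAchievability

section DecodeForward

section Bounded

variable {σ υ α β : Type} [Fintype σ] [Fintype υ] [Fintype α] [Fintype β]

theorem neg_card_le_mutInfo {p : α × β → ℝ} (hp : IsPMF p) :
    -(Fintype.card (α × β) / Real.log 2) ≤ mutInfo p := by
  have h1 := (isPMF_marginal hp).ent_nonneg
  have h2 := (isPMF_marginal' hp).ent_nonneg
  have h3 := ent_le_card hp.1
  unfold mutInfo
  linarith

theorem neg_card_le_condMutInfo {p : υ × α × β → ℝ} (hp : IsPMF p) :
    -(Fintype.card (υ × α × β) / Real.log 2 + Fintype.card υ / Real.log 2) ≤ condMutInfo p := by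
  have hsum : ∑ u, ∑ a, ∑ b, p (u, a, b) = 1 := by
    rw [← hp.2, Fintype.sum_prod_type]
    simp_rw [Fintype.sum_prod_type (α₁ := α)]
  have h1 := IsPMF.ent_nonneg (p := fun ua : υ × α => ∑ b, p (ua.1, ua.2, b))
    ⟨fun _ => Finset.sum_nonneg fun _ _ => hp.1 _, by rw [Fintype.sum_prod_type]; exact hsum⟩
  have h2 := IsPMF.ent_nonneg (p := fun ub : υ × β => ∑ a, p (ub.1, a, ub.2))
    ⟨fun _ => Finset.sum_nonneg fun _ _ => hp.1 _, by
      rw [Fintype.sum_prod_type, ← hsum]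
      exact Finset.sum_congr rfl fun u _ => Finset.sum_comm⟩
  have h3 := ent_le_card hp.1
  have h4 := ent_le_card (p := fun u => ∑ a, ∑ b, p (u, a, b)) fun u =>
    Finset.sum_nonneg fun _ _ => Finset.sum_nonneg fun _ _ => hp.1 _
  unfold condMutInfo
  linarith

theorem isPMF_mixture {T : σ → α → ℝ} (hT : ∀ s, IsPMF (T s)) {q : σ → ℝ} (hq : IsPMF q) :
    IsPMF fun a => ∑ s, q s * T s a := by
  refine ⟨fun a => Finset.sum_nonneg fun s _ => mul_nonneg (hq.1 s) ((hT s).1 a), ?_⟩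
  rw [Finset.sum_comm]
  simp_rw [← Finset.mul_sum, (hT _).2, mul_one, hq.2]

theorem lt_mutInfo_of_lt_sInf {T : σ → α × β → ℝ} (hT : ∀ s, IsPMF (T s)) {γ : ℝ}
    (h : γ < sInf {v | ∃ q ∈ {q : σ → ℝ | IsPMF q}, v = mutInfo fun t => ∑ s, q s * T s t})
    (q : σ → ℝ) (hq : IsPMF q) : γ < mutInfo fun t => ∑ s, q s * T s t :=
  h.trans_le <| csInf_le ⟨_, by
    rintro _ ⟨q, hq, rfl⟩
    exact neg_card_le_mutInfo (isPMF_mixture hT hq)⟩ ⟨q, hq, rfl⟩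

theorem lt_condMutInfo_of_lt_sInf {T : σ → υ × α × β → ℝ} (hT : ∀ s, IsPMF (T s)) {γ : ℝ}
    (h : γ < sInf {v | ∃ q ∈ {q : σ → ℝ | IsPMF q}, v = condMutInfo fun t => ∑ s, q s * T s t})
    (q : σ → ℝ) (hq : IsPMF q) : γ < condMutInfo fun t => ∑ s, q s * T s t :=
  h.trans_le <| csInf_le ⟨_, by
    rintro _ ⟨q, hq, rfl⟩
    exact neg_card_le_condMutInfo (isPMF_mixture hT hq)⟩ ⟨q, hq, rfl⟩

end Bounded

theorem exists_conditional {υ α : Type} [Fintype υ] [Fintype α] [Nonempty α] {p : υ × α → ℝ}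
    (hp : ∀ t, 0 ≤ p t) :
    ∃ κ : υ → α → ℝ, (∀ u, IsPMF (κ u)) ∧ ∀ u a, (∑ a, p (u, a)) * κ u a = p (u, a) := by
  classical
  refine ⟨fun u => if ∑ a, p (u, a) = 0 then fun b => if b = Classical.arbitrary α then 1 else 0
    else fun a => p (u, a) / ∑ a, p (u, a), fun u => ?_, fun u a => ?_⟩
  · dsimp only
    split_ifs with h
    · exact isPMF_single _
    · exact ⟨fun a => div_nonneg (hp _) (Finset.sum_nonneg fun _ _ => hp _), by
        rw [← Finset.sum_div, div_self h]⟩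
  · dsimp only
    split_ifs with h
    · rw [h, zero_mul, (Finset.sum_eq_zero_iff_of_nonneg fun _ _ => hp _).1 h a (Finset.mem_univ a)]
    · exact mul_div_cancel₀ _ h

theorem exists_rate_split {I1 I2 I3 C R : ℝ} (hC : 0 ≤ C) (h1 : R < I2 + I3 + C)
    (h2 : R < I1 + I3) :
    ∃ ℓ b r τ : ℝ, 0 ≤ ℓ ∧ 0 ≤ b ∧ 0 ≤ r ∧ 0 < τ ∧ ℓ ≤ C ∧ ℓ + b ≤ max (I1 - τ - τ) 0 ∧
      b ≤ max (I2 - τ - τ) 0 ∧ r ≤ max (I3 - τ - τ) 0 ∧ R < ℓ + b + r := by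
  obtain ⟨τ, hτ, hτ1, hτ2⟩ : ∃ τ : ℝ, 0 < τ ∧ R + 4 * τ < I2 + I3 + C ∧ R + 4 * τ < I1 + I3 := by
    have h : 0 < min (I2 + I3 + C) (I1 + I3) - R := sub_pos.2 (lt_min h1 h2)
    have := min_le_left (I2 + I3 + C) (I1 + I3)
    have := min_le_right (I2 + I3 + C) (I1 + I3)
    exact ⟨(min (I2 + I3 + C) (I1 + I3) - R) / 8, by linarith, by linarith, by linarith⟩
  have e1 := le_max_left (I1 - τ - τ) 0
  have e2 := le_max_left (I2 - τ - τ) 0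
  have e3 := le_max_left (I3 - τ - τ) 0
  have f1 := le_max_right (I1 - τ - τ) 0
  have f2 := le_max_right (I2 - τ - τ) 0
  have f3 := le_max_right (I3 - τ - τ) 0
  set m1 := max (I1 - τ - τ) 0
  set m2 := max (I2 - τ - τ) 0
  set m3 := max (I3 - τ - τ) 0
  refine ⟨min C (m1 - min m2 m1), min m2 m1, m3, τ, le_min hC (by linarith [min_le_right m2 m1]),
    le_min f2 f1, f3, hτ, min_le_left _ _, by linarith [min_le_right C (m1 - min m2 m1)],
    min_le_left _ _, le_rfl, ?_⟩
  rcases min_cases m2 m1 with ⟨h, -⟩ | ⟨h, -⟩ <;> rw [h] <;>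
  rcases min_cases C (m1 - min m2 m1) with ⟨h', -⟩ | ⟨h', -⟩ <;> rw [h] at h' <;> rw [h'] <;>
    linarith

theorem isPMF_satellite {υ 𝒳 β : Type} [Fintype υ] [Fintype 𝒳] [Fintype β] {V : 𝒳 → β → ℝ}
    (hV : ∀ x, IsPMF (V x)) {p : υ × 𝒳 → ℝ} (hp : IsPMF p) :
    IsPMF fun t : υ × 𝒳 × β => p (t.1, t.2.1) * V t.2.1 t.2.2 := by
  refine ⟨fun t => mul_nonneg (hp.1 _) ((hV _).1 _), ?_⟩
  rw [Fintype.sum_prod_type]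
  simp_rw [Fintype.sum_prod_type (α₁ := 𝒳), ← Finset.mul_sum, (hV _).2, mul_one]
  rw [← Fintype.sum_prod_type', hp.2]

theorem isPMF_cloud {υ 𝒳 β : Type} [Fintype υ] [Fintype 𝒳] [Fintype β] {V : 𝒳 → β → ℝ}
    (hV : ∀ x, IsPMF (V x)) {p : υ × 𝒳 → ℝ} (hp : IsPMF p) :
    IsPMF fun t : υ × β => ∑ x, p (t.1, x) * V x t.2 := by
  refine ⟨fun t => Finset.sum_nonneg fun x _ => mul_nonneg (hp.1 _) ((hV _).1 _), ?_⟩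
  rw [← (isPMF_satellite hV hp).2, Fintype.sum_prod_type, Fintype.sum_prod_type]
  refine Finset.sum_congr rfl fun u _ => ?_
  rw [Finset.sum_comm, Fintype.sum_prod_type]

section Scores

variable {υ 𝒳 𝒮 β : Type} [Fintype υ] [Fintype 𝒳] [Fintype 𝒮] [Fintype β] [Nonempty 𝒮]
  {V : 𝒳 → 𝒮 → β → ℝ}

theorem exists_cloud_score (hV : IsChannel V) {p : υ × 𝒳 → ℝ} (hp : IsPMF p) {γ : ℝ}
    (h : γ < sInf {v | ∃ q ∈ {q : 𝒮 → ℝ | IsPMF q},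
      v = mutInfo fun t : υ × β => ∑ s, q s * ∑ x, p (t.1, x) * V x s t.2}) :
    ∃ φ : υ → β → ℝ, (∀ b, ∑ u, (∑ x, p (u, x)) * (2 : ℝ) ^ φ u b ≤ 1) ∧
      ∀ s, γ < ∑ u, ∑ x, ∑ b, p (u, x) * V x s b * φ u b := by
  obtain ⟨φ, hφ, hm⟩ := exists_score_mutInfo
    (T := fun s (u : υ) (b : β) => ∑ x, p (u, x) * V x s b)
    (fun s u b => Finset.sum_nonneg fun x _ => mul_nonneg (hp.1 _) ((hV _ _).1 _))
    (p := fun u => ∑ x, p (u, x))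
    (fun s u => by
      rw [Finset.sum_comm]
      simp_rw [← Finset.mul_sum, (hV _ _).2, mul_one])
    (by rw [← Fintype.sum_prod_type, hp.2])
    (lt_mutInfo_of_lt_sInf (T := fun s (t : υ × β) => ∑ x, p (t.1, x) * V x s t.2)
      (fun s => isPMF_cloud (fun x => hV x s) hp) h)
  refine ⟨φ, hφ, fun s => (hm s).trans_le (le_of_eq ?_)⟩
  refine Finset.sum_congr rfl fun u _ => ?_
  simp_rw [Finset.sum_mul]
  exact Finset.sum_comm

theorem exists_satellite_score (hV : IsChannel V) {p : υ × 𝒳 → ℝ} (hp : IsPMF p)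
    {κ : υ → 𝒳 → ℝ} (hκ : ∀ u, IsPMF (κ u))
    (hpκ : ∀ u x, (∑ x, p (u, x)) * κ u x = p (u, x)) {γ : ℝ}
    (h : γ < sInf {v | ∃ q ∈ {q : 𝒮 → ℝ | IsPMF q},
      v = condMutInfo fun t : υ × 𝒳 × β => ∑ s, q s * (p (t.1, t.2.1) * V t.2.1 s t.2.2)}) :
    ∃ φ : υ → 𝒳 → β → ℝ, (∀ u b, ∑ x, κ u x * (2 : ℝ) ^ φ u x b ≤ 1) ∧
      ∀ s, γ < ∑ u, ∑ x, ∑ b, p (u, x) * V x s b * φ u x b := by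
  classical
  obtain ⟨φ, hφ, hm⟩ := exists_score
    (T := fun s (u : υ) (x : 𝒳) (b : β) => p (u, x) * V x s b)
    (fun s u x b => mul_nonneg (hp.1 _) ((hV _ _).1 _)) (p := fun u x => p (u, x))
    (fun s u x => by rw [← Finset.mul_sum, (hV _ _).2, mul_one])
    (by rw [← Fintype.sum_prod_type', hp.2])
    (lt_condMutInfo_of_lt_sInf
      (T := fun s (t : υ × 𝒳 × β) => p (t.1, t.2.1) * V t.2.1 s t.2.2)
      (fun s => isPMF_satellite (fun x => hV x s) hp) h)
  refine ⟨fun u x b => if ∑ x, p (u, x) = 0 then 0 else φ u x b, fun u b => ?_, fun s => ?_⟩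
  · dsimp only
    split_ifs with hu
    · simp [(hκ u).2]
    · have hpos : 0 < ∑ x, p (u, x) :=
        lt_of_le_of_ne (Finset.sum_nonneg fun _ _ => hp.1 _) (Ne.symm hu)
      refine le_of_mul_le_mul_left ?_ hpos
      simp_rw [Finset.mul_sum, ← mul_assoc, hpκ, mul_one]
      exact hφ u b
  · refine (hm s).trans_le (le_of_eq ?_)
    refine Finset.sum_congr rfl fun u _ => Finset.sum_congr rfl fun x _ =>
      Finset.sum_congr rfl fun b _ => ?_
    dsimp only
    split_ifs with hu
    · rw [← hpκ u x, hu]; ring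
    · rfl

end Scores

variable {𝒳 𝒮 𝒴 𝒴₁ : Type} [Fintype 𝒳] [Fintype 𝒮] [Fintype 𝒴] [Fintype 𝒴₁]
  {W : 𝒳 → 𝒮 → 𝒴 × 𝒴₁ → ℝ}

theorem weakAchievable_of_lt_decodeForward [Nonempty 𝒳] [Nonempty 𝒮] (hW : IsChannel W) {k : ℕ}
    {p : Fin k × 𝒳 → ℝ} (hp : IsPMF p) {C1 R : ℝ} (hC1 : 0 ≤ C1)
    (hR : R < min
      (sInf {v | ∃ q ∈ {q : 𝒮 → ℝ | IsPMF q}, v = IqUY W p q}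
        + sInf {v | ∃ q ∈ {q : 𝒮 → ℝ | IsPMF q}, v = IqXYgivenU W p q} + C1)
      (sInf {v | ∃ q ∈ {q : 𝒮 → ℝ | IsPMF q}, v = IqUY1 W p q}
        + sInf {v | ∃ q ∈ {q : 𝒮 → ℝ | IsPMF q}, v = IqXYgivenU W p q})) :
    WeakAchievable W C1 R := by
  set VY : 𝒳 → 𝒮 → 𝒴 → ℝ := fun x s y => ∑ y1, W x s (y, y1) with hVY
  set VY1 : 𝒳 → 𝒮 → 𝒴₁ → ℝ := fun x s y1 => ∑ y, W x s (y, y1) with hVY1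
  have hVY' : IsChannel VY := fun x s => isPMF_marginal (hW x s)
  have hVY1' : IsChannel VY1 := fun x s => isPMF_marginal' (hW x s)
  have e2 : ∀ q : 𝒮 → ℝ, IqUY W p q
      = mutInfo fun t : Fin k × 𝒴 => ∑ s, q s * ∑ x, p (t.1, x) * VY x s t.2 := fun q => by
    refine congrArg mutInfo (funext fun t => ?_)
    simp_rw [hVY, Finset.mul_sum]
    rw [Finset.sum_comm]
    exact Finset.sum_congr rfl fun s _ => Finset.sum_congr rfl fun x _ =>
      Finset.sum_congr rfl fun y1 _ => by ring
  have e1 : ∀ q : 𝒮 → ℝ, IqUY1 W p q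
      = mutInfo fun t : Fin k × 𝒴₁ => ∑ s, q s * ∑ x, p (t.1, x) * VY1 x s t.2 := fun q => by
    refine congrArg mutInfo (funext fun t => ?_)
    simp_rw [hVY1, Finset.mul_sum]
    rw [Finset.sum_comm]
    exact Finset.sum_congr rfl fun s _ => Finset.sum_congr rfl fun x _ =>
      Finset.sum_congr rfl fun y _ => by ring
  have e3 : ∀ q : 𝒮 → ℝ, IqXYgivenU W p q = condMutInfo fun t : Fin k × 𝒳 × 𝒴 =>
      ∑ s, q s * (p (t.1, t.2.1) * VY t.2.1 s t.2.2) := fun q => by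
    refine congrArg condMutInfo (funext fun t => ?_)
    rw [Finset.mul_sum]
    exact Finset.sum_congr rfl fun s _ => by ring
  simp_rw [e1, e2, e3] at hR
  obtain ⟨ℓ, b, r, τ, hℓ0, hb0, hr0, hτ, hℓ, hℓb, hb, hr, hlt⟩ :=
    exists_rate_split hC1 (hR.trans_le (min_le_left _ _)) (hR.trans_le (min_le_right _ _))
  obtain ⟨κ, hκ, hpκ⟩ := exists_conditional hp.1
  obtain ⟨φ1, hφ1, h1⟩ := exists_cloud_score hVY1' hp (sub_lt_self _ hτ)
  obtain ⟨φ2, hφ2, h2⟩ := exists_cloud_score hVY' hp (sub_lt_self _ hτ)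
  obtain ⟨φ3, hφ3, h3⟩ := exists_satellite_score hVY' hp hκ hpκ (sub_lt_self _ hτ)
  have hmean : ∀ (s : 𝒮) (φ : Fin k → 𝒳 → 𝒴 → 𝒴₁ → ℝ),
      ∑ a : Fin k × 𝒳 × 𝒴 × 𝒴₁, (∑ x, p (a.1, x)) * κ a.1 a.2.1 * W a.2.1 s a.2.2 *
        φ a.1 a.2.1 a.2.2.1 a.2.2.2
      = ∑ u, ∑ x, ∑ y, ∑ y1, p (u, x) * W x s (y, y1) * φ u x y y1 := fun s φ => by
    simp_rw [hpκ]
    rw [Fintype.sum_prod_type]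
    simp_rw [Fintype.sum_prod_type (α₁ := 𝒳), Fintype.sum_prod_type (α₁ := 𝒴)]
  refine weakAchievable_of_scores hW (p := fun u => ∑ x, p (u, x)) (isPMF_marginal hp) hκ
    hφ1 hφ2 hφ3 (fun s => (h1 s).trans_le (le_of_eq ?_)) (fun s => (h2 s).trans_le (le_of_eq ?_))
    (fun s => (h3 s).trans_le (le_of_eq ?_)) hℓ0 hb0 hr0 hτ hℓ hℓb hb hr hlt
  · rw [hmean s fun u _ _ y1 => φ1 u y1]
    refine Finset.sum_congr rfl fun u _ => Finset.sum_congr rfl fun x _ => ?_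
    rw [Finset.sum_comm]
    simp_rw [hVY1, Finset.mul_sum, Finset.sum_mul]
  · rw [hmean s fun u _ y _ => φ2 u y]
    simp_rw [hVY, Finset.mul_sum, Finset.sum_mul]
  · rw [hmean s fun u x y _ => φ3 u x y]
    simp_rw [hVY, Finset.mul_sum, Finset.sum_mul]

end DecodeForward

section EmptyStates

variable {𝒳 𝒮 𝒴 𝒴₁ : Type} [Fintype 𝒮] [Fintype 𝒴] [Fintype 𝒴₁] [IsEmpty 𝒮]
  {W : 𝒳 → 𝒮 → 𝒴 × 𝒴₁ → ℝ} {C1 : ℝ}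

theorem AVRCAchievable.of_isEmpty [Nonempty 𝒳] (hC1 : 0 ≤ C1) (R : ℝ) :
    AVRCAchievable W C1 R := by
  refine fun ε _ => ⟨1, fun n hn => ?_⟩
  have hM : 0 < ⌈(2 : ℝ) ^ ((n : ℝ) * R)⌉₊ := Nat.ceil_pos.2 (by positivity)
  refine ⟨⌈(2 : ℝ) ^ ((n : ℝ) * R)⌉₊, 1,
    ⟨fun _ _ => Classical.arbitrary 𝒳, fun _ => 0, fun _ => ⟨0, hM⟩⟩, Nat.le_ceil _,
    ⟨le_rfl, ?_⟩, fun qn hqn => ?_⟩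
  · rw [Nat.cast_one]
    exact Real.one_le_rpow one_le_two (by positivity)
  · obtain ⟨s⟩ := hqn.nonempty
    exact isEmptyElim (s ⟨0, hn⟩)

theorem setOf_isPMF_eq_empty : {q : 𝒮 → ℝ | IsPMF q} = ∅ :=
  Set.eq_empty_of_forall_notMem fun q hq => by
    obtain ⟨s⟩ := IsPMF.nonempty hq
    exact isEmptyElim s

end EmptyStates

/-- If the marginal sender-to-relay channel `W_{Y₁|X,S}` is non-symmetrizable and
`C₁ > 0`, then the deterministic code capacity of the primitive AVRC coincides with
its random code capacity, and consequently it lies between the partial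
decode-forward bound `R_DF*` and the cutset bound `R_CS*` (evaluated with the state
set equal to the whole simplex). -/
theorem avrc_detCapacity_of_nonSymmetrizable
    {𝒳 𝒮 𝒴 𝒴₁ : Type} [Fintype 𝒳] [Fintype 𝒮] [Fintype 𝒴] [Fintype 𝒴₁] [Nonempty 𝒳]
    (W : 𝒳 → 𝒮 → 𝒴 × 𝒴₁ → ℝ) (hW : IsChannel W)
    (C1 : ℝ) (hC1 : 0 < C1)
    (hnonsym : ¬ Symmetrizable (fun x s y1 => ∑ y, W x s (y, y1))) :
    AVRCCapacity W C1 = AVRCRandCapacity W C1 ∧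
    RDF W C1 {q : 𝒮 → ℝ | IsPMF q} ≤ AVRCCapacity W C1 ∧
    AVRCCapacity W C1 ≤ RCS W C1 {q : 𝒮 → ℝ | IsPMF q} := by
  classical
  rcases isEmpty_or_nonempty 𝒮 with h𝒮 | h𝒮
  · have hdet : {R | AVRCAchievable W C1 R} = Set.univ :=
      Set.eq_univ_of_forall fun R => .of_isEmpty hC1.le R
    have hrand : {R | AVRCRandAchievable W C1 R} = Set.univ :=
      Set.eq_univ_of_forall fun R => (AVRCAchievable.of_isEmpty hC1.le R).rand
    rw [AVRCCapacity, AVRCRandCapacity, hdet, hrand, Real.sSup_univ, setOf_isPMF_eq_empty]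
    refine ⟨rfl, Real.sSup_le ?_ le_rfl, ?_⟩
    · rintro _ ⟨k, p, -, rfl⟩
      simp [hC1.le]
    · simp [RCS]
  · have hdet : ∀ {R R' : ℝ}, WeakAchievable W C1 R → R' < R → AVRCAchievable W C1 R' :=
      fun h hR => h.det hW hC1 hnonsym hR
    have hbdd : ∀ R, AVRCAchievable W C1 R → R ≤ RCS W C1 {q : 𝒮 → ℝ | IsPMF q} :=
      fun R h => h.le_RCS hW
    have hne : ({R | AVRCAchievable W C1 R}).Nonempty := ⟨0, .of_nonpos hC1.le le_rfl⟩
    have hcap : ∀ R, WeakAchievable W C1 R → R ≤ AVRCCapacity W C1 := fun R h =>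
      le_of_forall_lt fun R' hR' => by
        obtain ⟨R'', h1, h2⟩ := exists_between hR'
        exact h1.trans_le (le_csSup ⟨_, hbdd⟩ (hdet h h2))
    refine ⟨le_antisymm ?_ ?_, ?_, csSup_le hne hbdd⟩
    · exact csSup_le_csSup ⟨_, fun R h => hcap R h.weak⟩ hne fun R h => h.rand
    · exact csSup_le (hne.mono fun R h => h.rand) fun R h => hcap R h.weak
    · refine csSup_le ⟨_, 1, _, isPMF_single (0, Classical.arbitrary 𝒳), rfl⟩ ?_
      rintro _ ⟨k, p, hp, rfl⟩
      refine le_of_forall_lt fun R hR => ?_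
      obtain ⟨R', h1, h2⟩ := exists_between hR
      exact h1.trans_le (hcap R' (weakAchievable_of_lt_decodeForward hW hp hC1.le h2))
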